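/- Suppose 0 < 1/n, 1/m ≪ ε ≪ 1/T, 1/a_1^Q ≪ δ ≪ ε_0 ≤ 1 and k ∈ ℕ∖{1}, and suppose a^Q ∈ [T]^{k−1}. Suppose R = (ε_0/2, a^O, d_{a^O,k}) is a regularity instance. Let V_1, V_2 be sets of sizes n, m, and let H_1^(k), H_2^(k) be k-graphs on V_1, V_2 respectively. Suppose (P1) Q_1 = Q_1(k−1, a^Q) is an (ε, a^Q, d_{a^Q,k})-equitable partition of H_1^(k); (P2) Q_2 = Q_2(k−1, a^Q) is an (ε, a^Q, d_{a^Q,k})-equitable partition of H_2^(k) (with the same a^Q and the same density function d_{a^Q,k}); and (P3) O_1 = O_1(k−1, a^O) is an (ε_0, a^O, d_{a^O,k})-equitable partition of H_1^(k). Then there exists an (ε_0+δ, a^O, d_{a^O,k})-equitable partition O_2 of H_2^(k). -/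

import Mathlib

namespace HypReg

open Finset

attribute [local instance 10] Classical.propDecidable

noncomputable section

variable {V : Type*} [DecidableEq V]

/-- Representation of a 1-graph: the set of singletons of `U`. -/
def sing (U : Finset V) : Finset (Finset V) :=
  U.image fun v => ({v} : Finset V)

/-- `Kset W j i B`: the i-element subsets of `W` all of whose j-element subsets lie in `B`. -/
def Kset (W : Finset V) (j i : ℕ) (B : Finset (Finset V)) : Finset (Finset V) :=
  (W.powersetCard i).filter fun S => ∀ T ∈ S.powersetCard j, T ∈ B

/-- Clique operator which, at level 1, uses the ambient family `cr` of crossing i-sets. -/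
def KsetC (W : Finset V) (cr : Finset (Finset V)) (j i : ℕ) (B : Finset (Finset V)) :
    Finset (Finset V) :=
  if j = 1 then cr.filter fun S => ∀ v ∈ S, ({v} : Finset V) ∈ B
  else Kset W j i B

/-- `A` (a (j+1)-graph) is (ε,d)-regular with respect to the j-graph `B` (plain clique sets). -/
def RegPair (W : Finset V) (j : ℕ) (ε d : ℝ) (A B : Finset (Finset V)) : Prop :=
  ∀ Q ⊆ B, ε * ((Kset W j (j+1) B).card : ℝ) ≤ ((Kset W j (j+1) Q).card : ℝ) →
    |((A ∩ Kset W j (j+1) Q).card : ℝ) - d * ((Kset W j (j+1) Q).card : ℝ)|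
      ≤ ε * ((Kset W j (j+1) Q).card : ℝ)

/-- (ε,d)-regularity with crossing-aware clique sets. -/
def RegPairC (W : Finset V) (cr : Finset (Finset V)) (j : ℕ) (ε d : ℝ)
    (A B : Finset (Finset V)) : Prop :=
  ∀ Q ⊆ B, ε * ((KsetC W cr j (j+1) B).card : ℝ) ≤ ((KsetC W cr j (j+1) Q).card : ℝ) →
    |((A ∩ KsetC W cr j (j+1) Q).card : ℝ) - d * ((KsetC W cr j (j+1) Q).card : ℝ)|
      ≤ ε * ((KsetC W cr j (j+1) Q).card : ℝ)

/-- Relative density `d(A | B)` of the (j+1)-graph `A` w.r.t. the j-graph `B`. -/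
def dens (W : Finset V) (cr : Finset (Finset V)) (j : ℕ) (A B : Finset (Finset V)) : ℝ :=
  if (KsetC W cr j (j+1) B).card = 0 then 0
  else ((A ∩ KsetC W cr j (j+1) B).card : ℝ) / ((KsetC W cr j (j+1) B).card : ℝ)

/-- `H` is a k-graph on the vertex set `W`. -/
def IsKGraph (W : Finset V) (k : ℕ) (H : Finset (Finset V)) : Prop :=
  ∀ e ∈ H, e ⊆ W ∧ e.card = k

/-- symmetric difference of two hypergraphs -/
def sd (A B : Finset (Finset V)) : Finset (Finset V) := (A \ B) ∪ (B \ A)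

/-- A (candidate) family of partitions: the ground set, the class of each vertex and,
for each level `j ≥ 2`, the class of each crossing j-set. -/
structure PartFam (V : Type*) [DecidableEq V] where
  gnd : Finset V
  vClass : V → Finset V
  cls : ℕ → Finset V → Finset (Finset V)

namespace PartFam

variable (F : PartFam V)

/-- crossing i-sets -/
def cross (i : ℕ) : Finset (Finset V) :=
  (F.gnd.powersetCard i).filter fun S =>
    ∀ u ∈ S, ∀ v ∈ S, u ≠ v → F.vClass u ≠ F.vClass v

/-- the level-j polyad of a vertex set `J` -/
def polyad (j : ℕ) (J : Finset V) : Finset (Finset V) :=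
  if j = 1 then sing (J.sup F.vClass) else (J.powersetCard j).sup (F.cls j)

/-- the clique set `K_j(P̂^{(j-1)}(J))` of the (j−1)-polyad of a crossing j-set `J` -/
def polyCliques (j : ℕ) (J : Finset V) : Finset (Finset V) :=
  KsetC F.gnd (F.cross j) (j-1) j (F.polyad (j-1) J)

/-- `F` is a family of partitions `P(k−1, a)`. -/
def IsFamily (k : ℕ) (a : ℕ → ℕ) : Prop :=
  (∀ v ∈ F.gnd, v ∈ F.vClass v) ∧
  (∀ v ∈ F.gnd, F.vClass v ⊆ F.gnd) ∧
  (∀ u ∈ F.gnd, ∀ v ∈ F.gnd, u ∈ F.vClass v → F.vClass u = F.vClass v) ∧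
  (F.gnd.image F.vClass).card = a 1 ∧ k ≤ a 1 ∧
  ∀ j, 2 ≤ j → j ≤ k - 1 →
    (∀ J ∈ F.cross j, J ∈ F.cls j J) ∧
    (∀ J ∈ F.cross j, ∀ I ∈ F.cls j J, F.cls j I = F.cls j J) ∧
    (∀ J ∈ F.cross j, F.cls j J ⊆ F.polyCliques j J) ∧
    (∀ J ∈ F.cross j, F.polyCliques j J ⊆ F.cross j) ∧
    (∀ J ∈ F.cross j, ((F.polyCliques j J).image (F.cls j)).card = a j)

/-- the regularity condition in the definition of an equitable family of partitions:
all polyad complexes of crossing k-sets are (ε, (1/a_2, …, 1/a_{k−1}))-regular. -/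
def PolyadReg (k : ℕ) (a : ℕ → ℕ) (ε : ℝ) : Prop :=
  ∀ K ∈ F.cross k, ∀ j, 2 ≤ j → j ≤ k - 1 → ∀ J ∈ K.powersetCard j,
    RegPairC F.gnd (F.cross j) (j-1) ε (1 / (a j : ℝ)) (F.polyad j K) (F.polyad (j-1) J)

/-- `(η, ε, a, λ)`-equitable family of partitions -/
def IsEquitable (k : ℕ) (a : ℕ → ℕ) (η ε lam : ℝ) : Prop :=
  1 ≤ η * (a 1 : ℝ) ∧
  (∀ v ∈ F.gnd, |((F.vClass v).card : ℝ) - (F.gnd.card : ℝ) / (a 1 : ℝ)|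
      ≤ lam * (F.gnd.card : ℝ) / (a 1 : ℝ)) ∧
  F.PolyadReg k a ε

/-- `(η, ε, a)`-equitable family of partitions (classes of size ⌊n/a₁⌋ or ⌊n/a₁⌋+1) -/
def IsEquitableE (k : ℕ) (a : ℕ → ℕ) (η ε : ℝ) : Prop :=
  1 ≤ η * (a 1 : ℝ) ∧
  (∀ v ∈ F.gnd, (F.vClass v).card = F.gnd.card / a 1 ∨
      (F.vClass v).card = F.gnd.card / a 1 + 1) ∧
  F.PolyadReg k a ε

/-- `G` is perfectly ε-regular with respect to `F`. -/
def PerfectlyRegular (k : ℕ) (ε : ℝ) (G : Finset (Finset V)) : Prop :=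
  ∀ K ∈ F.cross k, ∃ d : ℝ, 0 ≤ d ∧
    RegPairC F.gnd (F.cross k) (k-1) ε d G (F.polyad (k-1) K)

end PartFam

/-- `a` is a T-bounded vector of length k−1. -/
def BoundedVec (k T : ℕ) (a : ℕ → ℕ) : Prop := ∀ j, 1 ≤ j → j ≤ k - 1 → a j ≤ T

/-- level-j refinement `F^{(j)} ≺ P^{(j)}` between two families of partitions -/
def RefinesAt (F P : PartFam V) (j : ℕ) : Prop :=
  if j = 1 then ∀ v ∈ F.gnd, F.vClass v ⊆ P.vClass v
  else ∀ I ∈ F.cross j,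
    (∃ J ∈ P.cross j, F.cls j I ⊆ P.cls j J) ∨ ∀ S ∈ F.cls j I, S ∉ P.cross j

/-- level-j approximate refinement `F^{(j)} ≺_ν P^{(j)}` -/
def RefinesApproxAt (F P : PartFam V) (j : ℕ) (ν : ℝ) : Prop :=
  if j = 1 then
    ∃ f : Finset V → Finset V,
      (∀ v ∈ F.gnd, f (F.vClass v) ∈ F.gnd.image P.vClass) ∧
      ∑ C ∈ F.gnd.image F.vClass, ((C \ f C).card : ℝ) ≤ ν * (F.gnd.card : ℝ)
  else
    ∃ f : Finset (Finset V) → Finset (Finset V),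
      (∀ I ∈ F.cross j,
        f (F.cls j I) ∈ ((P.cross j).image (P.cls j)) ∪ {F.cross j \ P.cross j}) ∧
      ∑ C ∈ (F.cross j).image (F.cls j), ((C \ f C).card : ℝ) ≤ ν * ((F.cross j).card : ℝ)

/-- The address space: a base set (of class indices) together with a labelling of its subsets. -/
abbrev Addr := Finset ℕ × (Finset ℕ → ℕ)

/-- `x` is an element of the address space `Â(l, j, a)`. -/
def IsAddress (l j : ℕ) (a : ℕ → ℕ) (x : Addr) : Prop :=
  x.1.card = l ∧ (∀ i ∈ x.1, 1 ≤ i ∧ i ≤ a 1) ∧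
  (∀ L : Finset ℕ, L ⊆ x.1 → 2 ≤ L.card → L.card ≤ j → 1 ≤ x.2 L ∧ x.2 L ≤ a L.card) ∧
  (∀ L : Finset ℕ, ¬(L ⊆ x.1 ∧ 2 ≤ L.card ∧ L.card ≤ j) → x.2 L = 0)

/-- restriction `ŷ ≤ x̂` of an address to the base `B`, keeping levels up to `j`. -/
def restrictA (x : Addr) (j : ℕ) (B : Finset ℕ) : Addr :=
  (B, fun L => if L ⊆ B ∧ 2 ≤ L.card ∧ L.card ≤ j then x.2 L else 0)

/-- `d` is a density function of `Â(k, k−1, a)`. -/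
def DensityFun (k : ℕ) (a : ℕ → ℕ) (d : Addr → ℝ) : Prop :=
  ∀ x : Addr, IsAddress k (k-1) a x → 0 ≤ d x ∧ d x ≤ 1

/-- A family of partitions together with an `a`-labelling. -/
structure LabFam (V : Type*) [DecidableEq V] extends PartFam V where
  vIdx : V → ℕ
  lbl : ℕ → Finset V → ℕ

namespace LabFam

variable (F : LabFam V)

/-- `F` is a family of partitions with a legitimate `a`-labelling. -/
def IsLabeled (k : ℕ) (a : ℕ → ℕ) : Prop :=
  F.toPartFam.IsFamily k a ∧
  (∀ v ∈ F.gnd, 1 ≤ F.vIdx v ∧ F.vIdx v ≤ a 1) ∧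
  (∀ u ∈ F.gnd, ∀ v ∈ F.gnd, (F.vIdx u = F.vIdx v ↔ F.vClass u = F.vClass v)) ∧
  ∀ j, 2 ≤ j → j ≤ k - 1 →
    (∀ I ∈ F.toPartFam.cross j, 1 ≤ F.lbl j I ∧ F.lbl j I ≤ a j) ∧
    (∀ I ∈ F.toPartFam.cross j, ∀ I' ∈ F.cls j I, F.lbl j I' = F.lbl j I) ∧
    (∀ I ∈ F.toPartFam.cross j, ∀ I' ∈ F.toPartFam.cross j,
      F.toPartFam.polyad (j-1) I = F.toPartFam.polyad (j-1) I' →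
      F.lbl j I = F.lbl j I' → F.cls j I = F.cls j I')

/-- the address `x̂(L)` (up to level j) of a crossing set `L` -/
def addrOf (j : ℕ) (L : Finset V) : Addr :=
  (L.image F.vIdx,
   fun M => if M ⊆ L.image F.vIdx ∧ 2 ≤ M.card ∧ M.card ≤ j
     then F.lbl M.card (L.filter fun v => F.vIdx v ∈ M) else 0)

/-- the part `P^{(j)}(x̂, b)` -/
def partAt (j : ℕ) (x : Addr) (b : ℕ) : Finset (Finset V) :=
  if j ≤ 1 then (if x.1 = {b} then sing (F.gnd.filter fun v => F.vIdx v = b) else ∅)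
  else (F.toPartFam.cross j).filter fun I => F.addrOf (j-1) I = x ∧ F.lbl j I = b

/-- the polyad `P̂^{(j)}(x̂)` -/
def polyAt (j : ℕ) (x : Addr) : Finset (Finset V) :=
  if j = 1 then sing (F.gnd.filter fun v => F.vIdx v ∈ x.1)
  else (x.1.powersetCard j).sup fun B => F.partAt j (restrictA x (j-1) B) (x.2 B)

/-- `F` is an `(ε, d)`-partition of `H`. -/
def IsDensPartition (k : ℕ) (a : ℕ → ℕ) (ε : ℝ) (d : Addr → ℝ)
    (H : Finset (Finset V)) : Prop :=
  ∀ x : Addr, IsAddress k (k-1) a x →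
    RegPairC F.gnd (F.toPartFam.cross k) (k-1) ε (d x) H (F.polyAt (k-1) x)

/-- `F` is an `(ε, a, d)`-equitable partition of `H`. -/
def IsEquitPartition (k : ℕ) (a : ℕ → ℕ) (ε : ℝ) (d : Addr → ℝ)
    (H : Finset (Finset V)) : Prop :=
  F.IsLabeled k a ∧ F.toPartFam.IsEquitableE k a (1 / (a 1 : ℝ)) ε ∧
  F.IsDensPartition k a ε d H

end LabFam

/-- An ℓ-partite complex: vertex classes and, for each level, a partite graph. -/
structure Cx (V : Type*) [DecidableEq V] (l : ℕ) where
  C : Fin l → Finset V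
  G : ℕ → Finset (Finset V)

namespace Cx

variable {l : ℕ} (X : Cx V l)

def gnd : Finset V := Finset.univ.sup X.C

/-- crossing i-sets with respect to the classes of `X` -/
def cross (i : ℕ) : Finset (Finset V) :=
  (X.gnd.powersetCard i).filter fun S => ∀ t : Fin l, (S ∩ X.C t).card ≤ 1

/-- restriction of the level-j graph to the classes indexed by `L` -/
def restr (j : ℕ) (L : Finset (Fin l)) : Finset (Finset V) :=
  if j = 1 then sing (L.sup X.C) else (X.G j).filter fun e => e ⊆ L.sup X.C

/-- `X` is a complex with levels up to `k`. -/
def IsComplex (k : ℕ) : Prop :=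
  (∀ s t : Fin l, s ≠ t → Disjoint (X.C s) (X.C t)) ∧
  (∀ j, 2 ≤ j → j ≤ k → X.G j ⊆ X.cross j) ∧
  (∀ j, 3 ≤ j → j ≤ k → X.G j ⊆ Kset X.gnd (j-1) j (X.G (j-1)))

/-- `X` is an (ε, (d_2, …, d_k))-regular complex. -/
def IsRegular (k : ℕ) (ε : ℝ) (d : ℕ → ℝ) : Prop :=
  ∀ j, 2 ≤ j → j ≤ k → ∀ L ∈ (Finset.univ : Finset (Fin l)).powersetCard j,
    RegPairC X.gnd (X.cross j) (j-1) ε (d j) (X.G j) (X.restr (j-1) L)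

/-- The restricted complex `X[L]` is (ε, (d_2, …, d_{k−1}, p))-regular. -/
def RestrRegular (k : ℕ) (ε : ℝ) (d : ℕ → ℝ) (L : Finset (Fin l)) (p : ℝ) : Prop :=
  ∀ j, 2 ≤ j → j ≤ k → ∀ L' ∈ L.powersetCard j,
    RegPairC X.gnd (X.cross j) (j-1) ε (if j = k then p else d j)
      (X.restr j L) (X.restr (j-1) L')

/-- clique set `K_i` of the level-j graph of the complex (level 1: crossing sets). -/
def KsetLvl (j i : ℕ) : Finset (Finset V) :=
  if j ≤ 1 then X.cross i else Kset X.gnd j i (X.G j)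

end Cx

/-- `eCL`, `mCL` satisfy the counting lemma of Kohayakawa–Rödl–Skokan. -/
def CountingProp (eCL : ℝ → ℝ → ℕ → ℕ → ℝ) (mCL : ℝ → ℝ → ℕ → ℕ → ℕ) : Prop :=
  ∀ γ d₀ : ℝ, 0 < γ → 0 < d₀ → ∀ k l : ℕ, 2 ≤ k → k ≤ l →
    (0 < eCL γ d₀ k l ∧ eCL γ d₀ k l ≤ 1) ∧
    ∀ (V₀ : Type) [DecidableEq V₀], ∀ (X : Cx V₀ l) (m : ℕ) (lam ε : ℝ) (d : ℕ → ℝ),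
      0 ≤ lam → lam < 1/4 → 0 < ε → ε ≤ eCL γ d₀ k l → mCL γ d₀ k l ≤ m →
      (∀ j, 2 ≤ j → j ≤ k → d₀ ≤ d j) →
      X.IsComplex k →
      (∀ i, |((X.C i).card : ℝ) - (m : ℝ)| ≤ lam * m) →
      X.IsRegular k ε d →
      |((Kset X.gnd k l (X.G k)).card : ℝ) -
        (∏ j ∈ Finset.Icc 2 k, d j ^ (l.choose j)) * ∏ i, ((X.C i).card : ℝ)|
        ≤ γ * ((∏ j ∈ Finset.Icc 2 k, d j ^ (l.choose j)) * ∏ i, ((X.C i).card : ℝ))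

/-- `eRI` is a legitimate function for defining regularity instances. -/
def GoodERI (eRI : ℕ → ℕ → ℝ) : Prop :=
  (∀ t k : ℕ, 1 ≤ t → 2 ≤ k → 0 < eRI t k ∧ eRI t k ≤ 1) ∧
  (∀ k t t' : ℕ, 1 ≤ t → t ≤ t' → eRI t' k ≤ eRI t k) ∧
  (∀ t k k' : ℕ, 2 ≤ k → k ≤ k' → eRI t k' ≤ eRI t k) ∧
  (∀ k : ℕ, Filter.Tendsto (fun t => eRI t k) Filter.atTop (nhds 0)) ∧
  ∃ (eCL : ℝ → ℝ → ℕ → ℕ → ℝ) (mCL : ℝ → ℝ → ℕ → ℕ → ℕ),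
    CountingProp eCL mCL ∧
    ∀ t k : ℕ, 1 ≤ t → 2 ≤ k →
      eRI t k < eCL (1/(t:ℝ)) (1/(t:ℝ)) (k-1) k / (4 * (t:ℝ) ^ (4^k))

/-- `max_i a_i` over `i ∈ [k−1]` -/
def maxA (k : ℕ) (a : ℕ → ℕ) : ℕ := (Finset.Icc 1 (k-1)).sup a

/-- `(ε, a, d)` is a regularity instance. -/
def RegInstance (eRI : ℕ → ℕ → ℝ) (k : ℕ) (ε : ℝ) (a : ℕ → ℕ) (d : Addr → ℝ) : Prop :=
  2 ≤ k ∧ (∀ j, 1 ≤ j → j ≤ k - 1 → 1 ≤ a j) ∧ 0 < ε ∧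
  ε ≤ eRI (maxA k a) k ∧ DensityFun k a d

section Counting

variable {W : Type} [Fintype W] [DecidableEq W]

/-- `S` spans an induced copy of `Fg` in `H` (both k-graphs). -/
def InducedCopy (Fg : Finset (Finset W)) (H : Finset (Finset V)) (k : ℕ) (S : Finset V) :
    Prop :=
  ∃ e : W → V, Function.Injective e ∧ Finset.univ.image e = S ∧
    ∀ A : Finset W, A.card = k → (A.image e ∈ H ↔ A ∈ Fg)

/-- the size of the automorphism group of `Fg` -/
def AutCount (Fg : Finset (Finset W)) : ℕ :=
  Nat.card {π : W ≃ W // ∀ A : Finset W, A.image π ∈ Fg ↔ A ∈ Fg}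

/-- the number `IC_σ(F, H)` of σ-induced copies of `Fg` in the complex `X` -/
def ICosig {l : ℕ} (X : Cx V l) (k : ℕ) (Fg : Finset (Finset W)) (σ : W ≃ Fin l) : ℕ :=
  Set.ncard {e : W → V |
    (∀ v, e v ∈ X.C (σ v)) ∧
    Finset.univ.image e ∈ X.KsetLvl (k-1) l ∧
    ∀ A : Finset W, A.card = k → (A.image e ∈ X.G k ↔ A ∈ Fg)}

/-- `IC(F, d, x̂, σ)` -/
def ICs (Fg : Finset (Finset W)) (k l : ℕ) (a : ℕ → ℕ) (d : Addr → ℝ)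
    (x : Addr) (σ : W → ℕ) : ℝ :=
  (∏ B ∈ x.1.powersetCard k,
    if ∃ A ∈ Fg, A.image σ = B then d (restrictA x (k-1) B)
    else 1 - d (restrictA x (k-1) B)) *
  ∏ j ∈ Finset.Icc 2 (k-1), ((a j : ℝ) ^ (l.choose j))⁻¹

/-- `IC(F, d, x̂)` -/
def ICa (Fg : Finset (Finset W)) (k l : ℕ) (a : ℕ → ℕ) (d : Addr → ℝ) (x : Addr) : ℝ :=
  (AutCount Fg : ℝ)⁻¹ *
    ∑ᶠ σ ∈ {σ : W → ℕ | Set.BijOn σ Set.univ ↑x.1}, ICs Fg k l a d x σ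

/-- `IC(F, d)` -/
def IC (Fg : Finset (Finset W)) (k l : ℕ) (a : ℕ → ℕ) (d : Addr → ℝ) : ℝ :=
  (((a 1).choose l : ℝ))⁻¹ * ∑ᶠ x ∈ {x : Addr | IsAddress l (k-1) a x}, ICa Fg k l a d x

end Counting

end

end HypReg

namespace HypReg

open Finset
open scoped BigOperators

attribute [local instance 10] Classical.propDecidable

set_option linter.unusedSectionVars false

noncomputable section

/-- Real-valued indicator of a proposition. -/
def ind (p : Prop) : ℝ := if p then 1 else 0

lemma ind_true {p : Prop} (h : p) : ind p = 1 := if_pos h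

lemma ind_false {p : Prop} (h : ¬p) : ind p = 0 := if_neg h

lemma ind_nonneg (p : Prop) : 0 ≤ ind p := by
  unfold ind; split_ifs <;> norm_num

lemma ind_le_one (p : Prop) : ind p ≤ 1 := by
  unfold ind; split_ifs <;> norm_num

lemma ind_and (p q : Prop) : ind (p ∧ q) = ind p * ind q := by
  by_cases hp : p <;> by_cases hq : q <;> simp [ind, hp, hq]

lemma ind_congr {p q : Prop} (h : p ↔ q) : ind p = ind q := by rw [propext h]

lemma ind_mul_congr {p : Prop} {a b : ℝ} (h : p → a = b) : a * ind p = b * ind p := by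
  by_cases hp : p
  · rw [h hp]
  · simp [ind, hp]

lemma sum_ind_eq {α : Type*} [Fintype α] (a : α) : ∑ b, ind (a = b) = 1 := by
  simp [ind]

lemma sum_ind_mul {α : Type*} [Fintype α] (a : α) (f : α → ℝ) :
    ∑ b, ind (a = b) * f b = f a := by
  simp [ind]

lemma abs_expect_le {Ω : Type*} [Fintype Ω] (f : Ω → ℝ) : |𝔼 x, f x| ≤ 𝔼 x, |f x| :=
  Finset.abs_expect_le _ _

lemma expect_le_of_le {Ω : Type*} [Fintype Ω] [Nonempty Ω] {f : Ω → ℝ} {c : ℝ}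
    (h : ∀ x, f x ≤ c) : 𝔼 x, f x ≤ c :=
  Finset.expect_le univ_nonempty (fun x _ => h x)

lemma expect_mono {Ω : Type*} [Fintype Ω] {f g : Ω → ℝ}
    (h : ∀ x, f x ≤ g x) : 𝔼 x, f x ≤ 𝔼 x, g x :=
  Finset.expect_le_expect fun x _ => h x

lemma expect_nonneg' {Ω : Type*} [Fintype Ω] {f : Ω → ℝ}
    (h : ∀ x, 0 ≤ f x) : 0 ≤ 𝔼 x, f x :=
  Finset.expect_nonneg fun x _ => h x

section Partite

variable {ι : Type} [Fintype ι] [DecidableEq ι] {X : ι → Type} [∀ i, Fintype (X i)]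
  [∀ i, Nonempty (X i)]

/-- `h` has small correlation with every product over `i ∈ S` of indicators of events not
depending on the coordinate `i`. -/
def CutLE (S : Finset ι) (h : (∀ i, X i) → ℝ) (ε : ℝ) : Prop :=
  ∀ P : ι → (∀ i, X i) → Prop, (∀ i ∈ S, DependsOn (P i) {i}ᶜ) →
    |𝔼 x, h x * ind (∀ i ∈ S, P i x)| ≤ ε

lemma CutLE.mono {S : Finset ι} {h : (∀ i, X i) → ℝ} {ε ε' : ℝ} (H : CutLE S h ε)
    (hε : ε ≤ ε') : CutLE S h ε' :=
  fun P hP => (H P hP).trans hε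

lemma CutLE.zero {S : Finset ι} {ε : ℝ} (hε : 0 ≤ ε) :
    CutLE S (fun _ : (∀ i, X i) => (0 : ℝ)) ε := by
  intro P _; simpa using hε

lemma CutLE.congr {S : Finset ι} {h h' : (∀ i, X i) → ℝ} {ε : ℝ} (H : CutLE S h ε)
    (e : ∀ x, h' x = h x) : CutLE S h' ε := by
  rwa [show h' = h from funext e]

lemma CutLE.add {S : Finset ι} {h h' : (∀ i, X i) → ℝ} {ε ε' : ℝ} (H : CutLE S h ε)
    (H' : CutLE S h' ε') : CutLE S (fun x => h x + h' x) (ε + ε') := by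
  intro P hP
  have := H P hP
  have := H' P hP
  simp only [add_mul, Finset.expect_add_distrib]
  exact (abs_add_le _ _).trans (by linarith)

lemma CutLE.const_mul {S : Finset ι} {h : (∀ i, X i) → ℝ} {ε : ℝ} (H : CutLE S h ε)
    {c : ℝ} (hc : |c| ≤ 1) : CutLE S (fun x => c * h x) ε := by
  intro P hP
  have := H P hP
  simp only [mul_assoc, ← Finset.mul_expect, abs_mul]
  nlinarith [abs_nonneg c, abs_nonneg (𝔼 x, h x * ind (∀ i ∈ S, P i x))]

lemma CutLE.sum {S : Finset ι} {α : Type*} (s : Finset α) {h : α → (∀ i, X i) → ℝ} {ε : ℝ}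
    (H : ∀ a ∈ s, CutLE S (h a) ε) : CutLE S (fun x => ∑ a ∈ s, h a x) (s.card * ε) := by
  intro P hP
  simp only [Finset.sum_mul, Finset.expect_sum_comm]
  refine (Finset.abs_sum_le_sum_abs _ _).trans ?_
  refine (Finset.sum_le_sum fun a ha => H a ha P hP).trans ?_
  simp

/-- Indicators of events depending on sets not containing `S` can be absorbed. -/
lemma CutLE.absorb {S : Finset ι} {h : (∀ i, X i) → ℝ} {ε : ℝ} (H : CutLE S h ε)
    (𝒯 : Finset (Finset ι)) (R : Finset ι → (∀ i, X i) → Prop)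
    (hR : ∀ T ∈ 𝒯, ¬ S ⊆ T ∧ DependsOn (R T) (T : Set ι)) :
    CutLE S (fun x => h x * ind (∀ T ∈ 𝒯, R T x)) ε := by
  intro P hP
  have := H (fun i x => P i x ∧ ∀ T ∈ 𝒯, i ∉ T → R T x) ?_
  · have e : ∀ x, h x * ind (∀ T ∈ 𝒯, R T x) * ind (∀ i ∈ S, P i x)
        = h x * ind (∀ i ∈ S, P i x ∧ ∀ T ∈ 𝒯, i ∉ T → R T x) := by
      intro x
      rw [mul_assoc, ← ind_and]
      congr 1
      apply ind_congr
      constructor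
      · rintro ⟨h1, h2⟩ i hi
        exact ⟨h2 i hi, fun T hT _ => h1 T hT⟩
      · intro h1
        refine ⟨fun T hT => ?_, fun i hi => (h1 i hi).1⟩
        obtain ⟨i, hi, hiT⟩ := Finset.not_subset.1 (hR T hT).1
        exact (h1 i hi).2 T hT hiT
    simp only [e]
    exact this
  · intro i hi x y hxy
    have e1 := hP i hi hxy
    apply propext
    have e2 : ∀ T ∈ 𝒯, i ∉ T → (R T x = R T y) := fun T hT hiT =>
      (hR T hT).2 fun j hj => hxy j (by
        rintro rfl; exact hiT hj)
    constructor
    · rintro ⟨h1, h2⟩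
      exact ⟨e1 ▸ h1, fun T hT hiT => e2 T hT hiT ▸ h2 T hT hiT⟩
    · rintro ⟨h1, h2⟩
      refine ⟨by rw [e1]; exact h1, fun T hT hiT => ?_⟩
      rw [e2 T hT hiT]; exact h2 T hT hiT

lemma CutLE.expect_le {S : Finset ι} {h : (∀ i, X i) → ℝ} {ε : ℝ} (H : CutLE S h ε) :
    |𝔼 x, h x| ≤ ε := by
  have := H (fun _ _ => True) (fun i _ x y _ => rfl)
  simpa [ind] using this

variable {κ : Type} [Fintype κ]

/-- A system of colourings of the partial points `x|_S`. -/
def IsDep {κ : Type*} (C : (∀ i, X i) → Finset ι → κ) : Prop :=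
  ∀ S, DependsOn (fun x => C x S) (S : Set ι)

/-- `K S p` is a probability vector in the colour `p S`, depending on colours of subsets. -/
structure IsKer (K : Finset ι → (Finset ι → κ) → ℝ) : Prop where
  local' : ∀ S p q, (∀ T ⊆ S, p T = q T) → K S p = K S q
  nonneg : ∀ S p, 0 ≤ K S p
  sum_eq : ∀ S p, ∑ d, K S (Function.update p S d) = 1

lemma IsKer.le_one {K : Finset ι → (Finset ι → κ) → ℝ} (hK : IsKer K) (S : Finset ι)
    (p : Finset ι → κ) : K S p ≤ 1 := by
  have h := hK.sum_eq S p
  have h2 : K S (Function.update p S (p S)) ≤ ∑ d, K S (Function.update p S d) :=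
    Finset.single_le_sum (f := fun d => K S (Function.update p S d))
      (fun d _ => hK.nonneg _ _) (mem_univ _)
  rw [Function.update_eq_self] at h2
  linarith

/-- Deviation of the indicator of colour `d` at `S` from the kernel. -/
def dev (C : (∀ i, X i) → Finset ι → κ) (K : Finset ι → (Finset ι → κ) → ℝ) (S : Finset ι)
    (d : κ) (x : ∀ i, X i) : ℝ :=
  ind (C x S = d) - K S (Function.update (C x) S d)

/-- Every deviation is a sum of an `L¹`-small and a cut-small function. -/
def RegSys (C : (∀ i, X i) → Finset ι → κ) (K : Finset ι → (Finset ι → κ) → ℝ)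
    (γ ε : ℝ) : Prop :=
  ∀ S, ∃ g h : κ → (∀ i, X i) → ℝ, (∀ d x, dev C K S d x = g d x + h d x) ∧
    ∑ d, (𝔼 x, |g d x|) ≤ γ ∧ ∀ d, CutLE S (h d) ε

/-- All deviations are cut-small. -/
def SuperReg (C : (∀ i, X i) → Finset ι → κ) (K : Finset ι → (Finset ι → κ) → ℝ)
    (ε : ℝ) : Prop :=
  ∀ S d, CutLE S (dev C K S d) ε

/-- Down-closed families. -/
def DownClosed (𝒟 : Finset (Finset ι)) : Prop := ∀ S ∈ 𝒟, ∀ T ⊆ S, T ∈ 𝒟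

lemma DownClosed.erase {𝒟 : Finset (Finset ι)} (h : DownClosed 𝒟) {S : Finset ι}
    (hmax : ∀ T ∈ 𝒟, T.card ≤ S.card) : DownClosed (𝒟.erase S) := by
  intro A hA T hT
  rw [mem_erase] at hA ⊢
  refine ⟨?_, h A hA.2 T hT⟩
  rintro rfl
  exact hA.1 (eq_of_subset_of_card_le hT (hmax A hA.2)).symm

/-- Induction on down-closed families, removing a set of maximal size. -/
lemma DownClosed.induction {motive : Finset (Finset ι) → Prop} (h0 : motive ∅)
    (hs : ∀ 𝒟 S, DownClosed 𝒟 → S ∈ 𝒟 → (∀ T ∈ 𝒟.erase S, ¬ S ⊆ T) → DownClosed (𝒟.erase S) →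
      motive (𝒟.erase S) → motive 𝒟) : ∀ 𝒟, DownClosed 𝒟 → motive 𝒟 := by
  intro 𝒟
  induction hn : 𝒟.card generalizing 𝒟 with
  | zero => intro _; rwa [card_eq_zero.1 hn]
  | succ n ih =>
    intro h𝒟
    have hne : 𝒟.Nonempty := card_pos.1 (by omega)
    obtain ⟨S, hS, hmax⟩ := exists_max_image 𝒟 card hne
    refine hs 𝒟 S h𝒟 hS ?_ (h𝒟.erase hmax) (ih _ ?_ (h𝒟.erase hmax))
    · intro T hT hST
      rw [mem_erase] at hT
      exact hT.1 (eq_of_subset_of_card_le hST (hmax T hT.2)).symm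
    · rw [card_erase_of_mem hS]; omega

/-- Summing out all colours outside a down-closed family. -/
lemma IsKer.sum_out {K : Finset ι → (Finset ι → κ) → ℝ} (hK : IsKer K)
    (q : Finset ι → κ) (𝒟 : Finset (Finset ι)) (h𝒟 : DownClosed 𝒟) :
    ∑ p : Finset ι → κ, ind (∀ T ∈ 𝒟, p T = q T) * ∏ S ∈ 𝒟ᶜ, K S p = 1 := by
  induction hn : (𝒟ᶜ).card generalizing 𝒟 q with
  | zero =>
    have h1 : 𝒟 = univ := by
      rw [card_eq_zero] at hn; simpa using hn
    subst h1
    have : ∀ p : Finset ι → κ, (∀ T ∈ (univ : Finset (Finset ι)), p T = q T) ↔ q = p := by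
      intro p; rw [funext_iff]; simp [eq_comm]
    simp only [this]
    simpa using sum_ind_eq q
  | succ n ih =>
    obtain ⟨S, hS, hmin⟩ := exists_min_image 𝒟ᶜ card (card_pos.1 (by omega))
    have hS' : S ∉ 𝒟 := by simpa using hS
    have hcomp : (insert S 𝒟)ᶜ = 𝒟ᶜ.erase S := by
      ext T; simp
    have hdc : DownClosed (insert S 𝒟) := by
      intro A hA T hT
      rw [mem_insert] at hA ⊢
      rcases hA with rfl | hA
      · by_contra hcon
        rw [not_or] at hcon
        have := hmin T (by simpa using hcon.2)
        exact hcon.1 (eq_of_subset_of_card_le hT this)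
      · exact Or.inr (h𝒟 A hA T hT)
    have hcard : ((insert S 𝒟)ᶜ).card = n := by
      rw [hcomp, card_erase_of_mem hS]; omega
    have hsub : ∀ T ⊂ S, T ∈ 𝒟 := by
      intro T hT
      by_contra hcon
      have := hmin T (by simpa using hcon)
      have := card_lt_card hT
      omega
    have key : ∀ p : Finset ι → κ, ind (∀ T ∈ 𝒟, p T = q T) * ∏ S ∈ 𝒟ᶜ, K S p
        = ∑ d, K S (Function.update q S d) *
          (ind (∀ T ∈ insert S 𝒟, p T = Function.update q S d T) *
            ∏ S ∈ (insert S 𝒟)ᶜ, K S p) := by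
      intro p
      rw [hcomp, ← mul_prod_erase _ _ hS]
      have h1 : ∀ d, ind (∀ T ∈ insert S 𝒟, p T = Function.update q S d T)
          = ind (p S = d) * ind (∀ T ∈ 𝒟, p T = q T) := by
        intro d
        rw [← ind_and]
        apply ind_congr
        rw [forall_mem_insert]
        simp only [Function.update_self]
        refine and_congr Iff.rfl (forall₂_congr fun T hT => ?_)
        rw [Function.update_of_ne (by rintro rfl; exact hS' hT)]
      have h2 : ∀ d, K S (Function.update q S d) *
          (ind (∀ T ∈ insert S 𝒟, p T = Function.update q S d T) *
            ∏ S ∈ 𝒟ᶜ.erase S, K S p) = ind (p S = d) *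
            (K S (Function.update q S d) * (ind (∀ T ∈ 𝒟, p T = q T) *
            ∏ S ∈ 𝒟ᶜ.erase S, K S p)) := by
        intro d; rw [h1]; ring
      rw [sum_congr rfl fun d _ => h2 d, sum_ind_mul]
      by_cases hp : ∀ T ∈ 𝒟, p T = q T
      · rw [hK.local' S p (Function.update q S (p S))]
        · ring
        · intro T hT
          rcases eq_or_ne T S with rfl | hne
          · simp
          · rw [Function.update_of_ne hne]
            exact hp T (hsub T (hT.ssubset_of_ne hne))
      · simp [ind_false hp]
    rw [sum_congr rfl fun p _ => key p, sum_comm]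
    simp only [← mul_sum]
    rw [sum_congr rfl fun d _ => by rw [ih _ _ hdc hcard, mul_one]]
    exact hK.sum_eq S q

/-- Pointwise peeling identity. -/
lemma peel_pointwise {C : (∀ i, X i) → Finset ι → κ} {K : Finset ι → (Finset ι → κ) → ℝ}
    (hK : IsKer K) {𝒟 : Finset (Finset ι)} (h𝒟 : DownClosed 𝒟) {S : Finset ι} (hS : S ∈ 𝒟)
    (p : Finset ι → κ) (x : ∀ i, X i) :
    ind (∀ T ∈ 𝒟, C x T = p T) = K S p * ind (∀ T ∈ 𝒟.erase S, C x T = p T)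
      + dev C K S (p S) x * ind (∀ T ∈ 𝒟.erase S, C x T = p T) := by
  have h1 : ind (∀ T ∈ 𝒟, C x T = p T)
      = ind (C x S = p S) * ind (∀ T ∈ 𝒟.erase S, C x T = p T) := by
    rw [← ind_and]
    apply ind_congr
    conv_lhs => rw [← insert_erase hS]
    rw [forall_mem_insert]
  rw [h1, ← add_mul]
  apply ind_mul_congr
  intro hx
  unfold dev
  rw [hK.local' S (Function.update (C x) S (p S)) p]
  · ring
  · intro T hT
    rcases eq_or_ne T S with rfl | hne
    · simp
    · rw [Function.update_of_ne hne]
      exact hx T (mem_erase.2 ⟨hne, h𝒟 S hS T hT⟩)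

lemma CutLE.absorb_cyl {C : (∀ i, X i) → Finset ι → κ} (hC : IsDep C) {S : Finset ι}
    {h : (∀ i, X i) → ℝ} {ε : ℝ} (H : CutLE S h ε) (𝒯 : Finset (Finset ι))
    (h𝒯 : ∀ T ∈ 𝒯, ¬ S ⊆ T) (p : Finset ι → κ) :
    CutLE S (fun x => h x * ind (∀ T ∈ 𝒯, C x T = p T)) ε :=
  H.absorb 𝒯 (fun T x => C x T = p T) fun T hT => ⟨h𝒯 T hT, fun x y hxy => by
    have := hC T hxy
    simp only at this ⊢
    rw [this]⟩

/-- Counting all patterns of a regular system in `ℓ¹`. -/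
lemma count_l1 {C : (∀ i, X i) → Finset ι → κ} (hC : IsDep C)
    {K : Finset ι → (Finset ι → κ) → ℝ} (hK : IsKer K) {γ ε : ℝ} (hr : RegSys C K γ ε) :
    ∑ p : Finset ι → κ, |(𝔼 x, ind (C x = p)) - ∏ S, K S p|
      ≤ Fintype.card (Finset ι) * (γ + Fintype.card (Finset ι → κ) * ε) := by
  have main : ∀ 𝒟 : Finset (Finset ι), DownClosed 𝒟 →
      ∑ p : Finset ι → κ, (∏ T ∈ 𝒟ᶜ, K T p) *
        |(𝔼 x, ind (∀ T ∈ 𝒟, C x T = p T)) - ∏ T ∈ 𝒟, K T p|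
      ≤ 𝒟.card * (γ + Fintype.card (Finset ι → κ) * ε) := by
    refine DownClosed.induction ?_ ?_
    · simp [ind]
    · intro 𝒟 S h𝒟 hS hmax hd ih
      obtain ⟨g, h, hgh, hg, hh⟩ := hr S
      have hcompl : (𝒟.erase S)ᶜ = insert S 𝒟ᶜ := by
        ext T; simp only [mem_compl, mem_erase, mem_insert]; tauto
      have hSc : S ∉ 𝒟ᶜ := by simpa using hS
      have hw0 : ∀ p, 0 ≤ ∏ T ∈ 𝒟ᶜ, K T p := fun p => prod_nonneg fun T _ => hK.nonneg _ _
      have hw1 : ∀ p, ∏ T ∈ 𝒟ᶜ, K T p ≤ 1 := fun p =>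
        prod_le_one (fun T _ => hK.nonneg _ _) fun T _ => hK.le_one _ _
      have hε : 0 ≤ ε := by
        by_cases hκ : Nonempty κ
        · exact (abs_nonneg _).trans (hh hκ.some).expect_le
        · exfalso
          exact hκ ⟨C (Classical.arbitrary _) ∅⟩
      have term : ∀ p : Finset ι → κ, (∏ T ∈ 𝒟ᶜ, K T p) *
          |(𝔼 x, ind (∀ T ∈ 𝒟, C x T = p T)) - ∏ T ∈ 𝒟, K T p| ≤
          (∏ T ∈ (𝒟.erase S)ᶜ, K T p) *
            |(𝔼 x, ind (∀ T ∈ 𝒟.erase S, C x T = p T)) - ∏ T ∈ 𝒟.erase S, K T p|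
          + ((𝔼 x, (∏ T ∈ 𝒟ᶜ, K T p) * (|g (p S) x| * ind (∀ T ∈ 𝒟.erase S, C x T = p T)))
            + ε) := by
        intro p
        have h1 := ((hh (p S)).absorb_cyl hC _ hmax p).expect_le
        rw [hcompl, prod_insert hSc,
          Finset.expect_congr rfl fun x _ => peel_pointwise hK h𝒟 hS p x,
          Finset.expect_add_distrib, ← Finset.mul_expect, ← mul_prod_erase _ _ hS,
          add_sub_right_comm, ← mul_sub]
        have h2 : |𝔼 x, dev C K S (p S) x * ind (∀ T ∈ 𝒟.erase S, C x T = p T)|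
            ≤ (𝔼 x, |g (p S) x| * ind (∀ T ∈ 𝒟.erase S, C x T = p T)) + ε := by
          rw [Finset.expect_congr rfl fun x _ => by rw [hgh, add_mul],
            Finset.expect_add_distrib]
          refine (abs_add_le _ _).trans (add_le_add ?_ h1)
          refine (abs_expect_le _).trans (le_of_eq (Finset.expect_congr rfl fun x _ => ?_))
          rw [abs_mul, abs_of_nonneg (ind_nonneg _)]
        rw [← Finset.mul_expect]
        set A := |(𝔼 x, ind (∀ T ∈ 𝒟.erase S, C x T = p T)) - ∏ T ∈ 𝒟.erase S, K T p|
        set B := 𝔼 x, |g (p S) x| * ind (∀ T ∈ 𝒟.erase S, C x T = p T)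
        have h3 := abs_add_le (K S p * ((𝔼 x, ind (∀ T ∈ 𝒟.erase S, C x T = p T))
          - ∏ T ∈ 𝒟.erase S, K T p))
          (𝔼 x, dev C K S (p S) x * ind (∀ T ∈ 𝒟.erase S, C x T = p T))
        rw [abs_mul, abs_of_nonneg (hK.nonneg S p)] at h3
        have h4 := mul_le_mul_of_nonneg_left (h3.trans (add_le_add le_rfl h2)) (hw0 p)
        refine h4.trans ?_
        have := mul_le_of_le_one_left hε (hw1 p)
        change _ * (K S p * A + (B + ε)) ≤ _
        nlinarith
      have hgsum : ∑ p : Finset ι → κ, (𝔼 x, (∏ T ∈ 𝒟ᶜ, K T p) *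
          (|g (p S) x| * ind (∀ T ∈ 𝒟.erase S, C x T = p T))) ≤ γ := by
        refine le_trans (le_of_eq ?_) hg
        rw [← Finset.expect_sum_comm, ← Finset.expect_sum_comm]
        refine Finset.expect_congr rfl fun x _ => ?_
        have e1 : ∀ p : Finset ι → κ, (∏ T ∈ 𝒟ᶜ, K T p) *
            (|g (p S) x| * ind (∀ T ∈ 𝒟.erase S, C x T = p T)) =
            ∑ d, |g d x| * (ind (∀ T ∈ 𝒟, p T = Function.update (C x) S d T) *
              (∏ T ∈ 𝒟ᶜ, K T p)) := by
          intro p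
          have e2 : ∀ d, |g d x| * (ind (∀ T ∈ 𝒟, p T = Function.update (C x) S d T) *
              (∏ T ∈ 𝒟ᶜ, K T p)) = ind (p S = d) * (|g d x| *
              (ind (∀ T ∈ 𝒟.erase S, C x T = p T) * (∏ T ∈ 𝒟ᶜ, K T p))) := by
            intro d
            have : ind (∀ T ∈ 𝒟, p T = Function.update (C x) S d T) = ind (p S = d) *
                ind (∀ T ∈ 𝒟.erase S, C x T = p T) := by
              rw [← ind_and]
              apply ind_congr
              conv_lhs => rw [← insert_erase hS]
              rw [forall_mem_insert]
              simp only [Function.update_self]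
              refine and_congr Iff.rfl (forall₂_congr fun T hT => ?_)
              rw [Function.update_of_ne (ne_of_mem_erase hT), eq_comm]
            rw [this]; ring
          rw [sum_congr rfl fun d _ => e2 d, sum_ind_mul]
          ring
        rw [sum_congr rfl fun p _ => e1 p, sum_comm]
        refine sum_congr rfl fun d _ => ?_
        rw [← mul_sum, hK.sum_out _ _ h𝒟, mul_one]
      refine (sum_le_sum fun p _ => term p).trans ?_
      rw [sum_add_distrib, sum_add_distrib]
      have hc : (𝒟.card : ℝ) = (𝒟.erase S).card + 1 := by
        rw [← card_erase_add_one hS]; push_cast; ring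
      rw [hc]
      simp only [sum_const, card_univ, nsmul_eq_mul]
      nlinarith
  have := main univ (fun _ _ _ _ => mem_univ _)
  simpa [funext_iff] using this

end Partite

end

end HypReg

namespace HypReg

open Finset
open scoped BigOperators

attribute [local instance 10] Classical.propDecidable

set_option linter.unusedSectionVars false

noncomputable section

lemma sq_expect_abs_le {Ω : Type*} [Fintype Ω] [Nonempty Ω] (f : Ω → ℝ) :
    (𝔼 x, |f x|) ^ 2 ≤ 𝔼 x, f x ^ 2 := by
  set m := 𝔼 x, |f x| with hm
  have h : 0 ≤ 𝔼 x, (|f x| - m) ^ 2 := expect_nonneg' fun x => sq_nonneg _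
  have e : ∀ x, (|f x| - m) ^ 2 = f x ^ 2 - 2 * m * |f x| + m ^ 2 := by
    intro x; rw [sub_sq, sq_abs]; ring
  simp only [e, Finset.expect_add_distrib, Finset.expect_sub_distrib, ← Finset.mul_expect,
    Finset.expect_const univ_nonempty] at h
  rw [← hm] at h
  nlinarith

section Cexp

variable {Ω : Type*} [Fintype Ω] {τ τ' : Type*}

/-- Conditional expectation of `f` given the value of `q`. -/
def cexp (q : Ω → τ) (f : Ω → ℝ) (x : Ω) : ℝ :=
  (𝔼 y, ind (q y = q x) * f y) / 𝔼 y, ind (q y = q x)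

lemma expect_ind_pos {p : Ω → Prop} {x : Ω} (hx : p x) : 0 < 𝔼 y, ind (p y) :=
  Finset.expect_pos' (fun _ _ => ind_nonneg _) ⟨x, mem_univ _, by rw [ind_true hx]; norm_num⟩

lemma cexp_congr (q : Ω → τ) (f : Ω → ℝ) {x y : Ω} (h : q x = q y) :
    cexp q f x = cexp q f y := by
  unfold cexp; rw [h]

lemma cexp_nonneg (q : Ω → τ) {f : Ω → ℝ} (hf : ∀ x, 0 ≤ f x) (x : Ω) : 0 ≤ cexp q f x :=
  div_nonneg (expect_nonneg' fun y => mul_nonneg (ind_nonneg _) (hf y))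
    (expect_nonneg' fun _ => ind_nonneg _)

lemma cexp_le_one (q : Ω → τ) {f : Ω → ℝ} (hf : ∀ x, f x ≤ 1) (x : Ω) : cexp q f x ≤ 1 := by
  refine div_le_one_of_le₀ (expect_mono fun y => ?_) (expect_nonneg' fun _ => ind_nonneg _)
  exact mul_le_of_le_one_right (ind_nonneg _) (hf y)

lemma cexp_zero (q : Ω → τ) (x : Ω) : cexp q (fun _ => 0) x = 0 := by
  simp [cexp]

lemma expect_cexp_mul (q : Ω → τ) (f w : Ω → ℝ) (hw : ∀ x y, q x = q y → w x = w y) :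
    𝔼 x, cexp q f x * w x = 𝔼 x, f x * w x := by
  have e1 : ∀ x, cexp q f x * w x =
      𝔼 y, ind (q x = q y) * (f y * w y / 𝔼 z, ind (q z = q y)) := by
    intro x
    rw [cexp, div_mul_eq_mul_div, Finset.expect_mul, Finset.expect_div]
    refine Finset.expect_congr rfl fun y _ => ?_
    by_cases h : q x = q y
    · rw [hw x y h, h]; simp [ind]
    · have h' : ¬ q y = q x := fun e => h e.symm
      simp [ind, h, h']
  rw [Finset.expect_congr rfl fun x _ => e1 x, Finset.expect_comm]
  refine Finset.expect_congr rfl fun y _ => ?_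
  rw [← Finset.expect_mul, mul_div_cancel₀]
  exact (expect_ind_pos (p := fun z => q z = q y) (x := y) rfl).ne'

lemma expect_cexp [Nonempty Ω] (q : Ω → τ) (f : Ω → ℝ) :
    𝔼 x, cexp q f x = 𝔼 x, f x := by
  simpa using expect_cexp_mul q f (fun _ => 1) (fun _ _ _ => rfl)

lemma expect_cexp_sub_sq (q : Ω → τ) (q' : Ω → τ') (hq : ∀ x y, q' x = q' y → q x = q y)
    (f : Ω → ℝ) :
    𝔼 x, (cexp q' f x - cexp q f x) ^ 2
      = (𝔼 x, cexp q' f x ^ 2) - 𝔼 x, cexp q f x ^ 2 := by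
  have h1 := expect_cexp_mul q' f (cexp q f) fun x y h => cexp_congr q f (hq x y h)
  have h2 := expect_cexp_mul q f (cexp q f) fun x y h => cexp_congr q f h
  have e : ∀ x, (cexp q' f x - cexp q f x) ^ 2
      = cexp q' f x ^ 2 - 2 * (cexp q' f x * cexp q f x) + cexp q f x ^ 2 := by
    intro x; ring
  simp only [e, Finset.expect_add_distrib, Finset.expect_sub_distrib, ← Finset.mul_expect]
  rw [h1, ← h2]
  simp only [← pow_two]
  ring

end Cexp

section Partite

variable {ι : Type} [Fintype ι] [DecidableEq ι]

/-- Averages over partial re-randomisations. -/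
lemma expect_piecewise {X : ι → Type} [∀ i, Fintype (X i)] [∀ i, Nonempty (X i)]
    (S : Finset ι) (g : (∀ i, X i) → ℝ) :
    (𝔼 z : ∀ i, X i, 𝔼 x : ∀ i, X i, g (S.piecewise x z)) = 𝔼 x, g x := by
  have inv : Function.Involutive (fun u : (∀ i, X i) × (∀ i, X i) =>
      (S.piecewise u.1 u.2, S.piecewise u.2 u.1)) := by
    rintro ⟨x, z⟩
    ext i <;> by_cases hi : i ∈ S <;> simp [hi]
  have h := Fintype.expect_equiv inv.toPerm
    (fun u : (∀ i, X i) × (∀ i, X i) => g (S.piecewise u.1 u.2)) (fun u => g u.1)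
    (fun u => rfl)
  rw [← univ_product_univ, Finset.expect_product, Finset.expect_product, Finset.expect_comm] at h
  rw [h]
  exact Finset.expect_congr rfl fun x _ => Finset.expect_const univ_nonempty (g x)

variable {X : ι → Type} [∀ i, Fintype (X i)] [∀ i, Nonempty (X i)]

/-- The colours strictly below `S`. -/
def low {κ : Type*} [Zero κ] (C : (∀ i, X i) → Finset ι → κ) (S : Finset ι) (x : ∀ i, X i) :
    Finset ι → κ :=
  fun T => if T ⊂ S then C x T else 0

lemma low_eq_iff {κ : Type*} [Zero κ] {C : (∀ i, X i) → Finset ι → κ} {S : Finset ι}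
    {x y : ∀ i, X i} : low C S x = low C S y ↔ ∀ T ⊂ S, C x T = C y T := by
  constructor
  · intro h T hT
    have := congrFun h T
    simpa [low, hT] using this
  · intro h
    funext T
    unfold low
    split_ifs with hT
    · exact h T hT
    · rfl

/-- `C'` refines `C`. -/
def Refines {κ κ' : Type*} (C' : (∀ i, X i) → Finset ι → κ') (C : (∀ i, X i) → Finset ι → κ) :
    Prop := ∀ x y S, C' x S = C' y S → C x S = C y S

lemma Refines.low {C' C : (∀ i, X i) → Finset ι → ℕ} (h : Refines C' C) (S : Finset ι)
    (x y : ∀ i, X i) (hxy : low C' S x = low C' S y) : HypReg.low C S x = HypReg.low C S y := by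
  rw [low_eq_iff] at hxy ⊢
  exact fun T hT => h x y T (hxy T hT)

/-- Probability of colour `d` at `S` given the lower colours. -/
def cpr (C : (∀ i, X i) → Finset ι → ℕ) (S : Finset ι) (d : ℕ) (x : ∀ i, X i) : ℝ :=
  cexp (low C S) (fun y => ind (C y S = d)) x

lemma cpr_nonneg (C : (∀ i, X i) → Finset ι → ℕ) (S : Finset ι) (d : ℕ) (x : ∀ i, X i) :
    0 ≤ cpr C S d x := cexp_nonneg _ (fun _ => ind_nonneg _) _

lemma cpr_le_one (C : (∀ i, X i) → Finset ι → ℕ) (S : Finset ι) (d : ℕ) (x : ∀ i, X i) :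
    cpr C S d x ≤ 1 := cexp_le_one _ (fun _ => ind_le_one _) _

lemma cpr_eq_zero {C : (∀ i, X i) → Finset ι → ℕ} {S : Finset ι} {d : ℕ}
    (h : ∀ x, C x S ≠ d) (x : ∀ i, X i) : cpr C S d x = 0 := by
  unfold cpr
  rw [show (fun y => ind (C y S = d)) = fun _ => 0 from funext fun y => ind_false (h y)]
  exact cexp_zero _ _

/-- The energy of the colouring at level `j + 1`. -/
def energy (N j : ℕ) (C : (∀ i, X i) → Finset ι → ℕ) : ℝ :=
  ∑ S ∈ powersetCard (j + 1) (univ : Finset ι), ∑ d ∈ range N, 𝔼 x, cpr C S d x ^ 2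

lemma energy_le (N j : ℕ) (C : (∀ i, X i) → Finset ι → ℕ) :
    energy N j C ≤ Fintype.card (Finset ι) := by
  have h : ∀ S : Finset ι, ∑ d ∈ range N, 𝔼 x, cpr C S d x ^ 2 ≤ 1 := by
    intro S
    have h1 : ∀ d, 𝔼 x, cpr C S d x ^ 2 ≤ 𝔼 x, ind (C x S = d) := by
      intro d
      rw [← expect_cexp (low C S) (fun y => ind (C y S = d))]
      refine expect_mono fun x => ?_
      have := cpr_nonneg C S d x
      have := cpr_le_one C S d x
      change cpr C S d x ^ 2 ≤ cpr C S d x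
      nlinarith
    refine (sum_le_sum fun d _ => h1 d).trans ?_
    rw [← Finset.expect_sum_comm]
    refine expect_le_of_le fun x => ?_
    have : ∀ d, ind (C x S = d) = if C x S = d then 1 else 0 := fun d => by
      unfold ind; split_ifs <;> rfl
    rw [sum_congr rfl fun d _ => this d, sum_ite_eq]
    split_ifs <;> norm_num
  refine (sum_le_sum fun S _ => h S).trans ?_
  simp only [sum_const, nsmul_eq_mul, mul_one]
  exact_mod_cast card_le_univ _

lemma energy_sub {N j : ℕ} {C C' : (∀ i, X i) → Finset ι → ℕ} (hr : Refines C' C)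
    (he : ∀ x (S : Finset ι), S.card = j + 1 → C' x S = C x S) :
    energy N j C' - energy N j C =
      ∑ S ∈ powersetCard (j + 1) (univ : Finset ι), ∑ d ∈ range N,
        𝔼 x, (cpr C' S d x - cpr C S d x) ^ 2 := by
  unfold energy
  rw [← sum_sub_distrib]
  refine sum_congr rfl fun S hS => ?_
  rw [← sum_sub_distrib]
  refine sum_congr rfl fun d _ => ?_
  have hS' := (mem_powersetCard.1 hS).2
  have e : ∀ x, cpr C' S d x = cexp (low C' S) (fun y => ind (C y S = d)) x := by
    intro x; unfold cpr; simp only [he _ S hS']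
  simp only [e]
  exact (expect_cexp_sub_sq _ _ (hr.low S) _).symm

lemma energy_mono {N j : ℕ} {C C' : (∀ i, X i) → Finset ι → ℕ} (hr : Refines C' C)
    (he : ∀ x (S : Finset ι), S.card = j + 1 → C' x S = C x S) :
    energy N j C ≤ energy N j C' := by
  have h := energy_sub (N := N) hr he
  have : 0 ≤ energy N j C' - energy N j C := by
    rw [h]
    exact sum_nonneg fun S _ => sum_nonneg fun d _ => expect_nonneg' fun x => sq_nonneg _
  linarith

lemma expect_sq_le_energy_sub {N j : ℕ} {C C' : (∀ i, X i) → Finset ι → ℕ} (hr : Refines C' C)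
    (he : ∀ x (S : Finset ι), S.card = j + 1 → C' x S = C x S) {S : Finset ι}
    (hS : S.card = j + 1) {d : ℕ} (hd : d < N) :
    𝔼 x, (cpr C' S d x - cpr C S d x) ^ 2 ≤ energy N j C' - energy N j C := by
  rw [energy_sub hr he]
  have h0 : ∀ (S : Finset ι) d, 0 ≤ 𝔼 x, (cpr C' S d x - cpr C S d x) ^ 2 :=
    fun S d => expect_nonneg' fun x => sq_nonneg _
  refine le_trans ?_ (single_le_sum (f := fun S => ∑ d ∈ range N,
        𝔼 x, (cpr C' S d x - cpr C S d x) ^ 2) (fun S _ => sum_nonneg fun d _ => h0 S d)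
        (mem_powersetCard.2 ⟨subset_univ S, hS⟩))
  exact single_le_sum (f := fun d => 𝔼 x, (cpr C' S d x - cpr C S d x) ^ 2)
    (fun d _ => h0 S d) (mem_range.2 hd)

lemma Refines.trans {κ κ' κ'' : Type*} {C : (∀ i, X i) → Finset ι → κ}
    {C' : (∀ i, X i) → Finset ι → κ'} {C'' : (∀ i, X i) → Finset ι → κ''}
    (h : Refines C'' C') (h' : Refines C' C) : Refines C'' C :=
  fun x y S e => h' x y S (h x y S e)

/-- One step of the energy increment. -/
lemma weak_step {C : (∀ i, X i) → Finset ι → ℕ} (hC : IsDep C) {S : Finset ι} {j : ℕ}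
    (hS : S.card = j + 1) {d : ℕ} {ε : ℝ} (hε : 0 < ε)
    (hbad : ¬ CutLE S (fun x => ind (C x S = d) - cpr C S d x) ε) :
    ∃ C' : (∀ i, X i) → Finset ι → ℕ, IsDep C' ∧ Refines C' C ∧
      (∀ x (T : Finset ι), T.card ≠ j → C' x T = C x T) ∧ (∀ x T, C' x T ≤ 2 * C x T + 1) ∧
      ε ^ 2 ≤ 𝔼 x, (cpr C' S d x - cpr C S d x) ^ 2 := by
  unfold CutLE at hbad
  push Not at hbad
  obtain ⟨P, hP, hbig⟩ := hbad
  obtain ⟨z, hz⟩ : ∃ z : ∀ i, X i, ε < |𝔼 x : ∀ i, X i,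
      (ind (C (S.piecewise x z) S = d) - cpr C S d (S.piecewise x z)) *
        ind (∀ i ∈ S, P i (S.piecewise x z))| := by
    by_contra hcon
    push Not at hcon
    rw [← expect_piecewise S] at hbig
    exact absurd hbig (not_lt.2 ((abs_expect_le _).trans (expect_le_of_le hcon)))
  have hpw : ∀ x T, T ⊆ S → C (S.piecewise x z) T = C x T := fun x T hT =>
    hC T fun i hi => by simp [hT hi]
  have hcpr : ∀ x, cpr C S d (S.piecewise x z) = cpr C S d x := fun x =>
    cexp_congr _ _ (low_eq_iff.2 fun T hT => hpw x T hT.1)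
  simp only [hpw _ S subset_rfl, hcpr] at hz
  set C' : (∀ i, X i) → Finset ι → ℕ := fun x T =>
    if T.card = j then 2 * C x T +
      (if ∃ i ∈ S, T = S.erase i ∧ P i (S.piecewise x z) then 1 else 0) else C x T with hC'
  have href : Refines C' C := by
    intro x y T h
    simp only [hC'] at h
    split_ifs at h <;> omega
  have hdep : IsDep C' := by
    intro T x y hxy
    have h1 : C x T = C y T := hC T hxy
    have h2 : ∀ i ∈ S, T = S.erase i → (P i (S.piecewise x z) = P i (S.piecewise y z)) := by
      rintro i hi rfl
      refine hP i hi fun l hl => ?_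
      by_cases hlS : l ∈ S
      · simp only [hlS, piecewise_eq_of_mem]
        exact hxy l (by simpa [hlS] using hl)
      · simp [hlS]
    have h3 : (∃ i ∈ S, T = S.erase i ∧ P i (S.piecewise x z)) ↔
        (∃ i ∈ S, T = S.erase i ∧ P i (S.piecewise y z)) := by
      refine exists_congr fun i => and_congr_right fun hi => and_congr_right fun e => ?_
      rw [h2 i hi e]
    simp only [hC', h1, h3]
  have hne : ∀ x (T : Finset ι), T.card ≠ j → C' x T = C x T := fun x T hT => by
    simp [hC', hT]
  refine ⟨C', hdep, href, hne, ?_, ?_⟩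
  · intro x T
    simp only [hC']
    split_ifs <;> omega
  have hf : ∀ x, C' x S = C x S := fun x => hne x S (by omega)
  have hw : ∀ x y, low C' S x = low C' S y →
      ind (∀ i ∈ S, P i (S.piecewise x z)) = ind (∀ i ∈ S, P i (S.piecewise y z)) := by
    intro x y hxy
    rw [low_eq_iff] at hxy
    apply ind_congr
    refine forall₂_congr fun i hi => ?_
    have h1 := hxy (S.erase i) (erase_ssubset hi)
    have hcard : (S.erase i).card = j := by rw [card_erase_of_mem hi]; omega
    have h2 : ∀ u : ∀ i, X i, (∃ i' ∈ S, S.erase i = S.erase i' ∧ P i' (S.piecewise u z)) ↔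
        P i (S.piecewise u z) := by
      intro u
      constructor
      · rintro ⟨i', hi', e, h⟩
        rwa [Finset.erase_injOn S hi hi' e]
      · exact fun h => ⟨i, hi, rfl, h⟩
    simp only [hC', hcard, if_true, h2] at h1
    by_cases hx : P i (S.piecewise x z) <;> by_cases hy : P i (S.piecewise y z) <;>
      simp only [hx, hy, if_true, if_false] at h1 ⊢ <;> omega
  have hcpr' : ∀ x, cpr C' S d x = cexp (low C' S) (fun y => ind (C y S = d)) x := by
    intro x; unfold cpr; simp only [hf]
  have key := expect_cexp_mul (low C' S) (fun y => ind (C y S = d)) _ hw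
  simp only [sub_mul, Finset.expect_sub_distrib] at hz
  rw [← key, ← Finset.expect_sub_distrib] at hz
  have hle : |𝔼 x : ∀ i, X i, (cexp (low C' S) (fun y => ind (C y S = d)) x *
      ind (∀ i ∈ S, P i (S.piecewise x z)) - cpr C S d x *
      ind (∀ i ∈ S, P i (S.piecewise x z)))| ≤ 𝔼 x, |cpr C' S d x - cpr C S d x| := by
    refine (abs_expect_le _).trans (expect_mono fun x => ?_)
    rw [← sub_mul, abs_mul, hcpr', abs_of_nonneg (ind_nonneg _)]
    exact mul_le_of_le_one_right (abs_nonneg _) (ind_le_one _)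
  have h1 : ε ≤ 𝔼 x, |cpr C' S d x - cpr C S d x| := (hz.le.trans hle)
  exact (pow_le_pow_left₀ hε.le h1 2).trans (sq_expect_abs_le _)

/-- Weak regularity: refine level `j` so that all deviations at level `j + 1` are cut-small. -/
lemma weak_refine {ε : ℝ} (hε : 0 < ε) (j N₀ : ℕ) (n : ℕ) :
    ∀ (N : ℕ) (C : (∀ i, X i) → Finset ι → ℕ), IsDep C → (∀ x S, C x S < N) →
    (∀ x (S : Finset ι), S.card = j + 1 → C x S < N₀) →
    (Fintype.card (Finset ι) : ℝ) < energy N₀ j C + n * ε ^ 2 →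
    ∃ C' : (∀ i, X i) → Finset ι → ℕ, IsDep C' ∧ (∀ x S, C' x S < 2 ^ n * N) ∧
      Refines C' C ∧ (∀ x (T : Finset ι), T.card ≠ j → C' x T = C x T) ∧
      ∀ (S : Finset ι) d, S.card = j + 1 →
        CutLE S (fun x => ind (C' x S = d) - cpr C' S d x) ε := by
  induction n with
  | zero =>
    intro N C _ _ _ h
    have := energy_le N₀ j C
    rw [Nat.cast_zero, zero_mul, add_zero] at h
    linarith
  | succ n ih =>
    intro N C hC hN hN0 hen
    by_cases hgood : ∀ (S : Finset ι) d, S.card = j + 1 →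
        CutLE S (fun x => ind (C x S = d) - cpr C S d x) ε
    · refine ⟨C, hC, fun x S => (hN x S).trans_le ?_, fun _ _ _ h => h, fun _ _ _ => rfl, hgood⟩
      exact Nat.le_mul_of_pos_left _ (by positivity)
    · push Not at hgood
      obtain ⟨S, d, hS, hbad⟩ := hgood
      have hd : d < N₀ := by
        by_contra hcon
        have h0 : ∀ x, C x S ≠ d := fun x => by have := hN0 x S hS; omega
        apply hbad
        refine (CutLE.zero hε.le).congr fun x => ?_
        rw [ind_false (h0 x), cpr_eq_zero h0, sub_zero]
      obtain ⟨C', hdep, href, hne, hle, hinc⟩ := weak_step hC hS hε hbad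
      have he : ∀ x (S : Finset ι), S.card = j + 1 → C' x S = C x S :=
        fun x S hS => hne x S (by omega)
      have h1 := expect_sq_le_energy_sub href he hS hd
      obtain ⟨C'', h2, h3, h4, h5, h6⟩ := ih (2 * N) C' hdep
        (fun x S => by have := hN x S; have := hle x S; omega)
        (fun x S hS => by rw [he x S hS]; exact hN0 x S hS)
        (by push_cast at hen ⊢; linarith)
      exact ⟨C'', h2, fun x S => by have := h3 x S; rw [pow_succ]; linarith, h4.trans href,
        fun x T hT => (h5 x T hT).trans (hne x T hT), h6⟩

end Partite

section Strong

variable (ι : Type) [Fintype ι] [DecidableEq ι]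

/-- Regularity of all levels up to `j`, with bounds independent of the vertex sets. -/
def StrongReg (j : ℕ) : Prop :=
  ∀ γ : ℝ, 0 < γ → ∀ ε : ℕ → ℝ, (∀ n, 0 < ε n) → ∀ N : ℕ, ∃ M : ℕ,
    ∀ (X : ι → Type) [∀ i, Fintype (X i)] [∀ i, Nonempty (X i)]
      (A : (∀ i, X i) → Finset ι → ℕ), IsDep A → (∀ x S, A x S < N) →
    ∃ N' ≤ M, ∃ C : (∀ i, X i) → Finset ι → ℕ, IsDep C ∧ (∀ x S, C x S < N') ∧ Refines C A ∧
      (∀ x (S : Finset ι), j ≤ S.card → C x S = A x S) ∧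
      ∀ S : Finset ι, S.card ≤ j → ∃ g h : ℕ → (∀ i, X i) → ℝ,
        (∀ d x, ind (C x S = d) = cpr C S d x + g d x + h d x) ∧
        ∑ d ∈ range N', (𝔼 x, |g d x|) ≤ γ ∧ ∀ d, CutLE S (h d) (ε N')

variable {ι}

lemma StrongReg.zero : StrongReg ι 0 := by
  intro γ hγ ε hε N
  refine ⟨N, fun X _ _ A hA hN => ⟨N, le_rfl, A, hA, hN, fun _ _ _ h => h, fun _ _ _ => rfl, ?_⟩⟩
  intro S hS
  rw [Nat.le_zero, card_eq_zero] at hS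
  subst hS
  refine ⟨fun _ _ => 0, fun _ _ => 0, fun d x => ?_, by simpa using hγ.le,
    fun d => CutLE.zero (hε N).le⟩
  have hconst : ∀ y, A y ∅ = A x ∅ := fun y => hA ∅ (by simp)
  have hl : ∀ y, low A ∅ y = low A ∅ x := fun y => low_eq_iff.2 fun T hT => by simp at hT
  rw [cpr, cexp]
  simp only [hconst, hl, ind_true, add_zero]
  simp

lemma StrongReg.succ {j : ℕ} (hj : StrongReg ι j) : StrongReg ι (j + 1) := by
  intro γ hγ ε hε N₀
  set γ' : ℝ := γ / (N₀ + 1) with hγ'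
  have hγ'0 : 0 < γ' := by positivity
  have key : ∀ n N : ℕ, ∃ M : ℕ,
    ∀ (X : ι → Type) [∀ i, Fintype (X i)] [∀ i, Nonempty (X i)]
      (A : (∀ i, X i) → Finset ι → ℕ), IsDep A → (∀ x S, A x S < N) →
      (∀ x (S : Finset ι), S.card = j + 1 → A x S < N₀) →
      (Fintype.card (Finset ι) : ℝ) < energy N₀ j A + n * γ' ^ 2 →
    ∃ N' ≤ M, ∃ C : (∀ i, X i) → Finset ι → ℕ, IsDep C ∧ (∀ x S, C x S < N') ∧ Refines C A ∧
      (∀ x (S : Finset ι), j + 1 ≤ S.card → C x S = A x S) ∧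
      ∀ S : Finset ι, S.card ≤ j + 1 → ∃ g h : ℕ → (∀ i, X i) → ℝ,
        (∀ d x, ind (C x S = d) = cpr C S d x + g d x + h d x) ∧
        ∑ d ∈ range N', (𝔼 x, |g d x|) ≤ γ ∧ ∀ d, CutLE S (h d) (ε N') := by
    intro n
    induction n with
    | zero =>
      intro N
      refine ⟨0, fun X _ _ A _ _ _ h => ?_⟩
      have := energy_le N₀ j A
      rw [Nat.cast_zero, zero_mul, add_zero] at h
      linarith
    | succ n ih =>
      intro N
      obtain ⟨M₁, hM₁⟩ := hj γ hγ ε hε N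
      have hr : ∀ N₁ : ℕ, ∃ r : ℕ, (Fintype.card (Finset ι) : ℝ) < r * (ε N₁) ^ 2 := by
        intro N₁
        obtain ⟨r, hr⟩ := exists_nat_gt ((Fintype.card (Finset ι) : ℝ) / (ε N₁) ^ 2)
        exact ⟨r, (div_lt_iff₀ (pow_pos (hε N₁) 2)).1 hr⟩
      choose r hr using hr
      set N₂ := (range (M₁ + 1)).sup fun N₁ => 2 ^ r N₁ * N₁ with hN₂
      obtain ⟨M₂, hM₂⟩ := ih N₂
      refine ⟨max M₁ M₂, fun X _ _ A hA hN hN0 hen => ?_⟩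
      obtain ⟨N₁, hN₁, C, hC, hCN, hCA, hCe, hCr⟩ := hM₁ X A hA hN
      have heA : ∀ x (S : Finset ι), S.card = j + 1 → C x S = A x S :=
        fun x S hS => hCe x S (by omega)
      have hC0 : ∀ x (S : Finset ι), S.card = j + 1 → C x S < N₀ := fun x S hS => by
        rw [heA x S hS]; exact hN0 x S hS
      have hE0 : 0 ≤ energy N₀ j C :=
        sum_nonneg fun S _ => sum_nonneg fun d _ => expect_nonneg' fun x => sq_nonneg _
      obtain ⟨C', hC', hCN', hCC', hCe', hCr'⟩ := weak_refine (hε N₁) j N₀ (r N₁) N₁ C hC hCN hC0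
        (by have := hr N₁; linarith)
      have heC : ∀ x (S : Finset ι), S.card = j + 1 → C' x S = C x S :=
        fun x S hS => hCe' x S (by omega)
      by_cases hinc : energy N₀ j C' - energy N₀ j C ≤ γ' ^ 2
      · refine ⟨N₁, hN₁.trans (le_max_left _ _), C, hC, hCN, hCA,
          fun x S hS => hCe x S (by omega), fun S hS => ?_⟩
        rcases Nat.lt_or_ge j S.card with hlt | hge
        swap
        · exact hCr S hge
        have hSc : S.card = j + 1 := by omega
        refine ⟨fun d x => cpr C' S d x - cpr C S d x,
          fun d x => ind (C' x S = d) - cpr C' S d x, fun d x => ?_, ?_, fun d => hCr' S d hSc⟩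
        · simp only [heC x S hSc]; ring
        · have hz : ∀ d, N₀ ≤ d → 𝔼 x, |cpr C' S d x - cpr C S d x| = 0 := by
            intro d hd
            have h1 : ∀ x, C x S ≠ d := fun x => by have := hC0 x S hSc; omega
            have h2 : ∀ x, C' x S ≠ d := fun x => by rw [heC x S hSc]; exact h1 x
            simp [cpr_eq_zero h1, cpr_eq_zero h2]
          have hb : ∀ d, d < N₀ → 𝔼 x, |cpr C' S d x - cpr C S d x| ≤ γ' := by
            intro d hd
            have h1 := (sq_expect_abs_le fun x => cpr C' S d x - cpr C S d x).trans
              ((expect_sq_le_energy_sub hCC' heC hSc hd).trans hinc)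
            exact (abs_le_of_sq_le_sq' h1 hγ'0.le).2
          calc ∑ d ∈ range N₁, (𝔼 x, |cpr C' S d x - cpr C S d x|)
              ≤ ∑ d ∈ range N₁, (if d < N₀ then γ' else 0) := by
                refine sum_le_sum fun d _ => ?_
                split_ifs with h
                · exact hb d h
                · exact (hz d (by omega)).le
            _ ≤ N₀ * γ' := by
                rw [← sum_filter, sum_const, nsmul_eq_mul]
                refine mul_le_mul_of_nonneg_right ?_ hγ'0.le
                have : (range N₁).filter (fun d => d < N₀) ⊆ range N₀ := fun d hd => by
                  simp at hd ⊢; exact hd.2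
                exact_mod_cast (card_le_card this).trans_eq (card_range _)
            _ ≤ γ := by
                rw [hγ', mul_div_assoc', div_le_iff₀ (by positivity)]
                nlinarith
      · push Not at hinc
        have h1 := energy_mono (N := N₀) hCA heA
        have hN₂' : 2 ^ r N₁ * N₁ ≤ N₂ :=
          le_sup (f := fun N₁ => 2 ^ r N₁ * N₁) (mem_range.2 (by omega))
        obtain ⟨N', hN', C'', h2, h3, h4, h5, h6⟩ := hM₂ X C' hC'
          (fun x S => (hCN' x S).trans_le hN₂')
          (fun x S hS => by rw [heC x S hS]; exact hC0 x S hS)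
          (by push_cast at hen; linarith)
        refine ⟨N', hN'.trans (le_max_right _ _), C'', h2, h3, (h4.trans hCC').trans hCA,
          fun x S hS => ?_, h6⟩
        rw [h5 x S hS, hCe' x S (by omega), hCe x S (by omega)]
  obtain ⟨n, hn⟩ := exists_nat_gt ((Fintype.card (Finset ι) : ℝ) / γ' ^ 2)
  rw [div_lt_iff₀ (pow_pos hγ'0 2)] at hn
  obtain ⟨M, hM⟩ := key n N₀
  refine ⟨M, fun X _ _ A hA hN => hM X A hA hN (fun x S _ => hN x S) ?_⟩
  have hE0 : 0 ≤ energy N₀ j A :=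
    sum_nonneg fun S _ => sum_nonneg fun d _ => expect_nonneg' fun x => sq_nonneg _
  linarith

lemma strongReg (j : ℕ) : StrongReg ι j := by
  induction j with
  | zero => exact StrongReg.zero
  | succ j ih => exact ih.succ

end Strong

end

end HypReg

namespace HypReg

open Finset
open scoped BigOperators

attribute [local instance 10] Classical.propDecidable

set_option linter.unusedSectionVars false

noncomputable section

lemma expect_inv_le {Ω τ : Type*} [Fintype Ω] [Fintype τ] (q : Ω → τ) :
    𝔼 x, (1 / 𝔼 y, ind (q y = q x)) ≤ Fintype.card τ := by
  have e : ∀ x, (1 / 𝔼 y, ind (q y = q x)) =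
      ∑ t, ind (q x = t) * (1 / 𝔼 y, ind (q y = t)) := fun x => (sum_ind_mul (q x) (fun t => 1 / 𝔼 y, ind (q y = t))).symm
  simp only [e, Finset.expect_sum_comm, ← Finset.expect_mul]
  refine (sum_le_sum (g := fun _ => (1 : ℝ)) fun t _ => ?_).trans (by simp)
  rw [mul_one_div]
  exact div_self_le_one _

section Kernels

variable {ι : Type} [Fintype ι] [DecidableEq ι] {κ l : Type} [Fintype κ] [Fintype l]

/-- A kernel for additional colours in `l`, relative to base colours in `κ`. -/
structure IsRelKer (v : Finset ι → (Finset ι → κ × l) → ℝ) : Prop where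
  local' : ∀ S p q, (∀ T ⊆ S, p T = q T) → v S p = v S q
  nonneg : ∀ S p, 0 ≤ v S p
  sum_eq : ∀ S p b, ∑ c, v S (Function.update p S (b, c)) = 1
  base : ∃ c₀ : l, ∀ p, v ∅ p = ind ((p ∅).2 = c₀)

lemma IsRelKer.le_one {v : Finset ι → (Finset ι → κ × l) → ℝ} (hv : IsRelKer v)
    (S : Finset ι) (p : Finset ι → κ × l) : v S p ≤ 1 := by
  have h := hv.sum_eq S p (p S).1
  have h2 : v S (Function.update p S ((p S).1, (p S).2)) ≤
      ∑ c, v S (Function.update p S ((p S).1, c)) :=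
    Finset.single_le_sum (f := fun c => v S (Function.update p S ((p S).1, c)))
      (fun d _ => hv.nonneg _ _) (mem_univ _)
  rw [Prod.mk.eta, Function.update_eq_self] at h2
  linarith

/-- Product of a kernel with a relative kernel. -/
def kmul (β : Finset ι → (Finset ι → κ) → ℝ) (v : Finset ι → (Finset ι → κ × l) → ℝ)
    (S : Finset ι) (p : Finset ι → κ × l) : ℝ :=
  β S (fun T => (p T).1) * v S p

lemma fst_update (p : Finset ι → κ × l) (S : Finset ι) (d : κ × l) :
    (fun T => (Function.update p S d T).1) = Function.update (fun T => (p T).1) S d.1 := by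
  funext T
  rcases eq_or_ne T S with rfl | h
  · simp
  · simp [h]

lemma IsKer.kmul {β : Finset ι → (Finset ι → κ) → ℝ} {v : Finset ι → (Finset ι → κ × l) → ℝ}
    (hβ : IsKer β) (hv : IsRelKer v) : IsKer (kmul β v) where
  local' S p q h := by
    unfold HypReg.kmul
    rw [hv.local' S p q h, hβ.local' S _ (fun T => (q T).1) fun T hT => by rw [h T hT]]
  nonneg S p := mul_nonneg (hβ.nonneg _ _) (hv.nonneg _ _)
  sum_eq S p := by
    unfold HypReg.kmul
    rw [Fintype.sum_prod_type]
    simp only [fst_update, ← mul_sum, hv.sum_eq, mul_one]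
    exact hβ.sum_eq _ _

lemma IsRelKer.sum_prod {v : Finset ι → (Finset ι → κ × l) → ℝ} (hv : IsRelKer v)
    (b : Finset ι → κ) : ∑ c : Finset ι → l, ∏ S, v S (fun T => (b T, c T)) = 1 := by
  have hK : IsKer (fun S (c : Finset ι → l) => v S (fun T => (b T, c T))) := {
    local' := fun S p q h => hv.local' S _ _ fun T hT => by rw [h T hT]
    nonneg := fun S p => hv.nonneg _ _
    sum_eq := fun S p => by
      rw [← hv.sum_eq S (fun T => (b T, p T)) (b S)]
      refine sum_congr rfl fun c _ => ?_
      congr 1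
      funext T
      rcases eq_or_ne T S with rfl | h
      · simp
      · simp [h] }
  obtain ⟨c₀, _⟩ := hv.base
  have := hK.sum_out (fun _ => c₀) ∅ (fun S hS => by simp at hS)
  simpa [ind] using this

end Kernels

section Partite

variable {ι : Type} [Fintype ι] [DecidableEq ι] {X : ι → Type} [∀ i, Fintype (X i)]
  [∀ i, Nonempty (X i)] {κ l : Type} [Fintype κ] [Fintype l]

/-- Pairing of two systems of colours. -/
def pairC {κ l : Type*} (B : (∀ i, X i) → Finset ι → κ) (c : (∀ i, X i) → Finset ι → l) :
    (∀ i, X i) → Finset ι → κ × l :=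
  fun x S => (B x S, c x S)

lemma IsDep.pairC {B : (∀ i, X i) → Finset ι → κ} {c : (∀ i, X i) → Finset ι → l}
    (hB : IsDep B) (hc : IsDep c) : IsDep (pairC B c) := fun S x y h => by
  have h1 := hB S h
  have h2 := hc S h
  simp only at h1 h2
  simp only [HypReg.pairC, h1, h2]

lemma CutLE.absorb_fun {C : (∀ i, X i) → Finset ι → κ} (hC : IsDep C) {S : Finset ι}
    {h : (∀ i, X i) → ℝ} {ε : ℝ} (H : CutLE S h ε) (ψ : (Finset ι → κ) → ℝ) (d : κ)
    (hψ : ∀ p q, (∀ T ⊆ S, p T = q T) → ψ p = ψ q) (hψ1 : ∀ p, |ψ p| ≤ 1) :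
    CutLE S (fun x => ψ (Function.update (C x) S d) * h x)
      (Fintype.card (Finset ι → κ) * ε) := by
  have h1 : CutLE S (fun x => ∑ p : Finset ι → κ, (ψ p * ind (∀ T, ¬ T ⊂ S → p T = d)) *
      (h x * ind (∀ T ∈ S.ssubsets, C x T = p T))) (Fintype.card (Finset ι → κ) * ε) := by
    refine CutLE.sum univ fun p _ => ?_
    refine (H.absorb_cyl hC S.ssubsets (fun T hT => ?_) p).const_mul ?_
    · exact (mem_ssubsets.1 hT).2
    · rw [abs_mul, abs_of_nonneg (ind_nonneg _)]
      exact mul_le_one₀ (hψ1 p) (ind_nonneg _) (ind_le_one _)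
  refine h1.congr fun x => ?_
  set p₀ : Finset ι → κ := fun T => if T ⊂ S then C x T else d with hp₀
  have h2 : ∀ p : Finset ι → κ, ind (∀ T, ¬ T ⊂ S → p T = d) *
      ind (∀ T ∈ S.ssubsets, C x T = p T) = ind (p₀ = p) := by
    intro p
    rw [← ind_and]
    apply ind_congr
    rw [funext_iff]
    constructor
    · rintro ⟨h1, h2⟩ T
      by_cases hT : T ⊂ S
      · simp [hp₀, hT, h2 T (mem_ssubsets.2 hT)]
      · simp [hp₀, hT, h1 T hT]
    · intro h
      refine ⟨fun T hT => ?_, fun T hT => ?_⟩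
      · rw [← h T]; simp [hp₀, hT]
      · rw [← h T]; simp [hp₀, mem_ssubsets.1 hT]
  have h3 : ∀ p : Finset ι → κ, (ψ p * ind (∀ T, ¬ T ⊂ S → p T = d)) *
      (h x * ind (∀ T ∈ S.ssubsets, C x T = p T)) = ind (p₀ = p) * (ψ p * h x) := by
    intro p; rw [← h2]; ring
  simp only [h3]
  rw [sum_ind_mul, hψ (Function.update (C x) S d) p₀]
  intro T hT
  rcases eq_or_ne T S with rfl | hne
  · simp [hp₀]
  · simp [hp₀, hne, hT.ssubset_of_ne hne]

/-- `c` is pseudorandom relative to `B` with relative kernel `v`. -/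
def RelPseudo (B : (∀ i, X i) → Finset ι → κ) (c : (∀ i, X i) → Finset ι → l)
    (v : Finset ι → (Finset ι → κ × l) → ℝ) (ε : ℝ) : Prop :=
  ∀ S c' b, CutLE S (fun x => ind (B x = b) *
    (ind (c x S = c') - v S (Function.update (pairC B c x) S (b S, c')))) ε

lemma RelPseudo.superReg {B : (∀ i, X i) → Finset ι → κ} {c : (∀ i, X i) → Finset ι → l}
    {v : Finset ι → (Finset ι → κ × l) → ℝ} {ε : ℝ} (h : RelPseudo B c v ε) (hε : 0 ≤ ε)
    (hB : IsDep B) (hc : IsDep c) (hv : IsRelKer v) {β : Finset ι → (Finset ι → κ) → ℝ}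
    {ε' : ℝ} (hS : SuperReg B β ε') :
    SuperReg (pairC B c) (kmul β v) (Fintype.card (Finset ι → κ) * ε +
      Fintype.card (Finset ι → κ × l) * ε') := by
  rintro S ⟨b, c'⟩
  have h1 : CutLE S (fun x => ∑ bb ∈ univ.filter (fun bb : Finset ι → κ => bb S = b),
      ind (B x = bb) * (ind (c x S = c') - v S (Function.update (pairC B c x) S (bb S, c'))))
      (Fintype.card (Finset ι → κ) * ε) := by
    refine (CutLE.sum _ fun bb _ => h S c' bb).mono ?_
    exact mul_le_mul_of_nonneg_right (by exact_mod_cast card_le_univ _) hε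
  have h2 := (hS S b).absorb_fun (hB.pairC hc) (v S) (b, c') (hv.local' S) fun p => by
    rw [abs_of_nonneg (hv.nonneg _ _)]; exact hv.le_one _ _
  refine (h1.add h2).congr fun x => ?_
  have h3 : ∑ bb ∈ univ.filter (fun bb : Finset ι → κ => bb S = b),
      ind (B x = bb) * (ind (c x S = c') - v S (Function.update (pairC B c x) S (bb S, c')))
      = ind (B x S = b) * (ind (c x S = c') -
        v S (Function.update (pairC B c x) S (b, c'))) := by
    rw [sum_filter]
    have : ∀ bb : Finset ι → κ, (if bb S = b then ind (B x = bb) * (ind (c x S = c') -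
        v S (Function.update (pairC B c x) S (bb S, c'))) else 0) = ind (B x = bb) *
        (ind (bb S = b) * (ind (c x S = c') -
        v S (Function.update (pairC B c x) S (b, c')))) := by
      intro bb
      split_ifs with hb
      · rw [ind_true hb, hb]; ring
      · rw [ind_false hb]; ring
    rw [sum_congr rfl fun bb _ => this bb, sum_ind_mul]
  rw [h3]
  unfold dev kmul
  rw [fst_update]
  have h4 : ind (pairC B c x S = (b, c')) = ind (B x S = b) * ind (c x S = c') := by
    rw [← ind_and]; exact ind_congr Prod.mk_inj
  rw [h4]
  have h5 : (fun T => (pairC B c x T).1) = B x := rfl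
  rw [h5]
  ring

lemma RelPseudo.count {B : (∀ i, X i) → Finset ι → κ} {c : (∀ i, X i) → Finset ι → l}
    {v : Finset ι → (Finset ι → κ × l) → ℝ} {ε : ℝ} (h : RelPseudo B c v ε)
    (hc : IsDep c) (hv : IsRelKer v) (p : Finset ι → κ × l) :
    |(𝔼 x, ind (pairC B c x = p)) - (𝔼 x, ind (B x = fun T => (p T).1)) * ∏ S, v S p|
      ≤ Fintype.card (Finset ι) * ε := by
  set b : Finset ι → κ := fun T => (p T).1 with hb
  have main : ∀ 𝒟 : Finset (Finset ι), DownClosed 𝒟 →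
      |(𝔼 x, ind (B x = b) * ind (∀ T ∈ 𝒟, c x T = (p T).2)) -
        (𝔼 x, ind (B x = b)) * ∏ S ∈ 𝒟, v S p| ≤ 𝒟.card * ε := by
    refine DownClosed.induction (by simp [ind]) ?_
    intro 𝒟 S h𝒟 hS hmax hd ih
    have h1 := ((h S (p S).2 b).absorb_cyl hc _ hmax fun T => (p T).2).expect_le
    have e : ∀ x, ind (B x = b) * ind (∀ T ∈ 𝒟, c x T = (p T).2) =
        v S p * (ind (B x = b) * ind (∀ T ∈ 𝒟.erase S, c x T = (p T).2)) +
        ind (B x = b) * (ind (c x S = (p S).2) -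
          v S (Function.update (pairC B c x) S (b S, (p S).2))) *
          ind (∀ T ∈ 𝒟.erase S, c x T = (p T).2) := by
      intro x
      have h1 : ind (∀ T ∈ 𝒟, c x T = (p T).2)
          = ind (c x S = (p S).2) * ind (∀ T ∈ 𝒟.erase S, c x T = (p T).2) := by
        rw [← ind_and]
        apply ind_congr
        conv_lhs => rw [← insert_erase hS]
        rw [forall_mem_insert]
      rw [h1]
      by_cases hx : B x = b
      swap
      · simp [ind_false hx]
      by_cases hy : ∀ T ∈ 𝒟.erase S, c x T = (p T).2
      swap
      · rw [ind_false hy]; ring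
      rw [ind_true hx, ind_true hy, hv.local' S (Function.update _ _ _) p]
      · ring
      · intro T hT
        rcases eq_or_ne T S with rfl | hne
        · simp [hb]
        · rw [Function.update_of_ne hne, pairC, hy T (mem_erase.2 ⟨hne, h𝒟 S hS T hT⟩), hx]
    have hcard : (𝒟.card : ℝ) = (𝒟.erase S).card + 1 := by
      rw [← card_erase_add_one hS]; push_cast; ring
    rw [Finset.expect_congr rfl fun x _ => e x, Finset.expect_add_distrib, ← Finset.mul_expect,
      ← mul_prod_erase _ _ hS, hcard, add_mul, one_mul, mul_left_comm, add_sub_right_comm,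
      ← mul_sub]
    refine (abs_add_le _ _).trans (add_le_add ?_ h1)
    rw [abs_mul, abs_of_nonneg (hv.nonneg S p)]
    exact (mul_le_of_le_one_left (abs_nonneg _) (hv.le_one S p)).trans ih
  have := main univ (fun _ _ _ _ => mem_univ _)
  have e : ∀ x, ind (B x = b) * ind (∀ T ∈ (univ : Finset (Finset ι)), c x T = (p T).2)
      = ind (pairC B c x = p) := by
    intro x
    rw [← ind_and]
    apply ind_congr
    constructor
    · rintro ⟨h1, h2⟩
      funext T
      rw [pairC, h1, h2 T (mem_univ _)]
    · rintro rfl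
      exact ⟨rfl, fun _ _ => rfl⟩
  simp only [e] at this
  exact this

end Partite

end

end HypReg

namespace HypReg

open Finset
open scoped BigOperators

attribute [local instance 10] Classical.propDecidable

set_option linter.unusedSectionVars false

noncomputable section

section Source

variable {ι : Type} [Fintype ι] [DecidableEq ι] {X : ι → Type} [∀ i, Fintype (X i)]
  [∀ i, Nonempty (X i)] {κ l : Type} [Fintype κ] [Fintype l]

/-- Probability of a pattern below `S`, together with the event `R`. -/
def below {κ : Type*} (C : (∀ i, X i) → Finset ι → κ) (S : Finset ι) (p : Finset ι → κ)
    (R : (∀ i, X i) → Prop) : ℝ :=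
  𝔼 x, ind (R x) * ind (∀ T ∈ S.ssubsets, C x T = p T)

lemma below_congr {κ : Type*} (C : (∀ i, X i) → Finset ι → κ) {S : Finset ι}
    {p q : Finset ι → κ} (h : ∀ T ⊂ S, p T = q T) (R : (∀ i, X i) → Prop) :
    below C S p R = below C S q R := by
  unfold below
  refine expect_congr rfl fun x _ => ?_
  congr 1
  apply ind_congr
  refine forall₂_congr fun T hT => ?_
  rw [h T (mem_ssubsets.1 hT)]

lemma below_nonneg {κ : Type*} (C : (∀ i, X i) → Finset ι → κ) (S : Finset ι)
    (p : Finset ι → κ) (R : (∀ i, X i) → Prop) : 0 ≤ below C S p R :=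
  expect_nonneg' fun _ => mul_nonneg (ind_nonneg _) (ind_nonneg _)

lemma below_mono {κ : Type*} (C : (∀ i, X i) → Finset ι → κ) (S : Finset ι)
    (p : Finset ι → κ) {R R' : (∀ i, X i) → Prop} (h : ∀ x, R x → R' x) :
    below C S p R ≤ below C S p R' := by
  refine expect_mono fun x => mul_le_mul_of_nonneg_right ?_ (ind_nonneg _)
  by_cases hx : R x
  · rw [ind_true hx, ind_true (h x hx)]
  · rw [ind_false hx]; exact ind_nonneg _

/-- Conditional probability of the colour `c` at `S` given the colours below `S` and the
base colour at `S`. -/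
def condKer (B : (∀ i, X i) → Finset ι → κ) (c : (∀ i, X i) → Finset ι → l) (c₀ : l)
    (S : Finset ι) (p : Finset ι → κ × l) : ℝ :=
  if below (pairC B c) S p (fun x => B x S = (p S).1) = 0 then ind ((p S).2 = c₀)
  else below (pairC B c) S p (fun x => pairC B c x S = p S) /
    below (pairC B c) S p (fun x => B x S = (p S).1)

lemma condKer_mul (B : (∀ i, X i) → Finset ι → κ) (c : (∀ i, X i) → Finset ι → l) (c₀ : l)
    (S : Finset ι) (p : Finset ι → κ × l) :
    condKer B c c₀ S p * below (pairC B c) S p (fun x => B x S = (p S).1) =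
      below (pairC B c) S p (fun x => pairC B c x S = p S) := by
  unfold condKer
  split_ifs with h
  · rw [h, mul_zero]
    refine (le_antisymm ?_ (below_nonneg _ _ _ _)).symm
    rw [← h]
    exact below_mono _ _ _ fun x hx => by rw [← hx]; rfl
  · rw [div_mul_cancel₀ _ h]

lemma condKer_isRelKer (B : (∀ i, X i) → Finset ι → κ) {c : (∀ i, X i) → Finset ι → l}
    (hc : IsDep c) (x₀ : ∀ i, X i) : IsRelKer (condKer B c (c x₀ ∅)) where
  local' S p q h := by
    unfold condKer
    rw [h S subset_rfl, below_congr (pairC B c) (fun T hT => h T hT.subset),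
      below_congr (pairC B c) (fun T hT => h T hT.subset)]
  nonneg S p := by
    unfold condKer
    split_ifs
    · exact ind_nonneg _
    · exact div_nonneg (below_nonneg _ _ _ _) (below_nonneg _ _ _ _)
  sum_eq S p b := by
    unfold condKer
    simp only [Function.update_self]
    have h1 : ∀ (d : l) R, below (pairC B c) S (Function.update p S (b, d)) R =
        below (pairC B c) S p R := fun d R => below_congr _ (fun T hT => by
      rw [Function.update_of_ne hT.ne]) _
    simp only [h1]
    split_ifs with h
    · simpa [eq_comm] using sum_ind_eq (c x₀ ∅)
    · rw [← sum_div, div_eq_one_iff_eq h]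
      unfold below
      rw [← Finset.expect_sum_comm]
      refine expect_congr rfl fun x _ => ?_
      rw [← sum_mul]
      congr 1
      have : ∀ d, ind (pairC B c x S = (b, d)) = ind (c x S = d) * ind (B x S = b) := by
        intro d
        rw [mul_comm, ← ind_and]
        exact ind_congr Prod.mk_inj
      rw [sum_congr rfl fun d _ => this d, ← sum_mul, sum_ind_eq, one_mul]
  base := by
    refine ⟨c x₀ ∅, fun p => ?_⟩
    have hm := condKer_mul B c (c x₀ ∅) ∅ p
    by_cases h : below (pairC B c) ∅ p (fun x => B x ∅ = (p ∅).1) = 0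
    · unfold condKer; rw [if_pos h]
    · have h2 : below (pairC B c) ∅ p (fun x => pairC B c x ∅ = p ∅) =
          ind ((p ∅).2 = c x₀ ∅) * below (pairC B c) ∅ p (fun x => B x ∅ = (p ∅).1) := by
        unfold below
        rw [Finset.mul_expect]
        refine expect_congr rfl fun x _ => ?_
        rw [← mul_assoc]
        congr 1
        rw [← ind_and ((p ∅).2 = c x₀ ∅)]
        apply ind_congr
        have : c x ∅ = c x₀ ∅ := hc ∅ (fun i hi => by simp at hi)
        rw [← this]
        change (B x ∅, c x ∅) = p ∅ ↔ (p ∅).2 = c x ∅ ∧ B x ∅ = (p ∅).1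
        rw [Prod.ext_iff, and_comm, @eq_comm _ (p ∅).2]
      exact mul_right_cancel₀ h (hm.trans h2)

/-- The regularity lemma over a superregular base. -/
lemma source_regSys {B : (∀ i, X i) → Finset ι → κ} {β : Finset ι → (Finset ι → κ) → ℝ}
    {ε : ℝ} (hβ : IsKer β) (hB : IsDep B) (hS : SuperReg B β ε) {N : ℕ}
    {C : (∀ i, X i) → Finset ι → ℕ} (hC : IsDep C) (hN : ∀ x S, C x S < N)
    (hCB : ∀ x y S, C x S = C y S → B x S = B y S) {γ δ : ℝ}
    (hreg : ∀ S : Finset ι, ∃ g h : ℕ → (∀ i, X i) → ℝ,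
        (∀ d x, ind (C x S = d) = cpr C S d x + g d x + h d x) ∧
        ∑ d ∈ range N, (𝔼 x, |g d x|) ≤ γ ∧ ∀ d, CutLE S (h d) δ)
    (x₀ : ∀ i, X i) (hε : 0 ≤ ε) :
    RegSys (pairC B fun x S => (⟨C x S, hN x S⟩ : Fin N))
      (kmul β (condKer B (fun x S => (⟨C x S, hN x S⟩ : Fin N)) ⟨C x₀ ∅, hN x₀ ∅⟩))
      (γ + Fintype.card (κ × Fin N) * (Fintype.card (Finset ι → κ × Fin N) * ε)) δ := by
  set c : (∀ i, X i) → Finset ι → Fin N := fun x S => ⟨C x S, hN x S⟩ with hc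
  set v := condKer B c ⟨C x₀ ∅, hN x₀ ∅⟩ with hv'
  have hcd : IsDep c := fun S x y h => Fin.ext (hC S h)
  have hv : IsRelKer v := condKer_isRelKer B hcd x₀
  intro S
  obtain ⟨g, h, hgh, hg, hh⟩ := hreg S
  have hrep : ∀ d : Fin N, ∃ b, ∀ x, c x S = d → B x S = b := by
    intro d
    by_cases hd : ∃ x, c x S = d
    · obtain ⟨x, hx⟩ := hd
      exact ⟨B x S, fun y hy => hCB y x S (by
        have := hy.trans hx.symm
        simpa [hc] using this)⟩
    · exact ⟨B x₀ S, fun x hx => (hd ⟨x, hx⟩).elim⟩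
  choose bOf hbOf using hrep
  have hind : ∀ x b d, ind (pairC B c x S = (b, d)) = ind (bOf d = b) * ind (C x S = d) := by
    intro x b d
    rw [← ind_and]
    apply ind_congr
    rw [pairC, Prod.mk_inj]
    have e : c x S = d ↔ C x S = (d : ℕ) := Fin.ext_iff
    rw [← e]
    refine and_congr_left fun h => ?_
    rw [hbOf d x h]
  set q : (∀ i, X i) → Finset ι → κ × Fin N :=
    fun x T => if T ⊂ S then pairC B c x T else pairC B c x₀ T with hq
  have hqiff : ∀ x y, (∀ T ∈ S.ssubsets, pairC B c y T = pairC B c x T) ↔ q y = q x := by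
    intro x y
    rw [funext_iff]
    refine forall_congr' fun T => ?_
    rw [mem_ssubsets]
    by_cases hT : T ⊂ S <;> simp [hq, hT]
  have hqlow : ∀ x y, low C S y = low C S x ↔ q y = q x := by
    intro x y
    rw [low_eq_iff, ← hqiff]
    refine forall_congr' fun T => ?_
    rw [mem_ssubsets]
    refine imp_congr_right fun _ => ?_
    constructor
    · intro h
      simp only [pairC, hc, h, hCB y x T h]
    · intro h
      have := congrArg Prod.snd h
      simpa [pairC, hc] using this
  have hcpr : ∀ x b d, ind (bOf d = b) * cpr C S d x * (𝔼 y, ind (q y = q x)) =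
      below (pairC B c) S (Function.update (pairC B c x) S (b, d))
        (fun y => pairC B c y S = (b, d)) := by
    intro x b d
    unfold cpr cexp
    simp only [hqlow]
    rw [mul_assoc, div_mul_cancel₀ _ (expect_ind_pos (p := fun y => q y = q x) rfl).ne',
      Finset.mul_expect, below_congr (q := pairC B c x) _ (fun T hT => by
        rw [Function.update_of_ne hT.ne])]
    unfold below
    refine expect_congr rfl fun y _ => ?_
    rw [hind, hqiff]
    ring
  have hML : ∀ x b, |below (pairC B c) S (pairC B c x) (fun y => B y S = b) -
      β S (Function.update (B x) S b) * (𝔼 y, ind (q y = q x))| ≤ ε := by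
    intro x b
    have h1 := ((hS S b).absorb_cyl (hB.pairC hcd) S.ssubsets
      (fun T hT => (mem_ssubsets.1 hT).2) (pairC B c x)).expect_le
    refine le_of_eq_of_le ?_ h1
    congr 1
    unfold below
    rw [Finset.mul_expect, ← Finset.expect_sub_distrib]
    refine expect_congr rfl fun y _ => ?_
    rw [← hqiff, ← sub_mul]
    apply ind_mul_congr
    intro hy
    unfold dev
    rw [hβ.local' S (Function.update (B x) S b) (Function.update (B y) S b)]
    intro T hT
    rcases eq_or_ne T S with rfl | hne
    · simp
    · rw [Function.update_of_ne hne, Function.update_of_ne hne]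
      exact (congrArg Prod.fst (hy T (mem_ssubsets.2 (hT.ssubset_of_ne hne)))).symm
  refine ⟨fun d x => ind (bOf d.2 = d.1) * g d.2 x + (ind (bOf d.2 = d.1) * cpr C S d.2 x -
    kmul β v S (Function.update (pairC B c x) S d)), fun d x => ind (bOf d.2 = d.1) * h d.2 x,
    ?_, ?_, fun d => (hh _).const_mul (by
      rw [abs_of_nonneg (ind_nonneg _)]; exact ind_le_one _)⟩
  · rintro ⟨b, d⟩ x
    rw [dev, hind, hgh]
    ring
  · have hbd : ∀ d : κ × Fin N, 𝔼 x, |ind (bOf d.2 = d.1) * g d.2 x +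
        (ind (bOf d.2 = d.1) * cpr C S d.2 x -
          kmul β v S (Function.update (pairC B c x) S d))| ≤
        ind (bOf d.2 = d.1) * (𝔼 x, |g d.2 x|) +
          Fintype.card (Finset ι → κ × Fin N) * ε := by
      rintro ⟨b, d⟩
      have hpt : ∀ x, |ind (bOf d = b) * g d x + (ind (bOf d = b) * cpr C S d x -
          kmul β v S (Function.update (pairC B c x) S (b, d)))| ≤
          ind (bOf d = b) * |g d x| + (1 / 𝔼 y, ind (q y = q x)) * ε := by
        intro x
        have hL : 0 < 𝔼 y, ind (q y = q x) := expect_ind_pos (p := fun y => q y = q x) rfl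
        refine (abs_add_le _ _).trans (add_le_add ?_ ?_)
        · rw [abs_mul, abs_of_nonneg (ind_nonneg _)]
        · set p := Function.update (pairC B c x) S (b, d) with hp
          have hm := condKer_mul B c ⟨C x₀ ∅, hN x₀ ∅⟩ S p
          rw [← hv'] at hm
          have hpS : p S = (b, d) := by simp [hp]
          simp only [hpS] at hm
          rw [← hcpr] at hm
          have hm2 : below (pairC B c) S p (fun x => B x S = b) =
              below (pairC B c) S (pairC B c x) (fun x => B x S = b) :=
            below_congr _ (fun T hT => by rw [hp, Function.update_of_ne hT.ne]) _
          have hk : kmul β v S p = β S (Function.update (B x) S b) * v S p := by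
            unfold kmul
            rw [hp, fst_update]
            rfl
          have e : ind (bOf d = b) * cpr C S d x - kmul β v S p = (1 / 𝔼 y, ind (q y = q x)) *
              (v S p * (below (pairC B c) S (pairC B c x) (fun y => B y S = b) -
                β S (Function.update (B x) S b) * (𝔼 y, ind (q y = q x)))) := by
            rw [mul_sub, ← hm2, hm, hk]
            field_simp
          rw [e, abs_mul, abs_of_nonneg (by positivity), abs_mul, abs_of_nonneg (hv.nonneg _ _)]
          refine mul_le_mul_of_nonneg_left ?_ (by positivity)
          exact (mul_le_of_le_one_left (abs_nonneg _) (hv.le_one _ _)).trans (hML x b)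
      refine (expect_mono hpt).trans ?_
      rw [Finset.expect_add_distrib, ← Finset.mul_expect, ← Finset.expect_mul]
      exact add_le_add le_rfl (mul_le_mul_of_nonneg_right (expect_inv_le q) hε)
    refine (sum_le_sum fun d _ => hbd d).trans ?_
    rw [sum_add_distrib, sum_const, card_univ, nsmul_eq_mul, Fintype.sum_prod_type_right]
    refine add_le_add ?_ le_rfl
    simp only [← sum_mul, sum_ind_eq, one_mul]
    rw [← Fin.sum_univ_eq_sum_range (fun d => 𝔼 x, |g d x|)] at hg
    exact hg

end Source

/-- Strong regularity for a system of colours over a superregular base. -/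
theorem source_regularity (ι : Type) [Fintype ι] [DecidableEq ι] (κ α : Type) [Fintype κ]
    [Fintype α] {η : ℝ} (hη : 0 < η) : ∃ M : ℕ, ∃ ε : ℝ, 0 < ε ∧
    ∀ (X : ι → Type) [∀ i, Fintype (X i)] [∀ i, Nonempty (X i)]
      (B : (∀ i, X i) → Finset ι → κ) (β : Finset ι → (Finset ι → κ) → ℝ)
      (A : (∀ i, X i) → Finset ι → α), IsDep B → IsKer β → SuperReg B β ε → IsDep A →
    ∃ N ≤ M, ∃ c : (∀ i, X i) → Finset ι → Fin N, IsDep c ∧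
      ∃ φ : Finset ι → Fin N → α, (∀ x S, A x S = φ S (c x S)) ∧
        (∀ S d, ∃ x, φ S d = A x S) ∧
      ∃ v : Finset ι → (Finset ι → κ × Fin N) → ℝ, IsRelKer v ∧
        ∑ p : Finset ι → κ × Fin N, |(𝔼 x, ind (pairC B c x = p)) - ∏ S, kmul β v S p| ≤ η := by
  set F : ℝ := (Fintype.card (Finset ι) : ℝ) with hF
  have hF0 : 0 < F := by rw [hF]; exact_mod_cast Fintype.card_pos
  set γ : ℝ := η / (3 * F) with hγ'
  have hγ : 0 < γ := by positivity
  set P : ℕ → ℝ := fun N => Fintype.card (Finset ι → κ × Fin N) with hP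
  have hP0 : ∀ N, 0 ≤ P N := fun N => Nat.cast_nonneg _
  obtain ⟨M, hM⟩ := strongReg (ι := ι) (Fintype.card ι) γ hγ (fun N => γ / (P N + 1))
    (fun N => div_pos hγ (by linarith [hP0 N])) (Fintype.card (κ × α))
  set D : ℝ := Fintype.card (κ × Fin M) * P M with hD
  have hD0 : 0 ≤ D := mul_nonneg (Nat.cast_nonneg _) (hP0 M)
  refine ⟨M, γ / (D + 1), by positivity, ?_⟩
  intro X _ _ B β A hB hβ hS hA
  set e := Fintype.equivFin (κ × α)
  obtain ⟨N, hNM, C, hC, hCN, hCA, -, hreg⟩ := hM X (fun x S => (e (B x S, A x S) : ℕ))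
    (fun S x y h => by
      have h1 := hB S h
      have h2 := hA S h
      simp only at h1 h2 ⊢
      rw [h1, h2]) (fun x S => (e _).2)
  have hCBA : ∀ x y S, C x S = C y S → B x S = B y S ∧ A x S = A y S := by
    intro x y S h
    have := hCA x y S h
    simp only at this
    have := e.injective (Fin.ext this)
    exact Prod.mk_inj.1 this
  have x₀ : ∀ i, X i := fun i => Classical.arbitrary _
  set ε' := γ / (D + 1) with hε'
  have hε0 : 0 ≤ ε' := by positivity
  have hR := source_regSys hβ hB hS hC hCN (fun x y S h => (hCBA x y S h).1)
    (fun S => hreg S (card_le_univ S)) x₀ hε0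
  have hcd : IsDep (fun x S => (⟨C x S, hCN x S⟩ : Fin N)) := fun S x y h => Fin.ext (hC S h)
  have hv := condKer_isRelKer B hcd x₀
  have hrep : ∀ S (d : Fin N), ∃ a, (∀ x, C x S = d → A x S = a) ∧ ∃ x, a = A x S := by
    intro S d
    by_cases hd : ∃ x, C x S = d
    · obtain ⟨x, hx⟩ := hd
      exact ⟨A x S, fun y hy => (hCBA y x S (hy.trans hx.symm)).2, x, rfl⟩
    · exact ⟨A x₀ S, fun x hx => (hd ⟨x, hx⟩).elim, x₀, rfl⟩
  choose φ hφ using hrep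
  refine ⟨N, hNM, _, hcd, φ, fun x S => (hφ S _).1 x rfl, fun S d => (hφ S d).2, _, hv, ?_⟩
  refine (count_l1 (hB.pairC hcd) (hβ.kmul hv) hR).trans ?_
  have h1 : (Fintype.card (κ × Fin N) : ℝ) * ((Fintype.card (Finset ι → κ × Fin N) : ℝ) * ε')
      ≤ γ := by
    have h2 : (Fintype.card (κ × Fin N) : ℝ) ≤ Fintype.card (κ × Fin M) := by
      simp only [Fintype.card_prod, Fintype.card_fin]
      exact_mod_cast Nat.mul_le_mul_left _ hNM
    have h3 : (Fintype.card (Finset ι → κ × Fin N) : ℝ) ≤ P M := by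
      simp only [hP, Fintype.card_fun, Fintype.card_prod, Fintype.card_fin]
      exact_mod_cast Nat.pow_le_pow_left (Nat.mul_le_mul_left _ hNM) _
    rw [← mul_assoc]
    refine (mul_le_mul_of_nonneg_right (mul_le_mul h2 h3 (Nat.cast_nonneg _)
      (Nat.cast_nonneg _)) hε0).trans ?_
    rw [← hD, hε', mul_div_assoc', div_le_iff₀ (by positivity)]
    nlinarith
  have h2 : (Fintype.card (Finset ι → κ × Fin N) : ℝ) * (γ / (P N + 1)) ≤ γ := by
    rw [mul_div_assoc', div_le_iff₀ (by linarith [hP0 N])]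
    show P N * γ ≤ _
    nlinarith
  calc F * (_ + _) ≤ F * (γ + γ + γ) :=
        mul_le_mul_of_nonneg_left (by linarith) hF0.le
    _ = η := by rw [hγ']; field_simp; ring

end

end HypReg

namespace HypReg

open Finset
open scoped BigOperators

attribute [local instance 10] Classical.propDecidable

set_option linter.unusedSectionVars false

noncomputable section

section Rounding

variable {Y l : Type*} [Fintype Y] [Fintype l] [DecidableEq Y]

lemma exists_choice_le {I : Type*} [Fintype I] (p : Y → l → ℝ) (hp : ∀ y c, 0 ≤ p y c)
    (hp1 : ∀ y, ∑ c, p y c = 1) (a : I → Y → l → ℝ) (ha : ∀ i y c, |a i y c| ≤ 1)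
    (ha0 : ∀ i y, ∑ c, p y c * a i y c = 0) {ε : ℝ} (hε : 0 < ε) (hε1 : ε ≤ 1)
    (hI : (Fintype.card I : ℝ) < Real.exp (ε ^ 2 * Fintype.card Y / 4)) :
    ∃ f : Y → l, ∀ i, ∑ y, a i y (f y) ≤ ε * Fintype.card Y := by
  by_contra! hcon
  set t := ε / 2 with ht
  set D : ℝ := (Fintype.card Y : ℝ) with hD
  have h1 : ∀ f : Y → l, Real.exp (t * (ε * D)) ≤ ∑ i, ∏ y, Real.exp (t * a i y (f y)) := by
    intro f
    obtain ⟨i, hi⟩ := hcon f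
    refine le_trans ?_ (single_le_sum (f := fun i => ∏ y, Real.exp (t * a i y (f y)))
      (fun j _ => prod_nonneg fun y _ => (Real.exp_pos _).le) (mem_univ i))
    rw [← Real.exp_sum, ← mul_sum]
    exact Real.exp_le_exp.2 (mul_le_mul_of_nonneg_left hi.le (by positivity))
  have h2 : ∑ f : Y → l, ∏ y, p y (f y) = 1 := by
    rw [← Fintype.piFinset_univ, ← Finset.prod_univ_sum]
    simp [hp1]
  have h3 : Real.exp (t * (ε * D)) ≤ ∑ i, ∏ y, ∑ c, p y c * Real.exp (t * a i y c) := by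
    calc Real.exp (t * (ε * D)) = ∑ f : Y → l, (∏ y, p y (f y)) * Real.exp (t * (ε * D)) := by
          rw [← sum_mul, h2, one_mul]
      _ ≤ ∑ f : Y → l, (∏ y, p y (f y)) * ∑ i, ∏ y, Real.exp (t * a i y (f y)) :=
          sum_le_sum fun f _ => mul_le_mul_of_nonneg_left (h1 f)
            (prod_nonneg fun y _ => hp _ _)
      _ = _ := by
          simp only [mul_sum]
          rw [sum_comm]
          refine sum_congr rfl fun i _ => ?_
          rw [Finset.prod_univ_sum, Fintype.piFinset_univ]
          refine sum_congr rfl fun f _ => ?_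
          rw [prod_mul_distrib]
  have h4 : ∀ i y, ∑ c, p y c * Real.exp (t * a i y c) ≤ Real.exp (t ^ 2) := by
    intro i y
    have h5 : ∀ c, p y c * Real.exp (t * a i y c) ≤
        p y c * (1 + t ^ 2) + t * (p y c * a i y c) := by
      intro c
      have hb : |t * a i y c| ≤ t := by
        rw [abs_mul, abs_of_pos (by positivity : 0 < t)]
        exact mul_le_of_le_one_right (by positivity) (ha i y c)
      have h6 := Real.abs_exp_sub_one_sub_id_le (x := t * a i y c) (hb.trans (by linarith))
      have h7 := (abs_le.1 h6).2
      have h8 : (t * a i y c) ^ 2 ≤ t ^ 2 := sq_le_sq' (by linarith [(abs_le.1 hb).1])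
        (abs_le.1 hb).2
      have : Real.exp (t * a i y c) ≤ 1 + t ^ 2 + t * a i y c := by linarith
      calc _ ≤ p y c * (1 + t ^ 2 + t * a i y c) := mul_le_mul_of_nonneg_left this (hp _ _)
        _ = _ := by ring
    refine (sum_le_sum fun c _ => h5 c).trans ?_
    rw [sum_add_distrib, ← sum_mul, ← mul_sum, hp1, ha0]
    have := Real.add_one_le_exp (t ^ 2)
    linarith
  have h5 : Real.exp (t * (ε * D)) ≤ Fintype.card I * Real.exp (ε ^ 2 * D / 4) := by
    refine h3.trans ((sum_le_sum fun i _ => prod_le_prod (fun y _ => sum_nonneg fun c _ =>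
      mul_nonneg (hp _ _) (Real.exp_pos _).le) fun y _ => h4 i y).trans (le_of_eq ?_))
    rw [prod_const, sum_const, card_univ, card_univ, nsmul_eq_mul, ← Real.exp_nat_mul]
    congr 2
    rw [ht]; ring
  have h6 : Real.exp (t * (ε * D)) = Real.exp (ε ^ 2 * D / 4) * Real.exp (ε ^ 2 * D / 4) := by
    rw [← Real.exp_add]; congr 1; rw [ht]; ring
  rw [h6] at h5
  exact absurd (le_of_mul_le_mul_right h5 (Real.exp_pos _)) (not_le.2 hI)

/-- Rounding of probability vectors against many tests. -/
lemma exists_rounding {J : Type*} [Fintype J] (p : Y → l → ℝ) (hp : ∀ y c, 0 ≤ p y c)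
    (hp1 : ∀ y, ∑ c, p y c = 1) (w : J → Y → ℝ) (hw : ∀ j y, |w j y| ≤ 1)
    {ε : ℝ} (hε : 0 < ε) (hε1 : ε ≤ 1)
    (hJ : 2 * Fintype.card l * (Fintype.card J : ℝ) <
      Real.exp (ε ^ 2 * Fintype.card Y / 4)) :
    ∃ f : Y → l, ∀ j c, |∑ y, w j y * (ind (f y = c) - p y c)| ≤ ε * Fintype.card Y := by
  have hple : ∀ y c, p y c ≤ 1 := fun y c => by
    rw [← hp1 y]
    exact single_le_sum (f := fun c => p y c) (fun d _ => hp y d) (mem_univ c)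
  have hd : ∀ (d c : l) y, |ind (d = c) - p y c| ≤ 1 := fun d c y => by
    rw [abs_le]
    have := ind_nonneg (d = c)
    have := ind_le_one (d = c)
    constructor <;> linarith [hp y c, hple y c]
  have hm : ∀ y c, ∑ d, p y d * (ind (d = c) - p y c) = 0 := by
    intro y c
    simp only [mul_sub, sum_sub_distrib, ← sum_mul, hp1, one_mul]
    have : ∀ d, p y d * ind (d = c) = ind (c = d) * p y d := by
      intro d; rw [mul_comm]; congr 1; exact ind_congr eq_comm
    simp only [this, sum_ind_mul, sub_self]
  obtain ⟨f, hf⟩ := exists_choice_le (I := J × l × Bool) p hp hp1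
    (fun i y d => (if i.2.2 then 1 else -1) * (w i.1 y * (ind (d = i.2.1) - p y i.2.1)))
    (fun i y d => by
      have : |(if i.2.2 then 1 else -1 : ℝ)| = 1 := by split_ifs <;> simp
      rw [abs_mul, this, one_mul, abs_mul]
      exact mul_le_one₀ (hw _ _) (abs_nonneg _) (hd _ _ _))
    (fun i y => by
      have e : ∀ d, p y d * ((if i.2.2 then 1 else -1) *
          (w i.1 y * (ind (d = i.2.1) - p y i.2.1))) =
          ((if i.2.2 then 1 else -1) * w i.1 y) * (p y d * (ind (d = i.2.1) - p y i.2.1)) :=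
        fun d => by ring
      rw [sum_congr rfl fun d _ => e d, ← mul_sum, hm, mul_zero]) hε hε1
    (by
      refine lt_of_le_of_lt (le_of_eq ?_) hJ
      simp only [Fintype.card_prod, Fintype.card_bool]
      push_cast
      ring)
  refine ⟨f, fun j c => abs_le.2 ⟨?_, ?_⟩⟩
  · have := hf (j, c, false)
    simp only [Bool.false_eq_true, if_false, ← mul_sum] at this
    linarith
  · have := hf (j, c, true)
    simp only [if_true, one_mul] at this
    exact this

end Rounding

lemma exists_exp_bound (C : ℝ) {a : ℝ} (ha : 0 < a) (m : ℕ) :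
    ∃ n₀ : ℕ, ∀ N : ℕ, n₀ ≤ N → C * (2 * (N : ℝ)) ^ m < Real.exp (a * N) := by
  have h := (isLittleO_pow_exp_pos_mul_atTop m ha).comp_tendsto tendsto_natCast_atTop_atTop
  have h2 := h.def (c := 1 / (2 * (|C| * 2 ^ m + 1))) (by positivity)
  obtain ⟨n₀, hn⟩ := Filter.eventually_atTop.1 h2
  refine ⟨n₀, fun N hN => ?_⟩
  have h3 := hn N hN
  simp only [Function.comp, Real.norm_eq_abs, abs_of_pos (Real.exp_pos _)] at h3
  rw [abs_of_nonneg (by positivity)] at h3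
  have hE := Real.exp_pos (a * N)
  have h4 : (|C| * 2 ^ m) * (N : ℝ) ^ m ≤ Real.exp (a * N) / 2 := by
    have hc : 0 ≤ |C| * 2 ^ m := by positivity
    refine (mul_le_mul_of_nonneg_left h3 hc).trans ?_
    rw [← mul_assoc, mul_one_div]
    have : |C| * 2 ^ m / (2 * (|C| * 2 ^ m + 1)) ≤ 1 / 2 := by
      rw [div_le_div_iff₀ (by positivity) (by positivity)]
      linarith
    nlinarith
  have h5 : C * (2 * (N : ℝ)) ^ m ≤ (|C| * 2 ^ m) * (N : ℝ) ^ m := by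
    rw [mul_pow, ← mul_assoc]
    gcongr
    exact le_abs_self C
  linarith

section Slice

variable {ι : Type} [Fintype ι] [DecidableEq ι]

/-- Extension of a partial point on `S` by `z`. -/
def extend {X : ι → Type} (S : Finset ι) (y : ∀ i : S, X i) (z : ∀ i, X i) : ∀ i, X i :=
  fun i => if h : i ∈ S then y ⟨i, h⟩ else z i

lemma expect_restrict {X : ι → Type} [∀ i, Fintype (X i)] [∀ i, Nonempty (X i)]
    (S : Finset ι) (g : (∀ i : S, X i) → ℝ) :
    𝔼 x : ∀ i, X i, g (fun i => x i) = 𝔼 y, g y := by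
  have h := Fintype.expect_equiv (Equiv.piEquivPiSubtypeProd (fun i => i ∈ S) X)
    (fun x => g (fun i => x i)) (fun u => g u.1) (fun x => rfl)
  rw [h, ← univ_product_univ, Finset.expect_product]
  exact expect_congr rfl fun y _ => expect_const univ_nonempty (g y)

lemma extend_restrict {X : ι → Type} (S : Finset ι) (x z : ∀ i, X i) :
    extend S (fun i : S => x i) z = S.piecewise x z := by
  funext i
  unfold extend Finset.piecewise
  split_ifs <;> rfl

lemma exists_slice (l Γ : Type) [Fintype l] [Fintype Γ] {ε : ℝ} (hε : 0 < ε) (hε1 : ε ≤ 1) :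
    ∃ n₀ : ℕ, ∀ (X : ι → Type) [∀ i, Fintype (X i)] [∀ i, Nonempty (X i)],
      (∀ i, n₀ ≤ Fintype.card (X i)) →
      (∀ i j, Fintype.card (X i) ≤ 2 * Fintype.card (X j)) →
      ∀ S : Finset ι, S.Nonempty → ∀ p : (∀ i, X i) → l → ℝ, (∀ x c, 0 ≤ p x c) →
      (∀ x, ∑ c, p x c = 1) → DependsOn p (S : Set ι) → ∀ B : (∀ i, X i) → Γ,
      ∃ f : (∀ i, X i) → l, DependsOn f (S : Set ι) ∧
        ∀ b c, CutLE S (fun x => ind (B x = b) * (ind (f x = c) - p x c)) ε := by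
  obtain ⟨n₁, hn₁⟩ := exists_exp_bound (2 * Fintype.card l * Fintype.card Γ)
    (a := ε ^ 2 / 8) (by positivity) (Fintype.card ι)
  obtain ⟨n₂, hn₂⟩ := exists_nat_ge (16 * Fintype.card ι / ε ^ 2)
  refine ⟨max n₁ n₂, ?_⟩
  intro X _ _ hX hXX S hS p hp hp1 hpS B
  obtain ⟨i₀, hi₀⟩ := hS
  set N := Fintype.card (X i₀) with hN
  have hN1 : n₁ ≤ N := (le_max_left _ _).trans (hX i₀)
  have hN2 : (n₂ : ℝ) ≤ N := by exact_mod_cast (le_max_right _ _).trans (hX i₀)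
  have hN0 : (0 : ℝ) < N := by exact_mod_cast Fintype.card_pos (α := X i₀)
  set D := Fintype.card (∀ i : S, X i) with hD
  let R : S → Type := fun i => ∀ j : {j : S // j ≠ i}, X j
  have hRD : ∀ i : S, (D : ℝ) = Fintype.card (X i) * Fintype.card (R i) := by
    intro i
    rw [hD, Fintype.card_congr (Equiv.piSplitAt i fun j : S => X j), Fintype.card_prod]
    push_cast
    rfl
  have hND : (N : ℝ) ≤ D := by
    rw [hRD ⟨i₀, hi₀⟩]
    have : (1 : ℝ) ≤ Fintype.card (R ⟨i₀, hi₀⟩) := by exact_mod_cast Fintype.card_pos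
    exact le_mul_of_one_le_right hN0.le this
  have hRle : ∀ i : S, (Fintype.card (R i) : ℝ) ≤ 2 * D / N := by
    intro i
    rw [le_div_iff₀ hN0, hRD i]
    have : (N : ℝ) ≤ 2 * Fintype.card (X i) := by exact_mod_cast hXX i₀ i
    nlinarith [(Nat.cast_nonneg (Fintype.card (R i)) : (0 : ℝ) ≤ _)]
  have hcard : 2 * Fintype.card l *
      (Fintype.card ((∀ i, X i) × Γ × (∀ i : S, R i → Bool)) : ℝ) <
      Real.exp (ε ^ 2 * D / 4) := by
    have h1 : (Fintype.card (∀ i, X i) : ℝ) ≤ (2 * N) ^ Fintype.card ι := by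
      rw [Fintype.card_pi, ← card_univ (α := ι), ← prod_const]
      push_cast
      exact prod_le_prod (fun _ _ => Nat.cast_nonneg _) fun i _ => by
        exact_mod_cast hXX i i₀
    have h2 : (Fintype.card (∀ i : S, R i → Bool) : ℝ) ≤ Real.exp (ε ^ 2 * D / 8) := by
      have h3 : ∀ i : S, (Fintype.card (R i → Bool) : ℝ) ≤ Real.exp (2 * D / N) := by
        intro i
        rw [Fintype.card_fun, Fintype.card_bool]
        push_cast
        have : (2 : ℝ) ≤ Real.exp 1 := by linarith [Real.add_one_le_exp 1]
        calc (2 : ℝ) ^ Fintype.card (R i) ≤ Real.exp 1 ^ Fintype.card (R i) := by gcongr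
          _ = Real.exp (Fintype.card (R i)) := by rw [← Real.exp_nat_mul, mul_one]
          _ ≤ _ := Real.exp_le_exp.2 (hRle i)
      rw [Fintype.card_pi]
      push_cast
      refine (prod_le_prod (fun _ _ => Nat.cast_nonneg _) fun i _ => h3 i).trans ?_
      rw [prod_const, ← Real.exp_nat_mul]
      refine Real.exp_le_exp.2 ?_
      have h4 : ((univ : Finset S).card : ℝ) ≤ Fintype.card ι := by
        rw [card_univ, Fintype.card_coe]
        exact_mod_cast card_le_univ S
      have h5 : 16 * Fintype.card ι ≤ ε ^ 2 * N := by
        have := hn₂.trans hN2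
        rw [div_le_iff₀ (by positivity)] at this
        linarith
      have hD0 : (0 : ℝ) ≤ D := hN0.le.trans hND
      have h6 : ((univ : Finset S).card : ℝ) ≤ ε ^ 2 * N / 16 := by linarith
      refine (mul_le_mul_of_nonneg_right h6 (by positivity)).trans (le_of_eq ?_)
      field_simp
      ring
    simp only [Fintype.card_prod]
    push_cast
    have h3 := hn₁ N hN1
    have h4 : Real.exp (ε ^ 2 / 8 * N) ≤ Real.exp (ε ^ 2 * D / 8) :=
      Real.exp_le_exp.2 (by nlinarith [sq_nonneg ε])
    calc 2 * (Fintype.card l : ℝ) * (Fintype.card (∀ i, X i) * (Fintype.card Γ *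
          Fintype.card (∀ i : S, R i → Bool)))
        ≤ 2 * (Fintype.card l : ℝ) * ((2 * N) ^ Fintype.card ι * (Fintype.card Γ *
          Real.exp (ε ^ 2 * D / 8))) := by gcongr
      _ = (2 * Fintype.card l * Fintype.card Γ * (2 * (N : ℝ)) ^ Fintype.card ι) *
          Real.exp (ε ^ 2 * D / 8) := by ring
      _ < Real.exp (ε ^ 2 * D / 8) * Real.exp (ε ^ 2 * D / 8) :=
          mul_lt_mul_of_pos_right (h3.trans_le h4) (Real.exp_pos _)
      _ = _ := by rw [← Real.exp_add]; congr 1; ring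
  have z₀ : ∀ i, X i := fun i => Classical.arbitrary _
  obtain ⟨f, hf⟩ := exists_rounding (fun (y : ∀ i : S, X i) c => p (extend S y z₀) c)
    (fun y c => hp _ _) (fun y => hp1 _)
    (fun (j : (∀ i, X i) × Γ × (∀ i : S, R i → Bool)) y =>
      ind (B (extend S y j.1) = j.2.1) * ind (∀ i : S, j.2.2 i (fun t => y t) = true))
    (fun j y => by
      rw [abs_of_nonneg (mul_nonneg (ind_nonneg _) (ind_nonneg _))]
      exact mul_le_one₀ (ind_le_one _) (ind_nonneg _) (ind_le_one _)) hε hε1 hcard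
  refine ⟨fun x => f (fun i => x i), fun x y h => ?_, fun b c P hP => ?_⟩
  · have : (fun i : S => x i) = fun i : S => y i := funext fun i => h i i.2
    simp only [this]
  rw [← expect_piecewise S]
  refine (abs_expect_le _).trans (expect_le_of_le fun z => ?_)
  set G : (∀ i : S, X i) → ℝ := fun y => (ind (B (extend S y z) = b) *
    ind (∀ i : S, decide (∃ y' : ∀ i : S, X i, (∀ t : {j : S // j ≠ i}, y' t = y t) ∧
      P i (extend S y' z)) = true)) * (ind (f y = c) - p (extend S y z₀) c) with hG
  have key : ∀ x : ∀ i, X i, ind (B (S.piecewise x z) = b) *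
      (ind (f (fun i : S => S.piecewise x z i) = c) - p (S.piecewise x z) c) *
      ind (∀ i ∈ S, P i (S.piecewise x z)) = G (fun i => x i) := by
    intro x
    rw [hG]
    simp only [extend_restrict]
    have h1 : (fun i : S => S.piecewise x z i) = fun i : S => x i := by
      funext i
      exact piecewise_eq_of_mem _ _ _ i.2
    have h2 : p (S.piecewise x z) = p (S.piecewise x z₀) := by
      refine hpS fun i hi => ?_
      have hi' : i ∈ S := hi
      simp [hi']
    have h3 : ind (∀ i ∈ S, P i (S.piecewise x z)) =
        ind (∀ i : S, decide (∃ y' : ∀ i : S, X i, (∀ t : {j : S // j ≠ i}, y' t = x t) ∧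
          P i (extend S y' z)) = true) := by
      apply ind_congr
      simp only [decide_eq_true_eq]
      constructor
      · intro h i
        exact ⟨fun t => x t, fun t => rfl, by rw [extend_restrict]; exact h i i.2⟩
      · intro h i hi
        obtain ⟨y', hy, hP'⟩ := h ⟨i, hi⟩
        have : P i (extend S y' z) = P i (S.piecewise x z) := by
          refine hP i hi fun j hj => ?_
          have hj : j ≠ i := hj
          unfold extend
          by_cases hjS : j ∈ S
          · simp only [hjS, dif_pos, piecewise_eq_of_mem]
            exact hy ⟨⟨j, hjS⟩, fun e => hj (congrArg Subtype.val e)⟩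
          · simp [hjS]
        exact this ▸ hP'
    rw [h1, h2, h3]
    ring
  rw [expect_congr rfl fun x _ => key x, expect_restrict S G]
  have hj := hf (z, b, fun i r => decide (∃ y' : ∀ i : S, X i,
    (∀ t : {j : S // j ≠ i}, y' t = r t) ∧ P i (extend S y' z))) c
  rw [Fintype.expect_eq_sum_div_card, abs_div, Nat.abs_cast,
    div_le_iff₀ (by exact_mod_cast Fintype.card_pos)]
  exact hj

end Slice

/-- A prescribed relative kernel is realised by pseudorandom colours. -/
theorem target_colouring (ι : Type) [Fintype ι] [DecidableEq ι] (κ l : Type) [Fintype κ]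
    [Fintype l] {ε : ℝ} (hε : 0 < ε) : ∃ n₀ : ℕ,
    ∀ (X : ι → Type) [∀ i, Fintype (X i)] [∀ i, Nonempty (X i)],
      (∀ i, n₀ ≤ Fintype.card (X i)) →
      (∀ i j, Fintype.card (X i) ≤ 2 * Fintype.card (X j)) →
      ∀ B : (∀ i, X i) → Finset ι → κ, IsDep B →
      ∀ v : Finset ι → (Finset ι → κ × l) → ℝ, IsRelKer v →
      ∃ c : (∀ i, X i) → Finset ι → l, IsDep c ∧ RelPseudo B c v ε := by
  obtain ⟨n₀, hn₀⟩ := exists_slice (ι := ι) l (Finset ι → κ) (ε := min ε 1)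
    (lt_min hε one_pos) (min_le_right _ _)
  refine ⟨n₀, fun X _ _ hX hXX B hB v hv => ?_⟩
  have : Nonempty l := ⟨hv.base.choose⟩
  have main : ∀ s : ℕ, ∃ c : (∀ i, X i) → Finset ι → l, IsDep c ∧ ∀ S : Finset ι, S.card ≤ s →
      ∀ c' b, CutLE S (fun x => ind (B x = b) *
        (ind (c x S = c') - v S (Function.update (pairC B c x) S (b S, c')))) ε := by
    intro s
    induction s with
    | zero =>
      obtain ⟨c₀, hc₀⟩ := hv.base
      refine ⟨fun _ _ => c₀, fun S x y h => rfl, fun S hS c' b => ?_⟩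
      rw [Nat.le_zero, card_eq_zero] at hS
      subst hS
      refine (CutLE.zero hε.le).congr fun x => ?_
      rw [hc₀, Function.update_self, ind_congr (@eq_comm _ c₀ c'), sub_self, mul_zero]
    | succ s ih =>
      obtain ⟨c, hc, hcut⟩ := ih
      have hex : ∀ S : Finset ι, S.Nonempty → ∃ f : (∀ i, X i) → l, DependsOn f (S : Set ι) ∧
          ∀ b c', CutLE S (fun x => ind (B x = b) * (ind (f x = c') -
            v S (Function.update (pairC B c x) S (B x S, c')))) (min ε 1) := by
        intro S hS
        refine hn₀ X hX hXX S hS (fun x c' => v S (Function.update (pairC B c x) S (B x S, c')))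
          (fun x c' => hv.nonneg _ _) (fun x => hv.sum_eq _ _ _) (fun x y h => ?_) B
        funext c'
        refine hv.local' S _ _ fun T hT => ?_
        have h1 : B x S = B y S := hB S h
        rcases eq_or_ne T S with rfl | hne
        · simp [h1]
        · rw [Function.update_of_ne hne, Function.update_of_ne hne]
          have h2 : DependsOn (fun x => pairC B c x T) (T : Set ι) := hB.pairC hc T
          exact h2 fun i hi => h i (hT hi)
      choose! f hfd hf using hex
      have hpos : ∀ S : Finset ι, S.card = s + 1 → S.Nonempty := fun S hS =>
        card_pos.1 (by omega)
      refine ⟨fun x S => if S.card = s + 1 then f S x else c x S, fun S x y h => ?_,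
        fun S hS c' b => ?_⟩
      · simp only
        split_ifs with hS
        · exact hfd S (hpos S hS) h
        · exact hc S h
      · have hlow : ∀ x, ∀ T : Finset ι, T.card < s + 1 →
            (if T.card = s + 1 then f T x else c x T) = c x T := fun x T hT => if_neg hT.ne
        have hv' : ∀ x d, v S (Function.update (pairC B (fun x S =>
            if S.card = s + 1 then f S x else c x S) x) S d) =
            v S (Function.update (pairC B c x) S d) := by
          intro x d
          refine hv.local' S _ _ fun T hT => ?_
          rcases eq_or_ne T S with rfl | hne
          · simp
          · rw [Function.update_of_ne hne, Function.update_of_ne hne, pairC, pairC,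
              hlow x T ((card_lt_card (hT.ssubset_of_ne hne)).trans_le hS)]
        simp only [hv']
        rcases hS.lt_or_eq with hlt | heq
        · refine (hcut S (by omega) c' b).congr fun x => ?_
          rw [hlow x S hlt]
        · refine ((hf S (hpos S heq) b c').mono (min_le_left _ _)).congr fun x => ?_
          rw [if_pos heq]
          by_cases hb : B x = b
          · rw [hb]
          · rw [ind_false hb, zero_mul, zero_mul]
  obtain ⟨c, hc, h⟩ := main (Fintype.card ι)
  exact ⟨c, hc, fun S => h S (card_le_univ S)⟩

end

end HypReg

namespace HypReg

open Finset
open scoped BigOperators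

attribute [local instance 10] Classical.propDecidable

set_option linter.unusedSectionVars false

noncomputable section

lemma exists_pos_le (e : ℕ → ℝ) (he : ∀ n, 0 < e n) (M : ℕ) :
    ∃ ε : ℝ, 0 < ε ∧ ∀ n ≤ M, ε ≤ e n := by
  obtain ⟨n₀, -, h⟩ := exists_min_image (range (M + 1)) e ⟨0, by simp⟩
  exact ⟨e n₀, he n₀, fun n hn => h n (mem_range.2 (by omega))⟩

lemma exists_nat_bound (f : ℕ → ℕ) (M : ℕ) : ∃ n₀ : ℕ, ∀ n ≤ M, f n ≤ n₀ :=
  ⟨(range (M + 1)).sup f, fun n hn => le_sup (f := f) (mem_range.2 (by omega))⟩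

lemma expect_eq_sum_pattern {Ω τ : Type*} [Fintype Ω] [Fintype τ] (q : Ω → τ) (Φ : τ → ℝ) :
    𝔼 x, Φ (q x) = ∑ p, Φ p * 𝔼 x, ind (q x = p) := by
  simp only [Finset.mul_expect, ← Finset.expect_sum_comm]
  refine expect_congr rfl fun x _ => ?_
  rw [← sum_ind_mul (q x) Φ]
  exact sum_congr rfl fun p _ => mul_comm _ _

lemma sum_pairs {F κ l : Type*} [Fintype F] [DecidableEq F] [Fintype κ] [Fintype l]
    (g : (F → κ × l) → ℝ) : ∑ p, g p = ∑ b : F → κ, ∑ c : F → l, g (fun T => (b T, c T)) := by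
  rw [← Fintype.sum_prod_type' fun (b : F → κ) (c : F → l) => g fun T => (b T, c T)]
  exact Fintype.sum_equiv (Equiv.arrowProdEquivProdArrow F (fun _ => κ) fun _ => l) _ _
    fun p => rfl

/-- Extending a pattern distribution by pseudorandom colours. -/
lemma RelPseudo.l1 {ι : Type} [Fintype ι] [DecidableEq ι] {X : ι → Type} [∀ i, Fintype (X i)]
    [∀ i, Nonempty (X i)] {κ l : Type} [Fintype κ] [Fintype l]
    {B : (∀ i, X i) → Finset ι → κ} {c : (∀ i, X i) → Finset ι → l}
    {v : Finset ι → (Finset ι → κ × l) → ℝ} {ε η : ℝ} (h : RelPseudo B c v ε)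
    (hc : IsDep c) (hv : IsRelKer v) {β : Finset ι → (Finset ι → κ) → ℝ}
    (hβ : ∑ b : Finset ι → κ, |(𝔼 x, ind (B x = b)) - ∏ S, β S b| ≤ η) :
    ∑ p : Finset ι → κ × l, |(𝔼 x, ind (pairC B c x = p)) - ∏ S, kmul β v S p| ≤
      Fintype.card (Finset ι → κ × l) * (Fintype.card (Finset ι) * ε) + η := by
  have h1 : ∀ p : Finset ι → κ × l,
      |(𝔼 x, ind (pairC B c x = p)) - ∏ S, kmul β v S p| ≤
      Fintype.card (Finset ι) * ε + |(𝔼 x, ind (B x = fun T => (p T).1)) -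
        ∏ S, β S (fun T => (p T).1)| * ∏ S, v S p := by
    intro p
    have hnn : 0 ≤ ∏ S, v S p := prod_nonneg fun S _ => hv.nonneg S p
    have e : (𝔼 x, ind (pairC B c x = p)) - ∏ S, kmul β v S p =
        ((𝔼 x, ind (pairC B c x = p)) - (𝔼 x, ind (B x = fun T => (p T).1)) * ∏ S, v S p) +
        ((𝔼 x, ind (B x = fun T => (p T).1)) - ∏ S, β S (fun T => (p T).1)) *
          ∏ S, v S p := by
      unfold kmul
      rw [prod_mul_distrib]
      ring
    rw [e]
    refine (abs_add_le _ _).trans (add_le_add (h.count hc hv p) ?_)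
    rw [abs_mul, abs_of_nonneg hnn]
  refine (sum_le_sum fun p _ => h1 p).trans ?_
  rw [sum_add_distrib, sum_const, card_univ, nsmul_eq_mul]
  refine add_le_add le_rfl ?_
  rw [sum_pairs]
  simp only [← mul_sum, hv.sum_prod, mul_one]
  exact hβ

/-- Transfer of a system of colours between two superregular systems. -/
theorem transfer_colours (ι : Type) [Fintype ι] [DecidableEq ι] (κ α φ : Type) [Fintype κ]
    [Fintype α] [Fintype φ] {η : ℝ} (hη : 0 < η) : ∃ ε : ℝ, 0 < ε ∧ ∃ n₀ : ℕ,
    ∀ (X Y : ι → Type) [∀ i, Fintype (X i)] [∀ i, Nonempty (X i)] [∀ i, Fintype (Y i)]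
      [∀ i, Nonempty (Y i)],
      (∀ i, n₀ ≤ Fintype.card (X i)) → (∀ i, n₀ ≤ Fintype.card (Y i)) →
      (∀ i j, Fintype.card (X i) ≤ 2 * Fintype.card (X j)) →
      (∀ i j, Fintype.card (Y i) ≤ 2 * Fintype.card (Y j)) →
    ∀ (BX : (∀ i, X i) → Finset ι → κ) (BY : (∀ i, Y i) → Finset ι → κ)
      (β : Finset ι → (Finset ι → κ) → ℝ), IsDep BX → IsDep BY → IsKer β →
      SuperReg BX β ε → SuperReg BY β ε →
    ∀ OX : (∀ i, X i) → Finset ι → α, IsDep OX →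
    ∃ OY : (∀ i, Y i) → Finset ι → α, IsDep OY ∧ (∀ y S, ∃ x, OY y S = OX x S) ∧
    ∀ FY : (∀ i, Y i) → Finset ι → φ, IsDep FY →
    ∃ FX : (∀ i, X i) → Finset ι → φ, IsDep FX ∧
    ∀ Φ : (Finset ι → κ × α × φ) → ℝ, (∀ p, |Φ p| ≤ 1) →
      |(𝔼 x, Φ fun S => (BX x S, OX x S, FX x S)) -
        𝔼 y, Φ fun S => (BY y S, OY y S, FY y S)| ≤ η := by
  obtain ⟨M₁, ε₁, hε₁, hA⟩ := source_regularity ι κ α (η := η / 4) (by positivity)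
  choose M₂ ε₂ hε₂ hA₂ using fun N : ℕ =>
    source_regularity ι (κ × Fin N) φ (η := η / 4) (by positivity)
  set K : ℝ := (Fintype.card (Finset ι → κ) : ℝ) with hK
  have hK0 : 0 ≤ K := Nat.cast_nonneg _
  set P : ℕ → ℝ := fun N => (Fintype.card (Finset ι → κ × Fin N) : ℝ) with hP
  have hP0 : ∀ N, 0 ≤ P N := fun N => Nat.cast_nonneg _
  choose nB hB using fun N : ℕ => target_colouring ι κ (Fin N) (ε := ε₂ N / (2 * (K + 1)))
    (div_pos (hε₂ N) (by positivity))
  set P₂ : ℕ → ℕ → ℝ := fun N N₂ =>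
    (Fintype.card (Finset ι → (κ × Fin N) × Fin N₂) : ℝ) * Fintype.card (Finset ι) with hP₂
  have hP₂0 : ∀ N N₂, 0 ≤ P₂ N N₂ := fun N N₂ => by positivity
  choose nB₂ hB₂ using fun N N₂ : ℕ => target_colouring ι (κ × Fin N) (Fin N₂)
    (ε := (η / 4) / (P₂ N N₂ + 1)) (div_pos (by positivity) (by linarith [hP₂0 N N₂]))
  obtain ⟨ε₃, hε₃, hle₃⟩ := exists_pos_le (fun N => ε₂ N / (2 * (P N + 1)))
    (fun N => div_pos (hε₂ N) (by linarith [hP0 N])) M₁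
  choose nC hC using fun N => exists_nat_bound (nB₂ N) (M₂ N)
  obtain ⟨nD, hD⟩ := exists_nat_bound (fun N => max (nB N) (nC N)) M₁
  refine ⟨min ε₁ ε₃, lt_min hε₁ hε₃, nD, ?_⟩
  intro X Y _ _ _ _ hXn hYn hXX hYY BX BY β hBX hBY hβ hSX hSY OX hOX
  obtain ⟨N, hN, c, hc, φ₁, hφ₁, hφ₁', v, hv, hl1⟩ :=
    hA X BX β OX hBX hβ (fun S d => (hSX S d).mono (min_le_left _ _)) hOX
  have hnN := hD N hN
  obtain ⟨cY, hcY, hrY⟩ := hB N Y (fun i => ((le_max_left _ _).trans hnN).trans (hYn i)) hYY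
    BY hBY v hv
  refine ⟨fun y S => φ₁ S (cY y S), fun S x y h => ?_, fun y S => hφ₁' S _, ?_⟩
  · have := hcY S h
    simp only at this ⊢
    rw [this]
  intro FY hFY
  have hSC : SuperReg (pairC BY cY) (kmul β v) (ε₂ N) := by
    have h1 := hrY.superReg (div_pos (hε₂ N) (by positivity)).le hBY hcY hv
      (fun S d => (hSY S d).mono (min_le_right _ _))
    refine fun S d => (h1 S d).mono ?_
    have h2 : K * (ε₂ N / (2 * (K + 1))) ≤ ε₂ N / 2 := by
      rw [mul_div_assoc', div_le_div_iff₀ (by positivity) (by norm_num)]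
      nlinarith [hε₂ N]
    have h3 : P N * ε₃ ≤ ε₂ N / 2 := by
      refine (mul_le_mul_of_nonneg_left (hle₃ N hN) (hP0 N)).trans ?_
      rw [mul_div_assoc', div_le_div_iff₀ (by linarith [hP0 N]) (by norm_num)]
      nlinarith [hε₂ N, hP0 N]
    have : K * (ε₂ N / (2 * (K + 1))) + P N * ε₃ ≤ ε₂ N := by linarith
    exact this
  obtain ⟨N₂, hN₂, f, hf, φ₂, hφ₂, -, v₂, hv₂, hl2⟩ :=
    hA₂ N Y (pairC BY cY) (kmul β v) FY (hBY.pairC hcY) (hβ.kmul hv) hSC hFY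
  obtain ⟨fX, hfX, hrX⟩ := hB₂ N N₂ X (fun i =>
    (((hC N N₂ hN₂).trans (le_max_right _ _)).trans hnN).trans (hXn i)) hXX
    (pairC BX c) (hBX.pairC hc) v₂ hv₂
  have hl3 := hrX.l1 hfX hv₂ hl1
  have hsmall : (Fintype.card (Finset ι → (κ × Fin N) × Fin N₂) : ℝ) *
      (Fintype.card (Finset ι) * ((η / 4) / (P₂ N N₂ + 1))) ≤ η / 4 := by
    rw [← mul_assoc]
    change P₂ N N₂ * ((η / 4) / (P₂ N N₂ + 1)) ≤ η / 4
    rw [mul_div_assoc', div_le_iff₀ (by linarith [hP₂0 N N₂])]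
    nlinarith
  refine ⟨fun x S => φ₂ S (fX x S), fun S x y h => ?_, fun Φ hΦ => ?_⟩
  · have := hfX S h
    simp only at this ⊢
    rw [this]
  set Φ' : (Finset ι → (κ × Fin N) × Fin N₂) → ℝ :=
    fun p => Φ fun S => ((p S).1.1, φ₁ S (p S).1.2, φ₂ S (p S).2) with hΦ'
  have e1 : (𝔼 x, Φ fun S => (BX x S, OX x S, φ₂ S (fX x S))) =
      𝔼 x, Φ' (pairC (pairC BX c) fX x) := by
    refine expect_congr rfl fun x _ => ?_
    simp only [hφ₁, hΦ', pairC]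
  have e2 : (𝔼 y, Φ fun S => (BY y S, φ₁ S (cY y S), FY y S)) =
      𝔼 y, Φ' (pairC (pairC BY cY) f y) := by
    refine expect_congr rfl fun x _ => ?_
    simp only [hφ₂, hΦ', pairC]
  rw [e1, e2, expect_eq_sum_pattern, expect_eq_sum_pattern, ← sum_sub_distrib]
  refine (abs_sum_le_sum_abs _ _).trans ?_
  have hpt : ∀ p, |Φ' p * (𝔼 x, ind (pairC (pairC BX c) fX x = p)) -
      Φ' p * 𝔼 y, ind (pairC (pairC BY cY) f y = p)| ≤
      |(𝔼 x, ind (pairC (pairC BX c) fX x = p)) - ∏ S, kmul (kmul β v) v₂ S p| +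
      |(𝔼 y, ind (pairC (pairC BY cY) f y = p)) - ∏ S, kmul (kmul β v) v₂ S p| := by
    intro p
    rw [← mul_sub, abs_mul]
    refine (mul_le_of_le_one_left (abs_nonneg _) (hΦ _)).trans ?_
    refine (abs_sub_le _ (∏ S, kmul (kmul β v) v₂ S p) _).trans (add_le_add le_rfl ?_)
    rw [abs_sub_comm]
  refine (sum_le_sum fun p _ => hpt p).trans ?_
  rw [sum_add_distrib]
  linarith

end

end HypReg

namespace HypReg

open Finset
open scoped BigOperators

attribute [local instance 10] Classical.propDecidable

set_option linter.unusedSectionVars false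

noncomputable section

variable {V : Type*} [DecidableEq V]

/-- The part of `J` with indices in `M`. -/
def sub (ix : V → ℕ) (M : Finset ℕ) (J : Finset V) : Finset V := J.filter fun v => ix v ∈ M

section Sub

variable {ix : V → ℕ} {M M' : Finset ℕ} {I J T : Finset V}

lemma sub_subset : sub ix M J ⊆ J := filter_subset _ _

lemma image_sub (h : M ⊆ J.image ix) : (sub ix M J).image ix = M := by
  ext m
  simp only [sub, mem_image, mem_filter]
  constructor
  · rintro ⟨v, ⟨-, h2⟩, rfl⟩; exact h2
  · intro hm
    obtain ⟨v, hv, rfl⟩ := mem_image.1 (h hm)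
    exact ⟨v, ⟨hv, hm⟩, rfl⟩

lemma card_sub (hJ : Set.InjOn ix J) (h : M ⊆ J.image ix) : (sub ix M J).card = M.card := by
  conv_rhs => rw [← image_sub h]
  exact (card_image_of_injOn (hJ.mono (coe_subset.2 sub_subset))).symm

lemma sub_image (hJ : Set.InjOn ix J) (h : T ⊆ J) : sub ix (T.image ix) J = T := by
  ext v
  simp only [sub, mem_filter, mem_image]
  constructor
  · rintro ⟨hv, u, hu, huv⟩
    rwa [← hJ (h hu) hv huv]
  · intro hv; exact ⟨h hv, v, hv, rfl⟩

lemma sub_sub_of_subset (h : M ⊆ M') : sub ix M (sub ix M' J) = sub ix M J := by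
  ext v
  simp only [sub, mem_filter]
  constructor
  · rintro ⟨⟨h1, -⟩, h2⟩; exact ⟨h1, h2⟩
  · rintro ⟨h1, h2⟩; exact ⟨⟨h1, h h2⟩, h2⟩

lemma sub_sub_image (hTJ : T ⊆ J) (hJ : Set.InjOn ix J) (h : M ⊆ T.image ix) :
    sub ix M J = sub ix M T := by
  conv_rhs => rw [← sub_image hJ hTJ]
  exact (sub_sub_of_subset h).symm

end Sub

/-- `y` has no labels outside the sets of size between 2 and `j`. -/
def Supp (j : ℕ) (y : Addr) : Prop :=
  ∀ M, ¬(M ⊆ y.1 ∧ 2 ≤ M.card ∧ M.card ≤ j) → y.2 M = 0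

namespace LabFam

variable (F : LabFam V)

/-- Vertex indices determine vertex classes. -/
def IdxOK : Prop := ∀ u ∈ F.gnd, ∀ v ∈ F.gnd, (F.vIdx u = F.vIdx v ↔ F.vClass u = F.vClass v)

/-- The labels of `T` up to level `j` are those prescribed by `y`. -/
def EmbA (j : ℕ) (T : Finset V) (y : Addr) : Prop :=
  T.image F.vIdx ⊆ y.1 ∧ ∀ M ⊆ T.image F.vIdx, 2 ≤ M.card → M.card ≤ j →
    F.lbl M.card (sub F.vIdx M T) = y.2 M

variable {F}

lemma addrOf_fst (j : ℕ) (L : Finset V) : (F.addrOf j L).1 = L.image F.vIdx := rfl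

lemma addrOf_snd {j : ℕ} {L : Finset V} {M : Finset ℕ} (h : M ⊆ L.image F.vIdx)
    (h2 : 2 ≤ M.card) (hj : M.card ≤ j) :
    (F.addrOf j L).2 M = F.lbl M.card (sub F.vIdx M L) :=
  if_pos ⟨h, h2, hj⟩

lemma addrOf_supp (j : ℕ) (L : Finset V) : Supp j (F.addrOf j L) := fun _ h => if_neg h

lemma addrOf_eq_iff {j : ℕ} {I : Finset V} {y : Addr} (hy : Supp j y) :
    F.addrOf j I = y ↔ I.image F.vIdx = y.1 ∧ F.EmbA j I y := by
  constructor
  · rintro rfl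
    exact ⟨rfl, subset_rfl, fun M hM h2 hj => (addrOf_snd hM h2 hj).symm⟩
  · rintro ⟨h1, h2⟩
    refine Prod.ext h1 (funext fun M => ?_)
    by_cases hM : M ⊆ I.image F.vIdx ∧ 2 ≤ M.card ∧ M.card ≤ j
    · rw [addrOf_snd hM.1 hM.2.1 hM.2.2, h2.2 M hM.1 hM.2.1 hM.2.2]
    · rw [addrOf_supp j I M hM, hy M (h1 ▸ hM)]

lemma mem_cross (hF : F.IdxOK) {i : ℕ} {S : Finset V} :
    S ∈ F.toPartFam.cross i ↔ S ⊆ F.gnd ∧ S.card = i ∧ Set.InjOn F.vIdx S := by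
  rw [PartFam.cross, mem_filter, mem_powersetCard, and_assoc]
  refine and_congr_right fun hS => and_congr_right fun _ => ?_
  constructor
  · intro h u hu v hv huv
    by_contra hne
    exact h u hu v hv hne ((hF u (hS hu) v (hS hv)).1 huv)
  · intro h u hu v hv hne hc
    exact hne (h hu hv ((hF u (hS hu) v (hS hv)).2 hc))

lemma EmbA.sub {j : ℕ} {T J : Finset V} {y : Addr} (h : F.EmbA j J y) (hT : T ⊆ J)
    (hJ : Set.InjOn F.vIdx J) : F.EmbA j T y := by
  have hi : T.image F.vIdx ⊆ J.image F.vIdx := image_subset_image hT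
  refine ⟨hi.trans h.1, fun M hM h2 hj => ?_⟩
  rw [← sub_sub_image hT hJ hM]
  exact h.2 M (hM.trans hi) h2 hj

lemma EmbA.of_subsets {j : ℕ} (hj : 1 ≤ j) {I : Finset V} {y : Addr} (hI : Set.InjOn F.vIdx I)
    (hc : j ≤ I.card) (h : ∀ T ∈ I.powersetCard j, F.EmbA j T y) : F.EmbA j I y := by
  have hIc : (I.image F.vIdx).card = I.card := card_image_of_injOn hI
  have key : ∀ M ⊆ I.image F.vIdx, M.card ≤ j → ∃ T ∈ I.powersetCard j, T ⊆ I ∧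
      M ⊆ T.image F.vIdx := by
    intro M hM hMj
    obtain ⟨M', h1, h2, h3⟩ := exists_subsuperset_card_eq hM hMj (hIc ▸ hc)
    exact ⟨HypReg.sub F.vIdx M' I, mem_powersetCard.2 ⟨sub_subset, by rw [card_sub hI h2, h3]⟩,
      sub_subset, by rw [image_sub h2]; exact h1⟩
  constructor
  · intro m hm
    obtain ⟨T, hT, -, hM⟩ := key {m} (singleton_subset_iff.2 hm) (by simpa using hj)
    exact (h T hT).1 (hM (mem_singleton_self m))
  · intro M hM h2 hMj
    obtain ⟨T, hT, hTI, hMT⟩ := key M hM hMj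
    rw [sub_sub_image hTI hI hMT]
    exact (h T hT).2 M hMT h2 hMj

variable (F)

/-- Crossing `j`-sets with address `y`. -/
def ClA (j : ℕ) (y : Addr) : Finset (Finset V) :=
  (F.toPartFam.cross j).filter fun I => F.addrOf (j - 1) I = y

/-- The `j`-sets which may occur in a polyad with address `y`. -/
def PolyA (j : ℕ) (y : Addr) : Finset (Finset V) :=
  (F.toPartFam.cross j).filter fun T => F.EmbA j T y

variable {F}

lemma mem_ClA {j : ℕ} {y : Addr} {I : Finset V} :
    I ∈ F.ClA j y ↔ I ∈ F.toPartFam.cross j ∧ F.addrOf (j - 1) I = y := mem_filter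

lemma mem_PolyA {j : ℕ} {y : Addr} {I : Finset V} :
    I ∈ F.PolyA j y ↔ I ∈ F.toPartFam.cross j ∧ F.EmbA j I y := mem_filter

lemma mem_sing {U : Finset V} {S : Finset V} : S ∈ sing U ↔ ∃ v ∈ U, {v} = S := mem_image

lemma mem_KsetC (hF : F.IdxOK) {j : ℕ} (hj : 1 ≤ j) {y : Addr} (hc : y.1.card = j + 1)
    (hy : Supp j y) {G : Finset (Finset V)} (hG : G ⊆ F.PolyA j y) {I : Finset V} :
    I ∈ KsetC F.gnd (F.toPartFam.cross (j + 1)) j (j + 1) G ↔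
      I ∈ F.ClA (j + 1) y ∧ ∀ T ∈ I.powersetCard j, T ∈ G := by
  have fin : I ∈ F.toPartFam.cross (j + 1) → (∀ T ∈ I.powersetCard j, T ∈ G) →
      I ∈ F.ClA (j + 1) y := by
    intro hI hT
    obtain ⟨h1, h2, h3⟩ := (mem_cross hF).1 hI
    have hE := EmbA.of_subsets hj h3 (by omega) fun T h => (mem_PolyA.1 (hG (hT T h))).2
    refine mem_ClA.2 ⟨hI, ?_⟩
    rw [Nat.add_sub_cancel, addrOf_eq_iff hy]
    exact ⟨eq_of_subset_of_card_le hE.1 (by rw [card_image_of_injOn h3, hc, h2]), hE⟩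
  unfold KsetC
  split_ifs with h1
  · subst h1
    have e : (∀ v ∈ I, ({v} : Finset V) ∈ G) ↔ ∀ T ∈ I.powersetCard 1, T ∈ G := by
      constructor
      · intro h T hT
        obtain ⟨h1, h2⟩ := mem_powersetCard.1 hT
        obtain ⟨v, rfl⟩ := card_eq_one.1 h2
        exact h v (singleton_subset_iff.1 h1)
      · intro h v hv
        exact h _ (mem_powersetCard.2 ⟨singleton_subset_iff.2 hv, card_singleton v⟩)
    rw [mem_filter, e]
    exact ⟨fun h => ⟨fin h.1 h.2, h.2⟩, fun h => ⟨(mem_ClA.1 h.1).1, h.2⟩⟩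
  · rw [Kset, mem_filter, mem_powersetCard]
    constructor
    · rintro ⟨⟨h2, h3⟩, h4⟩
      refine ⟨fin ((mem_cross hF).2 ⟨h2, h3, ?_⟩) h4, h4⟩
      intro u hu v hv huv
      by_contra hne
      have huvI : ({u, v} : Finset V) ⊆ I := by
        intro w hw
        rcases mem_insert.1 hw with rfl | hw
        · exact hu
        · rw [mem_singleton.1 hw]; exact hv
      obtain ⟨T, hT1, hT2, hT3⟩ := exists_subsuperset_card_eq huvI
        (n := j) (by rw [card_pair hne]; omega) (by omega)
      have h5 := (mem_cross hF).1 (mem_PolyA.1 (hG (h4 T (mem_powersetCard.2 ⟨hT2, hT3⟩)))).1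
      exact hne (h5.2.2 (hT1 (by simp)) (hT1 (by simp)) huv)
    · rintro ⟨h2, h3⟩
      obtain ⟨h4, h5, h6⟩ := (mem_cross hF).1 (mem_ClA.1 h2).1
      exact ⟨⟨h4, h5⟩, h3⟩

variable (F)

/-- The classes are determined by indices and labels in the canonical way up to level `l`. -/
structure Canon (l : ℕ) : Prop where
  idx : F.IdxOK
  vcl : ∀ v ∈ F.gnd, F.vClass v = F.gnd.filter fun u => F.vIdx u = F.vIdx v
  cls : ∀ j, 2 ≤ j → j ≤ l → ∀ J ∈ F.toPartFam.cross j,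
    F.cls j J = (F.toPartFam.cross j).filter fun I => F.addrOf j I = F.addrOf j J

variable {F}

lemma addrOf_eq_sub_iff {j : ℕ} {T J : Finset V}
    (h : T.image F.vIdx ⊆ J.image F.vIdx) :
    F.addrOf j T = F.addrOf j (sub F.vIdx (T.image F.vIdx) J) ↔ F.EmbA j T (F.addrOf j J) := by
  rw [addrOf_eq_iff (addrOf_supp _ _), addrOf_fst, image_sub h]
  constructor
  · rintro ⟨-, h2⟩
    refine ⟨h, fun M hM h3 h4 => ?_⟩
    rw [h2.2 M hM h3 h4, addrOf_snd (by rw [image_sub h]; exact hM) h3 h4,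
      addrOf_snd (hM.trans h) h3 h4, sub_sub_of_subset hM]
  · intro h2
    refine ⟨rfl, by rw [addrOf_fst, image_sub h], fun M hM h3 h4 => ?_⟩
    rw [h2.2 M hM h3 h4, addrOf_snd (hM.trans h) h3 h4, addrOf_snd (L := HypReg.sub F.vIdx _ J)
      (by rw [image_sub h]; exact hM) h3 h4, sub_sub_of_subset hM]

lemma Canon.polyad {l : ℕ} (hF : F.Canon l) {j : ℕ} (hj : 1 ≤ j) (hjl : j ≤ max l 1)
    {J : Finset V} {i : ℕ} (hJ : J ∈ F.toPartFam.cross i) :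
    F.toPartFam.polyad j J = F.PolyA j (F.addrOf j J) := by
  obtain ⟨h1, h2, h3⟩ := (mem_cross hF.idx).1 hJ
  ext T
  rw [mem_PolyA]
  unfold PartFam.polyad
  split_ifs with hj1
  · subst hj1
    rw [mem_sing, mem_cross hF.idx]
    constructor
    · rintro ⟨v, hv, rfl⟩
      obtain ⟨u, hu, huv⟩ := mem_sup.1 hv
      rw [hF.vcl u (h1 hu), mem_filter] at huv
      refine ⟨⟨singleton_subset_iff.2 huv.1, card_singleton v, by simp⟩, ?_, ?_⟩
      · rw [image_singleton, singleton_subset_iff, huv.2]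
        exact mem_image_of_mem _ hu
      · intro M _ h2 h3
        omega
    · rintro ⟨⟨h4, h5, -⟩, h6, -⟩
      obtain ⟨v, rfl⟩ := card_eq_one.1 h5
      rw [image_singleton, singleton_subset_iff] at h6
      obtain ⟨u, hu, huv⟩ := mem_image.1 h6
      refine ⟨v, mem_sup.2 ⟨u, hu, ?_⟩, rfl⟩
      rw [hF.vcl u (h1 hu), mem_filter]
      exact ⟨singleton_subset_iff.1 h4, huv.symm⟩
  · have hj2 : 2 ≤ j := by omega
    have hjl' : j ≤ l := by
      rcases le_max_iff.1 hjl with h | h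
      · exact h
      · omega
    have hsub : ∀ T' ∈ J.powersetCard j, T' ∈ F.toPartFam.cross j := by
      intro T' hT'
      obtain ⟨h4, h5⟩ := mem_powersetCard.1 hT'
      exact (mem_cross hF.idx).2 ⟨h4.trans h1, h5, h3.mono (by exact_mod_cast h4)⟩
    rw [mem_sup]
    constructor
    · rintro ⟨T', hT', hT⟩
      rw [hF.cls j hj2 hjl' T' (hsub T' hT'), mem_filter] at hT
      refine ⟨hT.1, ?_⟩
      have h4 := (mem_powersetCard.1 hT').1
      have h5 : T.image F.vIdx = T'.image F.vIdx := congrArg Prod.fst hT.2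
      rw [← addrOf_eq_sub_iff (h5 ▸ image_subset_image h4), h5, sub_image h3 h4]
      exact hT.2
    · rintro ⟨hT, hE⟩
      have h4 : T.image F.vIdx ⊆ J.image F.vIdx := hE.1
      have hT' : sub F.vIdx (T.image F.vIdx) J ∈ J.powersetCard j := by
        refine mem_powersetCard.2 ⟨sub_subset, ?_⟩
        obtain ⟨-, h6, h7⟩ := (mem_cross hF.idx).1 hT
        rw [card_sub h3 h4, card_image_of_injOn h7, h6]
      refine ⟨_, hT', ?_⟩
      rw [hF.cls j hj2 hjl' _ (hsub _ hT'), mem_filter]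
      exact ⟨hT, (addrOf_eq_sub_iff h4).2 hE⟩

lemma card_addrOf (hF : F.IdxOK) {i j : ℕ} {J : Finset V} (hJ : J ∈ F.toPartFam.cross i) :
    (F.addrOf j J).1.card = i := by
  obtain ⟨-, h2, h3⟩ := (mem_cross hF).1 hJ
  rw [addrOf_fst, card_image_of_injOn h3, h2]

lemma addrOf_self_emb (j : ℕ) (J : Finset V) : F.EmbA j J (F.addrOf j J) :=
  ((addrOf_eq_iff (addrOf_supp j J)).1 rfl).2

lemma Canon.polyCliques {l : ℕ} (hF : F.Canon l) {j : ℕ} (hj : 2 ≤ j) (hjl : j - 1 ≤ max l 1)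
    {J : Finset V} (hJ : J ∈ F.toPartFam.cross j) :
    F.toPartFam.polyCliques j J = F.ClA j (F.addrOf (j - 1) J) := by
  obtain ⟨i, rfl⟩ : ∃ i, j = i + 1 := ⟨j - 1, by omega⟩
  unfold PartFam.polyCliques
  rw [Nat.add_sub_cancel] at *
  rw [hF.polyad (by omega) hjl hJ]
  ext I
  rw [mem_KsetC hF.idx (by omega) (card_addrOf hF.idx hJ) (addrOf_supp _ _) subset_rfl]
  refine and_iff_left_of_imp fun hI T hT => ?_
  obtain ⟨h1, h2⟩ := mem_ClA.1 hI
  obtain ⟨h3, h4, h5⟩ := (mem_cross hF.idx).1 h1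
  obtain ⟨h6, h7⟩ := mem_powersetCard.1 hT
  rw [Nat.add_sub_cancel] at h2
  refine mem_PolyA.2 ⟨(mem_cross hF.idx).2 ⟨h6.trans h3, h7, h5.mono (by exact_mod_cast h6)⟩, ?_⟩
  rw [← h2]
  exact (addrOf_self_emb _ I).sub h6 h5

lemma addrOf_succ_eq_iff {j : ℕ} (hj : 1 ≤ j) {I J : Finset V} (hI : Set.InjOn F.vIdx I)
    (hIc : I.card = j + 1) (hJ : Set.InjOn F.vIdx J) (hJc : J.card = j + 1) :
    F.addrOf (j + 1) I = F.addrOf (j + 1) J ↔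
      F.addrOf j I = F.addrOf j J ∧ F.lbl (j + 1) I = F.lbl (j + 1) J := by
  have key : ∀ L : Finset V, Set.InjOn F.vIdx L → L.card = j + 1 →
      F.lbl (L.image F.vIdx).card (sub F.vIdx (L.image F.vIdx) L) = F.lbl (j + 1) L := by
    intro L hL hc
    rw [sub_image hL subset_rfl, card_image_of_injOn hL, hc]
  have hcard : ∀ L : Finset V, Set.InjOn F.vIdx L → L.card = j + 1 →
      (L.image F.vIdx).card = j + 1 := fun L hL hc => by rw [card_image_of_injOn hL, hc]
  rw [addrOf_eq_iff (addrOf_supp _ _), addrOf_eq_iff (addrOf_supp _ _)]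
  simp only [addrOf_fst]
  constructor
  · rintro ⟨h1, h2⟩
    refine ⟨⟨h1, h2.1, fun M hM h3 h4 => ?_⟩, ?_⟩
    · rw [h2.2 M hM h3 (by omega), addrOf_snd (h1 ▸ hM) h3 (by omega),
        addrOf_snd (h1 ▸ hM) h3 h4]
    · have h5 := h2.2 _ subset_rfl (by rw [hcard I hI hIc]; omega) (by rw [hcard I hI hIc])
      rw [key I hI hIc, addrOf_snd h1.subset (by rw [hcard I hI hIc]; omega)
        (by rw [hcard I hI hIc]), h1, key J hJ hJc] at h5
      exact h5
  · rintro ⟨⟨h1, h2⟩, h3⟩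
    refine ⟨h1, h1.subset, fun M hM h4 h5 => ?_⟩
    rcases h5.lt_or_eq with h5 | h5
    · rw [h2.2 M hM h4 (by omega), addrOf_snd (h1 ▸ hM) h4 (by omega),
        addrOf_snd (h1 ▸ hM) h4 (by omega)]
    · have : M = I.image F.vIdx := eq_of_subset_of_card_le hM (by rw [hcard I hI hIc, h5])
      subst this
      rw [key I hI hIc, addrOf_snd h1.subset h4 (by omega), h1, key J hJ hJc, h3]

end LabFam

end

end HypReg

namespace HypReg

open Finset
open scoped BigOperators

attribute [local instance 10] Classical.propDecidable

set_option linter.unusedSectionVars false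

noncomputable section

variable {V : Type*} [DecidableEq V]

lemma card_image_eq_of_iff {α β γ : Type*} [DecidableEq β] [DecidableEq γ] (s : Finset α)
    (f : α → β) (g : α → γ) (h : ∀ u ∈ s, ∀ v ∈ s, f u = f v ↔ g u = g v) :
    (s.image f).card = (s.image g).card := by
  choose r hr using fun c (hc : c ∈ s.image f) => mem_image.1 hc
  refine card_bij (fun c hc => g (r c hc)) (fun c hc => mem_image_of_mem g (hr c hc).1) ?_ ?_
  · intro c hc c' hc' e
    have := (h _ (hr c hc).1 _ (hr c' hc').1).2 e
    rwa [(hr c hc).2, (hr c' hc').2] at this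
  · intro b hb
    obtain ⟨u, hu, rfl⟩ := mem_image.1 hb
    have hc := mem_image_of_mem f hu
    exact ⟨f u, hc, (h _ (hr _ hc).1 _ hu).1 (hr _ hc).2⟩

/-- The members of `Cl` whose `(j-1)`-subsets all lie in `G`. -/
def cliq (Cl : Finset (Finset V)) (j : ℕ) (G : Finset (Finset V)) : Finset (Finset V) :=
  Cl.filter fun I => ∀ T ∈ I.powersetCard (j - 1), T ∈ G

lemma mem_cliq {Cl G : Finset (Finset V)} {j : ℕ} {I : Finset V} :
    I ∈ cliq Cl j G ↔ I ∈ Cl ∧ ∀ T ∈ I.powersetCard (j - 1), T ∈ G := by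
  simp only [cliq, mem_filter]

/-- Regularity of `E` relative to the clique set `Cl`, tested on arbitrary `(j-1)`-graphs. -/
def RegAt (Cl E : Finset (Finset V)) (j : ℕ) (ε d : ℝ) : Prop :=
  ∀ G : Finset (Finset V), ε * (Cl.card : ℝ) ≤ ((cliq Cl j G).card : ℝ) →
    |((E ∩ cliq Cl j G).card : ℝ) - d * ((cliq Cl j G).card : ℝ)|
      ≤ ε * ((cliq Cl j G).card : ℝ)

lemma RegAt.congr {Cl E E' : Finset (Finset V)} {j : ℕ} {ε d : ℝ} (h : RegAt Cl E j ε d)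
    (hE : ∀ I ∈ Cl, I ∈ E ↔ I ∈ E') : RegAt Cl E' j ε d := by
  intro G hG
  have : E' ∩ cliq Cl j G = E ∩ cliq Cl j G := by
    ext I
    simp only [mem_inter, mem_cliq]
    constructor
    · rintro ⟨h1, h2, h3⟩; exact ⟨(hE I h2).2 h1, h2, h3⟩
    · rintro ⟨h1, h2, h3⟩; exact ⟨(hE I h2).1 h1, h2, h3⟩
  rw [this]
  exact h G hG

namespace LabFam

variable (F : LabFam V)

/-- Crossing `j`-sets with label `b`. -/
def lblSet (j b : ℕ) : Finset (Finset V) := (F.toPartFam.cross j).filter fun I => F.lbl j I = b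

/-- A labelled family of partitions, described by its labels. -/
structure LabOK (k : ℕ) (a : ℕ → ℕ) : Prop where
  canon : F.Canon (k - 1)
  le_one : k ≤ a 1
  idx_range : ∀ v ∈ F.gnd, 1 ≤ F.vIdx v ∧ F.vIdx v ≤ a 1
  idx_surj : ∀ i, 1 ≤ i → i ≤ a 1 → ∃ v ∈ F.gnd, F.vIdx v = i
  lbl_range : ∀ j, 2 ≤ j → j ≤ k - 1 → ∀ I ∈ F.toPartFam.cross j,
    1 ≤ F.lbl j I ∧ F.lbl j I ≤ a j
  lbl_surj : ∀ j, 2 ≤ j → j ≤ k - 1 → ∀ J ∈ F.toPartFam.cross j, ∀ b, 1 ≤ b → b ≤ a j →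
    ∃ I ∈ F.ClA j (F.addrOf (j - 1) J), F.lbl j I = b

/-- An equitable partition of a hypergraph, described by its labels. -/
structure Nice (k : ℕ) (a : ℕ → ℕ) (ε : ℝ) (d : Addr → ℝ) (H : Finset (Finset V)) : Prop where
  lab : F.LabOK k a
  size : ∀ v ∈ F.gnd, (F.gnd.filter fun u => F.vIdx u = F.vIdx v).card = F.gnd.card / a 1 ∨
      (F.gnd.filter fun u => F.vIdx u = F.vIdx v).card = F.gnd.card / a 1 + 1
  low : ∀ j, 2 ≤ j → j ≤ k - 1 → ∀ J ∈ F.toPartFam.cross j, ∀ b, 1 ≤ b → b ≤ a j →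
    RegAt (F.ClA j (F.addrOf (j - 1) J)) (F.lblSet j b) j ε (1 / (a j : ℝ))
  top : ∀ x, IsAddress k (k - 1) a x → RegAt (F.ClA k x) H k ε (d x)

variable {F}

lemma cross_subset (hF : F.IdxOK) {i : ℕ} {S T : Finset V}
    (hS : S ∈ F.toPartFam.cross i) (hT : T ⊆ S) : T ∈ F.toPartFam.cross T.card := by
  obtain ⟨h1, -, h3⟩ := (mem_cross hF).1 hS
  exact (mem_cross hF).2 ⟨hT.trans h1, rfl, h3.mono (coe_subset.2 hT)⟩

lemma addrOf_mono {j i : ℕ} (hij : i ≤ j) {I J : Finset V}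
    (h : F.addrOf j I = F.addrOf j J) : F.addrOf i I = F.addrOf i J := by
  rw [addrOf_eq_iff (addrOf_supp _ _)] at h ⊢
  refine ⟨h.1, h.2.1, fun M hM h2 h3 => ?_⟩
  have h1 : I.image F.vIdx = J.image F.vIdx := h.1
  rw [h.2.2 M hM h2 (by omega), addrOf_snd (h1 ▸ hM) h2 (by omega), addrOf_snd (h1 ▸ hM) h2 h3]

lemma IsLabeled.canon {k : ℕ} {a : ℕ → ℕ} (h : F.IsLabeled k a) :
    F.Canon (k - 1) := by
  obtain ⟨⟨h1, h2, h3, -, -, h6⟩, -, h8, h9⟩ := h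
  have hv : ∀ v ∈ F.gnd, F.vClass v = F.gnd.filter fun u => F.vIdx u = F.vIdx v := by
    intro v hv
    ext u
    rw [mem_filter]
    constructor
    · intro hu
      have hug := h2 v hv hu
      exact ⟨hug, (h8 u hug v hv).2 (h3 u hug v hv hu)⟩
    · rintro ⟨hug, he⟩
      rw [← (h8 u hug v hv).1 he]
      exact h1 u hug
  have main : ∀ l, l ≤ k - 1 → F.Canon l := by
    intro l
    induction l with
    | zero => intro _; exact ⟨h8, hv, fun j h1 h2 => by omega⟩
    | succ l ih =>
      intro hl
      have hC := ih (by omega)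
      refine ⟨h8, hv, fun j hj hjl J hJ => ?_⟩
      rcases hjl.lt_or_eq with hlt | rfl
      · exact hC.cls j hj (by omega) J hJ
      obtain ⟨g1, -, g3, -, -⟩ := h6 (l + 1) hj hl
      obtain ⟨f1, f2, f3⟩ := h9 (l + 1) hj hl
      obtain ⟨-, c2, c3⟩ := (mem_cross h8).1 hJ
      ext I
      rw [mem_filter]
      constructor
      · intro hI
        have h4 := g3 J hJ hI
        rw [hC.polyCliques hj (by simp) hJ, mem_ClA] at h4
        obtain ⟨-, d2, d3⟩ := (mem_cross h8).1 h4.1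
        exact ⟨h4.1, (addrOf_succ_eq_iff (by omega) d3 d2 c3 c2).2 ⟨h4.2, f2 J hJ I hI⟩⟩
      · rintro ⟨hI, he⟩
        obtain ⟨-, d2, d3⟩ := (mem_cross h8).1 hI
        obtain ⟨e1, e2⟩ := (addrOf_succ_eq_iff (by omega) d3 d2 c3 c2).1 he
        rw [← f3 I hI J hJ (by
          rw [Nat.add_sub_cancel, hC.polyad (by omega) (by simp) hI,
            hC.polyad (by omega) (by simp) hJ, e1]) e2]
        exact g1 I hI
  exact main _ le_rfl

lemma Canon.cls_eq_iff {l : ℕ} (hF : F.Canon l) {j : ℕ} (hj : 2 ≤ j) (hjl : j ≤ l)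
    {I J : Finset V} (hI : I ∈ F.toPartFam.cross j) (hJ : J ∈ F.toPartFam.cross j) :
    F.cls j I = F.cls j J ↔ F.addrOf j I = F.addrOf j J := by
  rw [hF.cls j hj hjl I hI, hF.cls j hj hjl J hJ]
  constructor
  · intro h
    have : I ∈ (F.toPartFam.cross j).filter fun I => F.addrOf j I = F.addrOf j J := by
      rw [← h]; exact mem_filter.2 ⟨hI, rfl⟩
    exact (mem_filter.1 this).2
  · intro h; rw [h]

lemma Canon.lbl_iff_cls {l : ℕ} (hF : F.Canon l) {j : ℕ} (hj : 2 ≤ j) (hjl : j ≤ l)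
    {y : Addr} {I J : Finset V} (hI : I ∈ F.ClA j y) (hJ : J ∈ F.ClA j y) :
    F.lbl j I = F.lbl j J ↔ F.cls j I = F.cls j J := by
  obtain ⟨i, rfl⟩ : ∃ i, j = i + 1 := ⟨j - 1, by omega⟩
  rw [mem_ClA, Nat.add_sub_cancel] at hI hJ
  rw [hF.cls_eq_iff hj hjl hI.1 hJ.1]
  obtain ⟨-, d2, d3⟩ := (mem_cross hF.idx).1 hI.1
  obtain ⟨-, c2, c3⟩ := (mem_cross hF.idx).1 hJ.1
  rw [addrOf_succ_eq_iff (by omega) d3 d2 c3 c2]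
  exact ⟨fun h => ⟨hI.2.trans hJ.2.symm, h⟩, fun h => h.2⟩

lemma Canon.idx_iff_vClass {l : ℕ} (hF : F.Canon l) :
    (F.gnd.image F.vIdx).card = (F.gnd.image F.vClass).card :=
  card_image_eq_of_iff _ _ _ hF.idx

lemma isLabeled_iff {k : ℕ} {a : ℕ → ℕ} : F.IsLabeled k a ↔ F.LabOK k a := by
  constructor
  · intro h
    have hC := IsLabeled.canon h
    obtain ⟨⟨h1, h2, h3, h4, h5, h6⟩, h7, h8, h9⟩ := h
    refine ⟨hC, h5, h7, ?_, fun j h1 h2 => (h9 j h1 h2).1, ?_⟩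
    · have e : F.gnd.image F.vIdx = Icc 1 (a 1) := by
        refine eq_of_subset_of_card_le ?_ ?_
        · intro i hi
          obtain ⟨v, hv, rfl⟩ := mem_image.1 hi
          exact mem_Icc.2 (h7 v hv)
        · rw [hC.idx_iff_vClass, h4]; simp
      intro i hi hi'
      have : i ∈ F.gnd.image F.vIdx := by rw [e]; exact mem_Icc.2 ⟨hi, hi'⟩
      exact mem_image.1 this
    · intro j hj hjk J hJ b hb hb'
      have hcard := (h6 j hj hjk).2.2.2.2 J hJ
      rw [hC.polyCliques hj (le_max_of_le_left (by omega)) hJ] at hcard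
      rw [← card_image_eq_of_iff _ (F.lbl j) (F.cls j)
        fun u hu v hv => hC.lbl_iff_cls hj hjk hu hv] at hcard
      have e : (F.ClA j (F.addrOf (j - 1) J)).image (F.lbl j) = Icc 1 (a j) := by
        refine eq_of_subset_of_card_le ?_ ?_
        · intro i hi
          obtain ⟨v, hv, rfl⟩ := mem_image.1 hi
          exact mem_Icc.2 ((h9 j hj hjk).1 v (mem_ClA.1 hv).1)
        · rw [hcard]; simp
      have : b ∈ (F.ClA j (F.addrOf (j - 1) J)).image (F.lbl j) := by
        rw [e]; exact mem_Icc.2 ⟨hb, hb'⟩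
      exact mem_image.1 this
  · intro h
    have hC := h.canon
    have hv : ∀ v ∈ F.gnd, v ∈ F.vClass v := by
      intro v hv
      rw [hC.vcl v hv]; exact mem_filter.2 ⟨hv, rfl⟩
    refine ⟨⟨hv, ?_, ?_, ?_, h.le_one, ?_⟩, h.idx_range, hC.idx, ?_⟩
    · intro v hv
      rw [hC.vcl v hv]; exact filter_subset _ _
    · intro u hu v hv huv
      rw [hC.vcl v hv, mem_filter] at huv
      exact (hC.idx u hu v hv).1 huv.2
    · rw [← hC.idx_iff_vClass]
      have e : F.gnd.image F.vIdx = Icc 1 (a 1) := by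
        ext i
        rw [mem_image, mem_Icc]
        constructor
        · rintro ⟨v, hv, rfl⟩; exact h.idx_range v hv
        · rintro ⟨h1, h2⟩; exact h.idx_surj i h1 h2
      rw [e]; simp
    · intro j hj hjk
      refine ⟨?_, ?_, ?_, ?_, ?_⟩
      · intro J hJ
        rw [hC.cls j hj hjk J hJ]; exact mem_filter.2 ⟨hJ, rfl⟩
      · intro J hJ I hI
        rw [hC.cls j hj hjk J hJ, mem_filter] at hI
        exact (hC.cls_eq_iff hj hjk hI.1 hJ).2 hI.2
      · intro J hJ I hI
        rw [hC.cls j hj hjk J hJ, mem_filter] at hI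
        rw [hC.polyCliques hj (le_max_of_le_left (by omega)) hJ, mem_ClA]
        exact ⟨hI.1, addrOf_mono (by omega) hI.2⟩
      · intro J hJ
        rw [hC.polyCliques hj (le_max_of_le_left (by omega)) hJ]
        exact filter_subset _ _
      · intro J hJ
        rw [hC.polyCliques hj (le_max_of_le_left (by omega)) hJ,
          ← card_image_eq_of_iff _ (F.lbl j) (F.cls j)
            fun u hu v hv => hC.lbl_iff_cls hj hjk hu hv]
        have e : (F.ClA j (F.addrOf (j - 1) J)).image (F.lbl j) = Icc 1 (a j) := by
          ext i
          rw [mem_image, mem_Icc]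
          constructor
          · rintro ⟨v, hv, rfl⟩; exact h.lbl_range j hj hjk v (mem_ClA.1 hv).1
          · rintro ⟨h1, h2⟩; exact h.lbl_surj j hj hjk J hJ i h1 h2
        rw [e]; simp
    · intro j hj hjk
      refine ⟨h.lbl_range j hj hjk, ?_, ?_⟩
      · intro I hI I' hI'
        rw [hC.cls j hj hjk I hI, mem_filter] at hI'
        obtain ⟨i, rfl⟩ : ∃ i, j = i + 1 := ⟨j - 1, by omega⟩
        obtain ⟨-, d2, d3⟩ := (mem_cross hC.idx).1 hI'.1
        obtain ⟨-, c2, c3⟩ := (mem_cross hC.idx).1 hI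
        exact ((addrOf_succ_eq_iff (by omega) d3 d2 c3 c2).1 hI'.2).2
      · intro I hI I' hI' hp hl
        have hjm : j - 1 ≤ max (k - 1) 1 := le_max_of_le_left (by omega)
        have h1 := hC.polyCliques hj hjm hI
        have h2 := hC.polyCliques hj hjm hI'
        have h3 : F.ClA j (F.addrOf (j - 1) I) = F.ClA j (F.addrOf (j - 1) I') := by
          rw [← h1, ← h2]
          unfold PartFam.polyCliques
          rw [hp]
        have h4 : I ∈ F.ClA j (F.addrOf (j - 1) I) := mem_ClA.2 ⟨hI, rfl⟩
        rw [h3] at h4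
        exact (hC.lbl_iff_cls hj hjk h4 (mem_ClA.2 ⟨hI', rfl⟩)).1 hl

lemma polyAt_eq (hF : F.IdxOK) {j : ℕ} (hj : 1 ≤ j) (x : Addr) :
    F.polyAt j x = F.PolyA j x := by
  ext T
  rw [mem_PolyA]
  unfold polyAt
  split_ifs with hj1
  · subst hj1
    rw [mem_sing, mem_cross hF]
    constructor
    · rintro ⟨v, hv, rfl⟩
      obtain ⟨h1, h2⟩ := mem_filter.1 hv
      refine ⟨⟨singleton_subset_iff.2 h1, card_singleton v, by simp⟩, ?_, ?_⟩
      · rwa [image_singleton, singleton_subset_iff]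
      · intro M _ h2 h3
        omega
    · rintro ⟨⟨h4, h5, -⟩, h6, -⟩
      obtain ⟨v, rfl⟩ := card_eq_one.1 h5
      rw [image_singleton, singleton_subset_iff] at h6
      exact ⟨v, mem_filter.2 ⟨singleton_subset_iff.1 h4, h6⟩, rfl⟩
  · rw [mem_sup]
    have hj2 : ¬ j ≤ 1 := by omega
    simp only [partAt, if_neg hj2, mem_filter]
    constructor
    · rintro ⟨B, hB, hT, hA, hl⟩
      obtain ⟨hB1, hB2⟩ := mem_powersetCard.1 hB
      obtain ⟨-, h6, h7⟩ := (mem_cross hF).1 hT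
      have e : T.image F.vIdx = B := congrArg Prod.fst hA
      refine ⟨hT, e ▸ hB1, fun M hM h2 h3 => ?_⟩
      rcases h3.lt_or_eq with h3 | h3
      · have := congrFun (congrArg Prod.snd hA) M
        rw [addrOf_snd hM h2 (by omega)] at this
        rw [this]
        exact if_pos ⟨e ▸ hM, h2, by omega⟩
      · have : M = T.image F.vIdx := by
          refine eq_of_subset_of_card_le hM ?_
          rw [card_image_of_injOn h7, h6, h3]
        rw [this, e, hB2, ← hl, ← e, sub_image h7 subset_rfl]
    · rintro ⟨hT, h1, h2⟩
      obtain ⟨-, h6, h7⟩ := (mem_cross hF).1 hT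
      have hc : (T.image F.vIdx).card = j := by rw [card_image_of_injOn h7, h6]
      refine ⟨T.image F.vIdx, mem_powersetCard.2 ⟨h1, hc⟩, hT, ?_, ?_⟩
      · refine Prod.ext rfl (funext fun M => ?_)
        simp only [addrOf, restrictA]
        split_ifs with h3
        · exact h2 M h3.1 h3.2.1 (by omega)
        · rfl
      · have := h2 _ subset_rfl (by omega) hc.le
        rwa [hc, sub_image h7 subset_rfl] at this

lemma mem_polyA_of_clA (hF : F.IdxOK) {j : ℕ} {y : Addr} {I T : Finset V}
    (hI : I ∈ F.ClA (j + 1) y) (hT : T ∈ I.powersetCard j) : T ∈ F.PolyA j y := by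
  obtain ⟨h1, h2⟩ := mem_ClA.1 hI
  obtain ⟨h3, h4, h5⟩ := (mem_cross hF).1 h1
  obtain ⟨h6, h7⟩ := mem_powersetCard.1 hT
  rw [Nat.add_sub_cancel] at h2
  refine mem_PolyA.2 ⟨(mem_cross hF).2 ⟨h6.trans h3, h7, h5.mono (coe_subset.2 h6)⟩, ?_⟩
  rw [← h2]
  exact (addrOf_self_emb _ I).sub h6 h5

lemma regPairC_iff (hF : F.IdxOK) {j : ℕ} (hj : 1 ≤ j) {y : Addr} (hc : y.1.card = j + 1)
    (hy : Supp j y) {A : Finset (Finset V)} {ε d : ℝ} :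
    RegPairC F.gnd (F.toPartFam.cross (j + 1)) j ε d A (F.PolyA j y) ↔
      RegAt (F.ClA (j + 1) y) A (j + 1) ε d := by
  have hB : KsetC F.gnd (F.toPartFam.cross (j + 1)) j (j + 1) (F.PolyA j y) = F.ClA (j + 1) y := by
    ext I
    rw [mem_KsetC hF hj hc hy subset_rfl]
    exact and_iff_left_of_imp fun hI T hT => mem_polyA_of_clA hF hI hT
  have hQ : ∀ Q ⊆ F.PolyA j y, KsetC F.gnd (F.toPartFam.cross (j + 1)) j (j + 1) Q =
      cliq (F.ClA (j + 1) y) (j + 1) Q := by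
    intro Q hQ
    ext I
    rw [mem_KsetC hF hj hc hy hQ, mem_cliq]
    rfl
  constructor
  · intro h G hG
    have e : cliq (F.ClA (j + 1) y) (j + 1) (G ∩ F.PolyA j y) =
        cliq (F.ClA (j + 1) y) (j + 1) G := by
      ext I
      rw [mem_cliq, mem_cliq]
      refine and_congr_right fun hI => forall₂_congr fun T hT => ?_
      rw [mem_inter]
      exact and_iff_left (mem_polyA_of_clA hF hI hT)
    have h1 := h _ (inter_subset_right (s₁ := G) (s₂ := F.PolyA j y))
    rw [hB, hQ _ inter_subset_right, e] at h1
    exact h1 hG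
  · intro h Q hQ' hle
    rw [hQ Q hQ'] at hle ⊢
    rw [hB] at hle
    exact h Q hle

lemma LabOK.exists_superset {k : ℕ} {a : ℕ → ℕ} (h : F.LabOK k a) {j : ℕ} (hj : j ≤ k)
    {J : Finset V} (hJ : J ∈ F.toPartFam.cross j) :
    ∃ K ∈ F.toPartFam.cross k, J ⊆ K := by
  have main : ∀ l, j + l ≤ k → ∃ K ∈ F.toPartFam.cross (j + l), J ⊆ K := by
    intro l
    induction l with
    | zero => intro _; exact ⟨J, hJ, subset_rfl⟩
    | succ l ih =>
      intro hl
      obtain ⟨K, hK, hJK⟩ := ih (by omega)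
      obtain ⟨h1, h2, h3⟩ := (mem_cross h.canon.idx).1 hK
      have hlt : (K.image F.vIdx).card < (Icc 1 (a 1)).card := by
        rw [card_image_of_injOn h3, h2]
        have := h.le_one
        simp
        omega
      obtain ⟨i, hi, hiK⟩ := exists_mem_notMem_of_card_lt_card hlt
      obtain ⟨v, hv, rfl⟩ := h.idx_surj i (mem_Icc.1 hi).1 (mem_Icc.1 hi).2
      have hvK : v ∉ K := fun hc => hiK (mem_image_of_mem _ hc)
      refine ⟨insert v K, (mem_cross h.canon.idx).2 ⟨insert_subset hv h1, ?_, ?_⟩,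
        hJK.trans (subset_insert _ _)⟩
      · rw [card_insert_of_notMem hvK, h2]; omega
      · rw [coe_insert, Set.injOn_insert (by exact_mod_cast hvK)]
        refine ⟨h3, ?_⟩
        rintro ⟨u, hu, huv⟩
        exact hiK (mem_image.2 ⟨u, hu, huv⟩)
  obtain ⟨l, rfl⟩ := Nat.exists_eq_add_of_le hj
  exact main l le_rfl

lemma Canon.regPairC_polyad_iff {l : ℕ} (hF : F.Canon l) {j : ℕ} (hj : 2 ≤ j) (hjl : j ≤ l)
    {k : ℕ} {K J : Finset V} (hK : K ∈ F.toPartFam.cross k) (hJ : J ∈ K.powersetCard j)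
    {ε d : ℝ} :
    RegPairC F.gnd (F.toPartFam.cross j) (j - 1) ε d (F.toPartFam.polyad j K)
        (F.toPartFam.polyad (j - 1) J) ↔
      RegAt (F.ClA j (F.addrOf (j - 1) J)) (F.lblSet j (F.lbl j J)) j ε d := by
  obtain ⟨hJK, hJc⟩ := mem_powersetCard.1 hJ
  have hJx : J ∈ F.toPartFam.cross j := hJc ▸ cross_subset hF.idx hK hJK
  obtain ⟨i, rfl⟩ : ∃ i, j = i + 1 := ⟨j - 1, by omega⟩
  rw [Nat.add_sub_cancel, hF.polyad (by omega) (le_max_of_le_left (by omega)) hJx,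
    hF.polyad (by omega) (le_max_of_le_left (by omega)) hK]
  rw [regPairC_iff hF.idx (by omega) (card_addrOf hF.idx hJx) (addrOf_supp _ _)]
  obtain ⟨-, -, hKi⟩ := (mem_cross hF.idx).1 hK
  obtain ⟨-, c2, c3⟩ := (mem_cross hF.idx).1 hJx
  have key : ∀ I ∈ F.ClA (i + 1) (F.addrOf i J), I ∈ F.PolyA (i + 1) (F.addrOf (i + 1) K) ↔
      I ∈ F.lblSet (i + 1) (F.lbl (i + 1) J) := by
    intro I hI
    rw [mem_ClA, Nat.add_sub_cancel] at hI
    obtain ⟨-, d2, d3⟩ := (mem_cross hF.idx).1 hI.1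
    have e : I.image F.vIdx = J.image F.vIdx := congrArg Prod.fst hI.2
    have hs : I.image F.vIdx ⊆ K.image F.vIdx := e ▸ image_subset_image hJK
    rw [mem_PolyA, lblSet, mem_filter, ← addrOf_eq_sub_iff hs, e, sub_image hKi hJK,
      addrOf_succ_eq_iff (by omega) d3 d2 c3 c2]
    exact ⟨fun h => ⟨h.1, h.2.2⟩, fun h => ⟨h.1, hI.2, h.2⟩⟩
  exact ⟨fun h => h.congr key, fun h => h.congr fun I hI => (key I hI).symm⟩

lemma isEquitPartition_iff {k : ℕ} (hk : 2 ≤ k) {a : ℕ → ℕ} {ε : ℝ} {d : Addr → ℝ}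
    {H : Finset (Finset V)} : F.IsEquitPartition k a ε d H ↔ F.Nice k a ε d H := by
  have hsz : ∀ (_ : F.LabOK k a), (∀ v ∈ F.gnd, (F.vClass v).card = F.gnd.card / a 1 ∨
      (F.vClass v).card = F.gnd.card / a 1 + 1) ↔
      ∀ v ∈ F.gnd, (F.gnd.filter fun u => F.vIdx u = F.vIdx v).card = F.gnd.card / a 1 ∨
      (F.gnd.filter fun u => F.vIdx u = F.vIdx v).card = F.gnd.card / a 1 + 1 := by
    intro hL
    refine forall₂_congr fun v hv => ?_
    rw [hL.canon.vcl v hv]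
  have htop : ∀ (_ : F.LabOK k a), F.IsDensPartition k a ε d H ↔
      ∀ x, IsAddress k (k - 1) a x → RegAt (F.ClA k x) H k ε (d x) := by
    intro hL
    obtain ⟨i, rfl⟩ : ∃ i, k = i + 1 := ⟨k - 1, by omega⟩
    refine forall₂_congr fun x hx => ?_
    rw [Nat.add_sub_cancel] at *
    rw [polyAt_eq hL.canon.idx (by omega), regPairC_iff hL.canon.idx (by omega) hx.1 hx.2.2.2]
  constructor
  · rintro ⟨h1, ⟨-, h2, h3⟩, h4⟩
    have hL := isLabeled_iff.1 h1
    refine ⟨hL, (hsz hL).1 h2, ?_, (htop hL).1 h4⟩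
    intro j hj hjk J hJ b hb hb'
    obtain ⟨I, hI, rfl⟩ := hL.lbl_surj j hj hjk J hJ b hb hb'
    obtain ⟨hIx, hIa⟩ := mem_ClA.1 hI
    obtain ⟨K, hK, hIK⟩ := hL.exists_superset (by omega) hIx
    have hIK' : I ∈ K.powersetCard j :=
      mem_powersetCard.2 ⟨hIK, ((mem_cross hL.canon.idx).1 hIx).2.1⟩
    rw [← hIa]
    exact (hL.canon.regPairC_polyad_iff hj hjk hK hIK').1 (h3 K hK j hj hjk I hIK')
  · rintro ⟨hL, h2, h3, h4⟩
    refine ⟨isLabeled_iff.2 hL, ⟨?_, (hsz hL).2 h2, ?_⟩, (htop hL).2 h4⟩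
    · have := hL.le_one
      have : (a 1 : ℝ) ≠ 0 := by
        have : a 1 ≠ 0 := by omega
        exact_mod_cast this
      rw [one_div, inv_mul_cancel₀ this]
    · intro K hK j hj hjk J hJ
      obtain ⟨hJK, hJc⟩ := mem_powersetCard.1 hJ
      have hJx : J ∈ F.toPartFam.cross j := hJc ▸ cross_subset hL.canon.idx hK hJK
      obtain ⟨r1, r2⟩ := hL.lbl_range j hj hjk J hJx
      exact (hL.canon.regPairC_polyad_iff hj hjk hK hJ).2 (h3 j hj hjk J hJx _ r1 r2)

end LabFam

end

end HypReg

namespace HypReg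

open Finset
open scoped BigOperators

attribute [local instance 10] Classical.propDecidable

set_option linter.unusedSectionVars false

noncomputable section

/-- The `i`-th vertex class. -/
abbrev VX {V : Type} [DecidableEq V] (W : Finset V) (ix : V → ℕ) {r : ℕ} (i : Fin r) : Type :=
  ↥(W.filter fun v => ix v = (i : ℕ) + 1)

/-- Translation of index sets. -/
def up {r : ℕ} (S : Finset (Fin r)) : Finset ℕ := S.image fun i : Fin r => (i : ℕ) + 1

section Up

variable {r : ℕ} {S T : Finset (Fin r)}

lemma up_inj_fun : Function.Injective fun i : Fin r => (i : ℕ) + 1 := fun i j h => by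
  ext; simpa using h

lemma card_up : (up S).card = S.card := card_image_of_injective _ up_inj_fun

lemma mem_up {i : Fin r} : (i : ℕ) + 1 ∈ up S ↔ i ∈ S := by
  rw [up, mem_image]
  constructor
  · rintro ⟨j, hj, e⟩
    have := up_inj_fun e
    rwa [← this]
  · intro h; exact ⟨i, h, rfl⟩

lemma up_subset : up T ⊆ up S ↔ T ⊆ S :=
  ⟨fun h _ hi => mem_up.1 (h (mem_up.2 hi)), fun h => image_subset_image h⟩

lemma up_injective : Function.Injective (up (r := r)) := fun _ _ h =>
  Finset.Subset.antisymm (up_subset.1 h.subset) (up_subset.1 h.symm.subset)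

lemma exists_up {M : Finset ℕ} (h : ∀ i ∈ M, 1 ≤ i ∧ i ≤ r) : ∃ S : Finset (Fin r), up S = M := by
  refine ⟨univ.filter fun i => (i : ℕ) + 1 ∈ M, ?_⟩
  ext m
  rw [up, mem_image]
  constructor
  · rintro ⟨i, hi, rfl⟩; exact (mem_filter.1 hi).2
  · intro hm
    obtain ⟨h1, h2⟩ := h m hm
    refine ⟨⟨m - 1, by omega⟩, mem_filter.2 ⟨mem_univ _, ?_⟩, ?_⟩
    · simpa [Nat.sub_add_cancel h1] using hm
    · simp [Nat.sub_add_cancel h1]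

lemma subset_up_iff {M : Finset ℕ} : M ⊆ up S ↔ ∃ T ⊆ S, up T = M := by
  constructor
  · intro h
    obtain ⟨T, rfl⟩ := exists_up (r := r) (M := M) fun i hi => by
      obtain ⟨j, -, rfl⟩ := mem_image.1 (h hi)
      omega
    exact ⟨T, up_subset.1 h, rfl⟩
  · rintro ⟨T, hT, rfl⟩; exact up_subset.2 hT

end Up

section Pt

variable {V : Type} [DecidableEq V] {W : Finset V} {ix : V → ℕ} {r : ℕ}
  {S T : Finset (Fin r)} {x x' : ∀ i : Fin r, VX W ix i}

/-- The vertex set of the restriction of `x` to `S`. -/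
def pt (S : Finset (Fin r)) (x : ∀ i : Fin r, VX W ix i) : Finset V :=
  S.image fun i => (x i : V)

lemma ix_val (x : ∀ i : Fin r, VX W ix i) (i : Fin r) : ix (x i) = (i : ℕ) + 1 :=
  (mem_filter.1 (x i).2).2

lemma pt_subset : pt S x ⊆ W := by
  intro v hv
  obtain ⟨i, -, rfl⟩ := mem_image.1 hv
  exact (mem_filter.1 (x i).2).1

lemma image_pt : (pt S x).image ix = up S := by
  rw [pt, image_image, up]
  exact image_congr fun i _ => ix_val x i

lemma injOn_pt : Set.InjOn ix (pt S x) := by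
  intro u hu v hv huv
  obtain ⟨i, -, rfl⟩ := mem_image.1 (mem_coe.1 hu)
  obtain ⟨j, -, rfl⟩ := mem_image.1 (mem_coe.1 hv)
  rw [ix_val x, ix_val x] at huv
  rw [up_inj_fun huv]

lemma card_pt : (pt S x).card = S.card := by
  rw [← card_image_of_injOn injOn_pt, image_pt, card_up]

lemma pt_mono (h : T ⊆ S) : pt T x ⊆ pt S x := image_subset_image h

lemma sub_pt (h : T ⊆ S) : sub ix (up T) (pt S x) = pt T x := by
  rw [← image_pt (x := x), sub_image injOn_pt (pt_mono h)]

lemma pt_congr (h : ∀ i ∈ S, x i = x' i) : pt S x = pt S x' :=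
  image_congr fun i hi => by rw [h i hi]

lemma pt_eq_iff : pt S x = pt S x' ↔ ∀ i ∈ S, x i = x' i := by
  refine ⟨fun h i hi => ?_, pt_congr⟩
  have h1 : (x i : V) ∈ pt S x' := h ▸ mem_image_of_mem _ hi
  obtain ⟨j, -, hj⟩ := mem_image.1 h1
  have h2 := congrArg ix hj
  rw [ix_val x', ix_val x] at h2
  have := up_inj_fun h2
  subst this
  exact Subtype.ext hj.symm

lemma subset_pt {J : Finset V} (h : J ⊆ pt S x) : ∃ T ⊆ S, J = pt T x := by
  have : J.image ix ⊆ up S := by rw [← image_pt (x := x)]; exact image_subset_image h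
  obtain ⟨T, hT, hTJ⟩ := subset_up_iff.1 this
  refine ⟨T, hT, ?_⟩
  rw [← sub_pt hT, hTJ, sub_image injOn_pt h]

lemma mem_powersetCard_pt {J : Finset V} {c : ℕ} :
    J ∈ (pt S x).powersetCard c ↔ ∃ T ∈ S.powersetCard c, J = pt T x := by
  rw [mem_powersetCard]
  constructor
  · rintro ⟨h1, h2⟩
    obtain ⟨T, hT, rfl⟩ := subset_pt h1
    exact ⟨T, mem_powersetCard.2 ⟨hT, by rw [← h2, card_pt]⟩, rfl⟩
  · rintro ⟨T, hT, rfl⟩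
    obtain ⟨h1, h2⟩ := mem_powersetCard.1 hT
    exact ⟨pt_mono h1, by rw [card_pt, h2]⟩

variable (W ix) in
/-- The partite sets with index set `S`. -/
def PT (S : Finset (Fin r)) : Finset (Finset V) :=
  W.powerset.filter fun I => Set.InjOn ix I ∧ I.image ix = up S

lemma mem_PT {I : Finset V} : I ∈ PT W ix S ↔ I ⊆ W ∧ Set.InjOn ix I ∧ I.image ix = up S := by
  simp only [PT, mem_filter, mem_powerset]

lemma pt_mem_PT : pt S x ∈ PT W ix S := mem_PT.2 ⟨pt_subset, injOn_pt, image_pt⟩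

variable (W ix) in
/-- The number of partite sets with index set `S`. -/
def numPT (S : Finset (Fin r)) : ℝ := ∏ i ∈ S, (Fintype.card (VX W ix i) : ℝ)

/-- The vertex set of a partial point. -/
def ptS (S : Finset (Fin r)) (y : ∀ i : S, VX W ix (i : Fin r)) : Finset V :=
  univ.image fun i => (y i : V)

lemma ptS_restrict (x : ∀ i : Fin r, VX W ix i) : ptS S (fun i : S => x i) = pt S x := by
  ext v
  simp only [ptS, pt, mem_image, mem_univ, true_and]
  exact ⟨fun ⟨a, e⟩ => ⟨a, a.2, e⟩, fun ⟨a, ha, e⟩ => ⟨⟨a, ha⟩, e⟩⟩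

lemma sum_ptS [∀ i : Fin r, Nonempty (VX W ix i)] (S : Finset (Fin r)) (g : Finset V → ℝ) :
    ∑ y, g (ptS (W := W) (ix := ix) S y) = ∑ I ∈ PT W ix S, g I := by
  obtain ⟨z⟩ : Nonempty (∀ i : Fin r, VX W ix i) := inferInstance
  have hy : ∀ y, ptS (W := W) (ix := ix) S y = pt S (extend S y z) := by
    intro y
    rw [← ptS_restrict]
    congr 1
    funext i
    simp [extend]
  refine sum_bij (fun y _ => ptS S y) ?_ ?_ ?_ fun _ _ => rfl
  · intro y _
    rw [hy]
    exact pt_mem_PT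
  · intro y _ y' _ e
    rw [hy, hy, pt_eq_iff] at e
    funext i
    have := e i i.2
    simpa [extend] using this
  · intro I hI
    obtain ⟨h1, h2, h3⟩ := mem_PT.1 hI
    have : ∀ i : S, ∃ v ∈ I, ix v = (i : Fin r) + 1 := by
      intro i
      have : ((i : Fin r) : ℕ) + 1 ∈ I.image ix := h3 ▸ mem_up.2 i.2
      exact mem_image.1 this
    choose f hf hf' using this
    refine ⟨fun i => ⟨f i, mem_filter.2 ⟨h1 (hf i), hf' i⟩⟩, mem_univ _, ?_⟩
    ext v
    simp only [ptS, mem_image, mem_univ, true_and]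
    constructor
    · rintro ⟨i, rfl⟩; exact hf i
    · intro hv
      have : ix v ∈ up S := h3 ▸ mem_image_of_mem _ hv
      obtain ⟨i, hi, e⟩ := mem_image.1 this
      exact ⟨⟨i, hi⟩, h2 (hf _) hv (by rw [hf', e])⟩

lemma card_ptS (S : Finset (Fin r)) :
    (Fintype.card (∀ i : S, VX W ix (i : Fin r)) : ℝ) = numPT W ix S := by
  rw [Fintype.card_pi, Nat.cast_prod, numPT]
  exact prod_coe_sort S fun i => (Fintype.card (VX W ix i) : ℝ)

lemma numPT_pos [∀ i : Fin r, Nonempty (VX W ix i)] (S : Finset (Fin r)) : 0 < numPT W ix S :=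
  prod_pos fun i _ => by exact_mod_cast Fintype.card_pos

lemma expect_pt [∀ i : Fin r, Nonempty (VX W ix i)] (S : Finset (Fin r)) (g : Finset V → ℝ) :
    𝔼 x : ∀ i : Fin r, VX W ix i, g (pt S x) = (∑ I ∈ PT W ix S, g I) / numPT W ix S := by
  have h := expect_restrict (X := fun i : Fin r => VX W ix i) S fun y => g (ptS S y)
  simp only [ptS_restrict] at h
  rw [h, Fintype.expect_eq_sum_div_card, sum_ptS, card_ptS]

lemma sum_PT [∀ i : Fin r, Nonempty (VX W ix i)] (S : Finset (Fin r)) (g : Finset V → ℝ) :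
    ∑ I ∈ PT W ix S, g I = numPT W ix S * 𝔼 x : ∀ i : Fin r, VX W ix i, g (pt S x) := by
  rw [expect_pt, mul_div_cancel₀ _ (numPT_pos S).ne']

lemma card_PT [∀ i : Fin r, Nonempty (VX W ix i)] (S : Finset (Fin r)) :
    ((PT W ix S).card : ℝ) = numPT W ix S := by
  have := sum_PT (W := W) (ix := ix) S fun _ => 1
  simpa using this

lemma sum_ind_card {α : Type*} {s t : Finset α} (h : t ⊆ s) : ∑ I ∈ s, ind (I ∈ t) = t.card := by
  rw [← sum_subset h fun I _ hI => ind_false hI, sum_congr rfl fun I hI => ind_true hI]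
  simp

/-- Regularity gives cut-smallness. -/
lemma RegAt.cutLE [∀ i : Fin r, Nonempty (VX W ix i)] {Cl E : Finset (Finset V)}
    {ε d : ℝ} (h : RegAt Cl E S.card ε d) (hCl : Cl ⊆ PT W ix S)
    (hS : S.Nonempty) (hε : 0 ≤ ε) (hd : 0 ≤ d) (hd1 : d ≤ 1) :
    CutLE S (fun x : ∀ i : Fin r, VX W ix i =>
      (ind (pt S x ∈ E) - d) * ind (pt S x ∈ Cl)) ε := by
  intro P hP
  rw [← expect_piecewise S]
  refine (abs_expect_le _).trans (expect_le_of_le fun z => ?_)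
  set G : Finset (Finset V) := W.powerset.filter fun T => ∃ i ∈ S, ∃ x : ∀ i : Fin r, VX W ix i,
    T = pt (S.erase i) x ∧ P i (S.piecewise x z) with hG
  have hpt : ∀ x : ∀ i : Fin r, VX W ix i, pt S (S.piecewise x z) = pt S x := fun x =>
    pt_congr fun i hi => by simp [hi]
  have hev : ∀ x : ∀ i : Fin r, VX W ix i, (∀ i ∈ S, P i (S.piecewise x z)) ↔
      ∀ T ∈ (pt S x).powersetCard (S.card - 1), T ∈ G := by
    intro x
    constructor
    · intro hx T hT
      obtain ⟨T', hT', rfl⟩ := mem_powersetCard_pt.1 hT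
      obtain ⟨h1, h2⟩ := mem_powersetCard.1 hT'
      rw [hG, mem_filter, mem_powerset]
      refine ⟨pt_subset, ?_⟩
      have hlt : T'.card < S.card := by
        have := hS.card_pos
        omega
      obtain ⟨i, hi, hiT⟩ := exists_mem_notMem_of_card_lt_card hlt
      refine ⟨i, hi, x, ?_, hx i hi⟩
      rw [eq_of_subset_of_card_le (subset_erase.2 ⟨h1, hiT⟩) (by rw [card_erase_of_mem hi, h2])]
    · intro hx i hi
      have h1 := hx (pt (S.erase i) x) (mem_powersetCard_pt.2 ⟨_, mem_powersetCard.2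
        ⟨erase_subset _ _, card_erase_of_mem hi⟩, rfl⟩)
      rw [hG, mem_filter] at h1
      obtain ⟨-, i', hi', x', e, hx'⟩ := h1
      have e2 : up (S.erase i) = up (S.erase i') := by
        rw [← image_pt (x := x), e, image_pt]
      have e3 := up_injective e2
      have e4 : i = i' := by
        by_contra hne
        have : i ∈ S.erase i' := mem_erase.2 ⟨hne, hi⟩
        rw [← e3] at this
        exact (mem_erase.1 this).1 rfl
      subst e4
      rw [pt_eq_iff] at e
      refine (hP i hi (x := S.piecewise x z) (y := S.piecewise x' z) fun j hj => ?_).mpr hx'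
      by_cases hjS : j ∈ S
      · simp only [hjS, piecewise_eq_of_mem]
        exact e j (mem_erase.2 ⟨hj, hjS⟩)
      · simp [hjS]
  have hsub' : cliq Cl S.card G ⊆ Cl := fun I hI => (mem_cliq.1 hI).1
  have hsub : cliq Cl S.card G ⊆ PT W ix S := hsub'.trans hCl
  have e1 : ∀ x : ∀ i : Fin r, VX W ix i,
      (ind (pt S (S.piecewise x z) ∈ E) - d) * ind (pt S (S.piecewise x z) ∈ Cl) *
        ind (∀ i ∈ S, P i (S.piecewise x z)) =
      (fun I => ind (I ∈ E ∩ cliq Cl S.card G) - d * ind (I ∈ cliq Cl S.card G)) (pt S x) := by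
    intro x
    simp only [hpt, mem_inter, mem_cliq, ← hev, ind_and]
    ring
  rw [expect_congr rfl fun x _ => e1 x, expect_pt S fun I =>
    ind (I ∈ E ∩ cliq Cl S.card G) - d * ind (I ∈ cliq Cl S.card G), sum_sub_distrib, ← mul_sum,
    sum_ind_card (inter_subset_right.trans hsub), sum_ind_card hsub]
  have hN := numPT_pos (W := W) (ix := ix) S
  rw [abs_div, abs_of_pos hN, div_le_iff₀ hN]
  have hClN : (Cl.card : ℝ) ≤ numPT W ix S := by
    rw [← card_PT]; exact_mod_cast card_le_card hCl
  have hK : ((cliq Cl S.card G).card : ℝ) ≤ Cl.card := by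
    exact_mod_cast card_le_card hsub'
  rcases le_total (ε * (Cl.card : ℝ)) ((cliq Cl S.card G).card : ℝ) with hle | hle
  · exact (h G hle).trans (by nlinarith)
  · have h1 : ((E ∩ cliq Cl S.card G).card : ℝ) ≤ (cliq Cl S.card G).card := by
      exact_mod_cast card_le_card inter_subset_right
    have h2 : (0 : ℝ) ≤ (E ∩ cliq Cl S.card G).card := Nat.cast_nonneg _
    have h3 : (0 : ℝ) ≤ (cliq Cl S.card G).card := Nat.cast_nonneg _
    refine le_trans (abs_le.2 ⟨?_, ?_⟩) (hle.trans (mul_le_mul_of_nonneg_left hClN hε))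
    · nlinarith
    · nlinarith

end Pt

end

end HypReg

namespace HypReg

open Finset LabFam
open scoped BigOperators

attribute [local instance 10] Classical.propDecidable

set_option linter.unusedSectionVars false

noncomputable section

/-- Inverse of `up`. -/
def dn {r : ℕ} (M : Finset ℕ) : Finset (Fin r) := univ.filter fun i => (i : ℕ) + 1 ∈ M

lemma dn_up {r : ℕ} (S : Finset (Fin r)) : dn (up S) = S := by
  ext i
  simp only [dn, mem_filter, mem_univ, true_and]
  exact mem_up

/-- The address described by a pattern of labels. -/
def patAddr {r T : ℕ} (j : ℕ) (S : Finset (Fin r)) (p : Finset (Fin r) → Fin (T + 2)) : Addr :=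
  (up S, fun M => if M ⊆ up S ∧ 2 ≤ M.card ∧ M.card ≤ j then (p (dn M) : ℕ) else 0)

lemma patAddr_congr {r T : ℕ} {j : ℕ} {S : Finset (Fin r)} {p q : Finset (Fin r) → Fin (T + 2)}
    (h : ∀ U ⊆ S, U.card ≤ j → p U = q U) : patAddr j S p = patAddr j S q := by
  refine Prod.ext rfl (funext fun M => ?_)
  simp only [patAddr]
  split_ifs with hM
  · obtain ⟨U, hU, rfl⟩ := subset_up_iff.1 hM.1
    rw [card_up] at hM
    rw [dn_up, h U hU hM.2.2]
  · rfl

/-- Truncation to the unit interval. -/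
def clip (d : ℝ) : ℝ := max 0 (min 1 d)

lemma clip_nonneg (d : ℝ) : 0 ≤ clip d := le_max_left _ _

lemma clip_le_one (d : ℝ) : clip d ≤ 1 := max_le zero_le_one (min_le_left _ _)

lemma clip_eq {d : ℝ} (h0 : 0 ≤ d) (h1 : d ≤ 1) : clip d = d := by
  rw [clip, min_eq_right h1, max_eq_right h0]

/-- The kernel of label densities. -/
def baseKer (k : ℕ) (a : ℕ → ℕ) (d : Addr → ℝ) (r T : ℕ) (S : Finset (Fin r))
    (p : Finset (Fin r) → Fin (T + 2)) : ℝ :=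
  if 2 ≤ S.card ∧ S.card ≤ k - 1 then
    ind ((p S : ℕ) ∈ Icc 1 (a S.card)) * (1 / (a S.card : ℝ))
  else if S.card = k then
    ind (p S = 1) * clip (d (patAddr (k - 1) S p)) +
      ind (p S = 0) * (1 - clip (d (patAddr (k - 1) S p)))
  else ind (p S = 0)

lemma sum_ind_fin {N a : ℕ} (ha : a < N) (c : ℝ) :
    ∑ b : Fin N, ind ((b : ℕ) ∈ Icc 1 a) * c = a * c := by
  rw [← sum_mul, Fin.sum_univ_eq_sum_range (fun b => ind (b ∈ Icc 1 a)) N, sum_ind_card]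
  · simp
  · intro b hb
    rw [mem_Icc] at hb
    rw [mem_range]
    omega

lemma baseKer_isKer {k : ℕ} (hk : 2 ≤ k) {a : ℕ → ℕ} {d : Addr → ℝ} {r T : ℕ}
    (ha : ∀ i, 1 ≤ i → i ≤ k - 1 → 1 ≤ a i ∧ a i ≤ T) : IsKer (baseKer k a d r T) := by
  refine ⟨?_, ?_, ?_⟩
  · intro S p q h
    unfold baseKer
    rw [h S subset_rfl, patAddr_congr (p := p) (q := q) fun U hU _ => h U hU]
  · intro S p
    unfold baseKer
    have := clip_nonneg (d (patAddr (k - 1) S p))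
    have := clip_le_one (d (patAddr (k - 1) S p))
    split_ifs
    · exact mul_nonneg (ind_nonneg _) (by positivity)
    · exact add_nonneg (mul_nonneg (ind_nonneg _) (by linarith))
        (mul_nonneg (ind_nonneg _) (by linarith))
    · exact ind_nonneg _
  · intro S p
    unfold baseKer
    simp only [Function.update_self]
    split_ifs with h1 h2
    · obtain ⟨h3, h4⟩ := ha S.card (by omega) h1.2
      rw [sum_ind_fin (by omega)]
      have : (a S.card : ℝ) ≠ 0 := by
        have : a S.card ≠ 0 := by omega
        exact_mod_cast this
      field_simp
    · have e : ∀ b, patAddr (k - 1) S (Function.update p S b) = patAddr (k - 1) S p := fun b =>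
        patAddr_congr fun U hU hc => Function.update_of_ne (by rintro rfl; omega) _ _
      simp only [e, sum_add_distrib, ← sum_mul]
      have h3 : ∀ c : Fin (T + 2), ∑ b, ind (b = c) = 1 := fun c => by
        rw [← sum_ind_eq c]; exact sum_congr rfl fun b _ => ind_congr eq_comm
      rw [h3, h3]; ring
    · rw [← sum_ind_eq (0 : Fin (T + 2))]; exact sum_congr rfl fun b _ => ind_congr eq_comm

section Base

variable {V : Type} [DecidableEq V] {F : LabFam V} {k : ℕ} {a : ℕ → ℕ} {r T : ℕ}

variable (F k r T) in
/-- The colouring of partite sets by labels and by membership in `H`. -/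
def baseCol (H : Finset (Finset V)) (x : ∀ i : Fin r, VX F.gnd F.vIdx i)
    (S : Finset (Fin r)) : Fin (T + 2) :=
  if 2 ≤ S.card ∧ S.card ≤ k - 1 then Fin.ofNat (T + 2) (F.lbl S.card (pt S x))
  else if S.card = k then (if pt S x ∈ H then 1 else 0) else 0

lemma baseCol_isDep (H : Finset (Finset V)) : IsDep (baseCol F k r T H) := by
  intro S x y h
  have : pt S x = pt S y := pt_congr h
  simp only [baseCol, this]

lemma pt_mem_cross (hF : F.IdxOK) {S : Finset (Fin r)} (x : ∀ i : Fin r, VX F.gnd F.vIdx i) :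
    pt S x ∈ F.toPartFam.cross S.card :=
  (mem_cross hF).2 ⟨pt_subset, card_pt, injOn_pt⟩

lemma patAddr_baseCol (hF : F.LabOK k a) (ha : ∀ i, 1 ≤ i → i ≤ k - 1 → a i ≤ T)
    {H : Finset (Finset V)} {j : ℕ} (hj : j ≤ k - 1) (S : Finset (Fin r))
    (x : ∀ i : Fin r, VX F.gnd F.vIdx i) :
    patAddr j S (baseCol F k r T H x) = F.addrOf j (pt S x) := by
  refine Prod.ext (by rw [addrOf_fst, image_pt]; rfl) (funext fun M => ?_)
  simp only [patAddr, LabFam.addrOf, image_pt]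
  split_ifs with hM
  · obtain ⟨U, hU, rfl⟩ := subset_up_iff.1 hM.1
    have hs : (pt S x).filter (fun v => F.vIdx v ∈ up U) = pt U x := by
      have := sub_pt (W := F.gnd) (ix := F.vIdx) (x := x) hU
      unfold sub at this
      convert this
    rw [dn_up, hs, card_up] at *
    have h2 := hM.2
    have h3 := hF.lbl_range U.card h2.1 (by omega) _ (pt_mem_cross hF.canon.idx x)
    have h4 := ha U.card (by omega) (by omega)
    rw [baseCol, if_pos ⟨h2.1, by omega⟩]
    simp only [Fin.ofNat]
    exact Nat.mod_eq_of_lt (by omega)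
  · rfl

lemma isAddress_addrOf (hidx : F.IdxOK) (hir : ∀ v ∈ F.gnd, 1 ≤ F.vIdx v ∧ F.vIdx v ≤ a 1)
    (hlr : ∀ j, 2 ≤ j → j ≤ k - 1 → ∀ I ∈ F.toPartFam.cross j, 1 ≤ F.lbl j I ∧ F.lbl j I ≤ a j)
    {j i : ℕ} (hi : i ≤ k - 1) {J : Finset V} (hJ : J ∈ F.toPartFam.cross j) :
    IsAddress j i a (F.addrOf i J) := by
  obtain ⟨h1, h2, h3⟩ := (mem_cross hidx).1 hJ
  refine ⟨card_addrOf hidx hJ, ?_, ?_, fun M hM => addrOf_supp i J M hM⟩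
  · intro m hm
    obtain ⟨v, hv, rfl⟩ := mem_image.1 hm
    exact hir v (h1 hv)
  · intro M hM hM2 hMi
    rw [addrOf_snd hM hM2 hMi]
    refine hlr M.card hM2 (by omega) _ ?_
    have := cross_subset hidx hJ (sub_subset (ix := F.vIdx) (M := M))
    rwa [card_sub h3 hM] at this

lemma ClA_subset_PT (hF : F.IdxOK) {j : ℕ} {y : Addr} {S : Finset (Fin r)} (hy : y.1 = up S) :
    F.ClA j y ⊆ PT F.gnd F.vIdx S := by
  intro I hI
  obtain ⟨h1, h2⟩ := mem_ClA.1 hI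
  obtain ⟨h3, -, h5⟩ := (mem_cross hF).1 h1
  refine mem_PT.2 ⟨h3, h5, ?_⟩
  rw [← addrOf_fst (j - 1), h2, hy]

variable [∀ i : Fin r, Nonempty (VX F.gnd F.vIdx i)]

lemma cutLE_of_addr (hF : F.LabOK k a) (ha : ∀ i, 1 ≤ i → i ≤ k - 1 → a i ≤ T) {j : ℕ}
    (hjk : j ≤ k) {S : Finset (Fin r)} (hS : S.card = j)
    {h : (∀ i : Fin r, VX F.gnd F.vIdx i) → ℝ} {ε : ℝ} (hε : 0 ≤ ε)
    (H : ∀ J ∈ F.toPartFam.cross j, J.image F.vIdx = up S →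
      CutLE S (fun x => h x * ind (pt S x ∈ F.ClA j (F.addrOf (j - 1) J))) ε) :
    CutLE S h ((T + 2 : ℝ) ^ (2 ^ r) * ε) := by
  set Y : Finset Addr := univ.image fun x : ∀ i : Fin r, VX F.gnd F.vIdx i =>
    F.addrOf (j - 1) (pt S x) with hY
  have hcard : (Y.card : ℝ) ≤ (T + 2 : ℝ) ^ (2 ^ r) := by
    have h1 : Y ⊆ (univ : Finset (Finset (Fin r) → Fin (T + 2))).image (patAddr (j - 1) S) := by
      intro y hy
      obtain ⟨x, -, rfl⟩ := mem_image.1 hy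
      refine mem_image.2 ⟨_, mem_univ _, patAddr_baseCol (H := ∅) hF ha (by omega) S x⟩
    have h2 := (card_le_card h1).trans card_image_le
    rw [card_univ, Fintype.card_fun, Fintype.card_fin, Fintype.card_finset, Fintype.card_fin] at h2
    exact_mod_cast h2
  refine CutLE.mono (CutLE.congr (CutLE.sum Y (ε := ε)
    (h := fun y x => h x * ind (pt S x ∈ F.ClA j y)) ?_) ?_)
    (mul_le_mul_of_nonneg_right hcard hε)
  · intro y hy
    obtain ⟨x, -, rfl⟩ := mem_image.1 hy
    exact H _ (hS ▸ pt_mem_cross hF.canon.idx x) image_pt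
  · intro x
    rw [← mul_sum]
    have e : ∀ y, ind (pt S x ∈ F.ClA j y) = ind (F.addrOf (j - 1) (pt S x) = y) := fun y =>
      ind_congr (by
        rw [mem_ClA]
        exact and_iff_right (hS ▸ pt_mem_cross hF.canon.idx x))
    rw [sum_congr rfl fun y _ => e y,
      sum_eq_single_of_mem (F.addrOf (j - 1) (pt S x)) (hY ▸ mem_image.2 ⟨x, mem_univ x, rfl⟩),
      ind_true rfl, mul_one]
    intro y _ hy
    exact ind_false fun e => hy e.symm

lemma ind_fin_val {N : ℕ} {c d : Fin N} : ind (c = d) = ind ((c : ℕ) = d) := ind_congr Fin.ext_iff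

lemma Nice.superReg (hk : 2 ≤ k) {ε : ℝ} {d : Addr → ℝ} {H : Finset (Finset V)}
    (hF : F.Nice k a ε d H) (hε : 0 ≤ ε) (hd : DensityFun k a d)
    (ha : ∀ i, 1 ≤ i → i ≤ k - 1 → 1 ≤ a i ∧ a i ≤ T) :
    SuperReg (baseCol F k r T H) (baseKer k a d r T) ((T + 2 : ℝ) ^ (2 ^ r) * ε) := by
  have ha' : ∀ i, 1 ≤ i → i ≤ k - 1 → a i ≤ T := fun i h1 h2 => (ha i h1 h2).2
  have hpos : (0 : ℝ) ≤ (T + 2 : ℝ) ^ (2 ^ r) * ε := by positivity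
  intro S c
  by_cases h1 : 2 ≤ S.card ∧ S.card ≤ k - 1
  · obtain ⟨h3, h4⟩ := ha S.card (by omega) h1.2
    have hdev : ∀ x, dev (baseCol F k r T H) (baseKer k a d r T) S c x =
        ind (F.lbl S.card (pt S x) = c) - ind ((c : ℕ) ∈ Icc 1 (a S.card)) * (1 / (a S.card : ℝ)) := by
      intro x
      simp only [dev, baseCol, baseKer, if_pos h1, Function.update_self]
      rw [ind_fin_val]
      simp only [Fin.ofNat]
      have h5 := (hF.lab.lbl_range S.card h1.1 h1.2 _ (pt_mem_cross hF.lab.canon.idx x)).2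
      rw [Nat.mod_eq_of_lt (by omega)]
    by_cases hc : (c : ℕ) ∈ Icc 1 (a S.card)
    · refine cutLE_of_addr hF.lab ha' (j := S.card) (by omega) rfl hε fun J hJ hJS => ?_
      rw [mem_Icc] at hc
      refine CutLE.congr (RegAt.cutLE (hF.low S.card h1.1 h1.2 J hJ c hc.1 hc.2)
        (ClA_subset_PT hF.lab.canon.idx hJS) (card_pos.1 (by omega)) hε (by positivity) ?_) ?_
      · rw [div_le_one (by exact_mod_cast h3)]; exact_mod_cast h3
      · intro x
        rw [hdev, ind_true (mem_Icc.2 hc), one_mul]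
        congr 2
        refine ind_congr ?_
        rw [lblSet, mem_filter]
        exact (and_iff_right (pt_mem_cross hF.lab.canon.idx x)).symm
    · refine CutLE.congr (CutLE.zero hpos) fun x => ?_
      rw [hdev, ind_false hc, ind_false, zero_mul, sub_zero]
      intro e
      have h5 := hF.lab.lbl_range S.card h1.1 h1.2 _ (pt_mem_cross hF.lab.canon.idx x)
      rw [e] at h5
      exact hc (mem_Icc.2 h5)
  · by_cases h2 : S.card = k
    · have hdev : ∀ x, dev (baseCol F k r T H) (baseKer k a d r T) S c x =
          (ind (c = 1) - ind (c = 0)) * (ind (pt S x ∈ H) - clip (d (F.addrOf (k - 1) (pt S x)))) := by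
        intro x
        have e : patAddr (k - 1) S (Function.update (baseCol F k r T H x) S c) =
            F.addrOf (k - 1) (pt S x) := by
          rw [← patAddr_baseCol hF.lab ha' (H := H) le_rfl S x]
          exact patAddr_congr fun U hU hc => Function.update_of_ne (by rintro rfl; omega) _ _
        have h01 : (0 : Fin (T + 2)) ≠ 1 := by simp
        simp only [dev, baseCol, baseKer, if_neg h1, if_pos h2, Function.update_self, e]
        by_cases hH : pt S x ∈ H
        · rw [if_pos hH, ind_true hH, ind_congr (p := (1 : Fin (T + 2)) = c) eq_comm]
          by_cases hc1 : c = 1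
          · subst hc1
            rw [ind_true rfl, ind_false h01.symm]; ring
          · rw [ind_false hc1]; ring
        · rw [if_neg hH, ind_false hH, ind_congr (p := (0 : Fin (T + 2)) = c) eq_comm]
          by_cases hc1 : c = 0
          · subst hc1
            rw [ind_true rfl, ind_false h01]; ring
          · rw [ind_false hc1]; ring
      refine cutLE_of_addr hF.lab ha' le_rfl h2 hε fun J hJ hJS => ?_
      have hadd := isAddress_addrOf hF.lab.canon.idx hF.lab.idx_range hF.lab.lbl_range le_rfl hJ
      obtain ⟨h3, h4⟩ := hd _ hadd
      have habs : |ind (c = 1) - ind (c = 0)| ≤ 1 := by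
        have := ind_nonneg (c = 1)
        have := ind_nonneg (c = 0)
        have := ind_le_one (c = 1)
        have := ind_le_one (c = 0)
        rw [abs_le]; constructor <;> linarith
      have htop : RegAt (F.ClA k (F.addrOf (k - 1) J)) H S.card ε (d (F.addrOf (k - 1) J)) := by
        rw [h2]; exact hF.top _ hadd
      refine CutLE.congr (CutLE.const_mul (RegAt.cutLE htop
        (ClA_subset_PT hF.lab.canon.idx hJS) (card_pos.1 (by omega)) hε h3 h4) habs) ?_
      intro x
      rw [hdev, mul_assoc]
      congr 1
      refine ind_mul_congr fun hx => ?_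
      rw [(mem_ClA.1 hx).2, clip_eq h3 h4]
    · refine CutLE.congr (CutLE.zero hpos) fun x => ?_
      simp only [dev, baseCol, baseKer, if_neg h1, if_neg h2, Function.update_self]
      rw [ind_congr (eq_comm (a := c)), sub_self]

end Base

end

end HypReg

namespace HypReg

open Finset LabFam
open scoped BigOperators

attribute [local instance 10] Classical.propDecidable

set_option linter.unusedSectionVars false

noncomputable section

/-- Counting a chain of events, each regular relative to the previous ones. -/
lemma count_events {ι : Type} [Fintype ι] [DecidableEq ι] {X : ι → Type} [∀ i, Fintype (X i)]
    [∀ i, Nonempty (X i)] {R : Finset ι → (∀ i, X i) → Prop}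
    (hR : ∀ S, DependsOn (R S) (S : Set ι)) {w e : Finset ι → ℝ}
    (hw0 : ∀ S, 0 ≤ w S) (hw1 : ∀ S, w S ≤ 1) (𝒟 : Finset (Finset ι)) (h𝒟 : DownClosed 𝒟)
    (he : ∀ S ∈ 𝒟, CutLE S (fun x => (ind (R S x) - w S) * ind (∀ T ∈ S.ssubsets, R T x)) (e S)) :
    |(𝔼 x, ind (∀ T ∈ 𝒟, R T x)) - ∏ T ∈ 𝒟, w T| ≤ ∑ S ∈ 𝒟, e S := by
  revert he
  refine DownClosed.induction (motive := fun 𝒟 => (∀ S ∈ 𝒟,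
    CutLE S (fun x => (ind (R S x) - w S) * ind (∀ T ∈ S.ssubsets, R T x)) (e S)) →
    |(𝔼 x, ind (∀ T ∈ 𝒟, R T x)) - ∏ T ∈ 𝒟, w T| ≤ ∑ S ∈ 𝒟, e S) ?_ ?_ 𝒟 h𝒟
  · intro _
    simp [ind]
  · intro 𝒟 S h𝒟 hS hmax hd ih he
    have ih' := ih fun T hT => he T (mem_of_mem_erase hT)
    have h1 := ((he S hS).absorb (𝒟.erase S) R fun T hT => ⟨hmax T hT, hR T⟩).expect_le
    have hss : ∀ T ∈ S.ssubsets, T ∈ 𝒟.erase S := fun T hT => by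
      obtain ⟨h2, h3⟩ := Finset.mem_ssubsets.1 hT |>.1, Finset.mem_ssubsets.1 hT |>.ne
      exact mem_erase.2 ⟨h3, h𝒟 S hS T h2⟩
    have key : ∀ x, ind (∀ T ∈ 𝒟, R T x) = w S * ind (∀ T ∈ 𝒟.erase S, R T x) +
        (ind (R S x) - w S) * ind (∀ T ∈ S.ssubsets, R T x) * ind (∀ T ∈ 𝒟.erase S, R T x) := by
      intro x
      have e1 : ind (∀ T ∈ 𝒟, R T x) = ind (R S x) * ind (∀ T ∈ 𝒟.erase S, R T x) := by
        rw [← ind_and]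
        refine ind_congr ⟨fun h => ⟨h S hS, fun T hT => h T (mem_of_mem_erase hT)⟩, fun h T hT => ?_⟩
        by_cases hTS : T = S
        · rw [hTS]; exact h.1
        · exact h.2 T (mem_erase.2 ⟨hTS, hT⟩)
      have e2 : ind (∀ T ∈ S.ssubsets, R T x) * ind (∀ T ∈ 𝒟.erase S, R T x) =
          ind (∀ T ∈ 𝒟.erase S, R T x) := by
        rw [← ind_and]
        exact ind_congr (and_iff_right_of_imp fun h T hT => h T (hss T hT))
      rw [e1, mul_assoc, e2]; ring
    rw [Finset.expect_congr rfl fun x _ => key x, Finset.expect_add_distrib, ← Finset.mul_expect,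
      ← mul_prod_erase _ _ hS, ← add_sum_erase _ _ hS, add_sub_right_comm, ← mul_sub,
      add_comm (e S)]
    refine (abs_add_le _ _).trans (add_le_add ?_ h1)
    rw [abs_mul, abs_of_nonneg (hw0 S)]
    exact (mul_le_of_le_one_left (abs_nonneg _) (hw1 S)).trans ih'

section Lower

variable {V : Type} [DecidableEq V] {F : LabFam V} {k : ℕ} {a : ℕ → ℕ} {r : ℕ}

lemma pt_nonempty_of_idx (hF : F.LabOK k a) (i : Fin (a 1)) : Nonempty (VX F.gnd F.vIdx i) := by
  obtain ⟨v, hv, e⟩ := hF.idx_surj (i + 1) (by omega) (by omega)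
  exact ⟨⟨v, mem_filter.2 ⟨hv, e⟩⟩⟩

/-- Membership in an address class, in terms of the labels of subsets. -/
lemma pt_mem_ClA_iff (hF : F.IdxOK) {S : Finset (Fin r)} {j : ℕ} (hS : S.card = j) {y : Addr}
    (hy1 : y.1 = up S) (hy : Supp (j - 1) y) (hj : 1 ≤ j) (x : ∀ i : Fin r, VX F.gnd F.vIdx i) :
    pt S x ∈ F.ClA j y ↔
      ∀ U ∈ S.ssubsets, 2 ≤ U.card → F.lbl U.card (pt U x) = y.2 (up U) := by
  rw [mem_ClA, and_iff_right (hS ▸ pt_mem_cross hF x), addrOf_eq_iff hy, image_pt, EmbA, image_pt,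
    hy1]
  constructor
  · rintro ⟨-, -, h⟩ U hU h2
    rw [Finset.mem_ssubsets] at hU
    have := h (up U) (up_subset.2 hU.1) (by rwa [card_up])
      (by rw [card_up]; have := card_lt_card hU; omega)
    rwa [sub_pt hU.1, card_up] at this
  · intro h
    refine ⟨rfl, subset_rfl, fun M hM h2 hMj => ?_⟩
    obtain ⟨U, hU, rfl⟩ := subset_up_iff.1 hM
    rw [sub_pt hU]
    rw [card_up] at h2 hMj ⊢
    refine h U (Finset.mem_ssubsets.2 (Finset.ssubset_iff_subset_ne.2 ⟨hU, ?_⟩)) h2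
    rintro rfl
    omega

lemma restrictA_supp (y : Addr) (j : ℕ) (B : Finset ℕ) : Supp j (restrictA y j B) :=
  fun _ h => if_neg h

/-- Lower bound for the density of an address class. -/
lemma Nice.lower {ε : ℝ} {d : Addr → ℝ} {H : Finset (Finset V)} (hF : F.Nice k a ε d H)
    (hε : 0 ≤ ε) (ha : ∀ i, 1 ≤ i → i ≤ k - 1 → 1 ≤ a i) {j : ℕ} (h2 : 2 ≤ j) (hjk : j ≤ k)
    {y : Addr} (hy : IsAddress j (j - 1) a y) {t : ℝ} (ht : 1 ≤ t)
    (hat : ∀ i, 1 ≤ i → i ≤ k - 1 → (a i : ℝ) ≤ t)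
    (hεt : 3 ≤ k → 2 ^ k * ε ≤ (1 / t) ^ (2 ^ k) / 2) {q : ℕ}
    (hq : ∀ v ∈ F.gnd, q ≤ (F.gnd.filter fun u => F.vIdx u = F.vIdx v).card) :
    (1 / t) ^ (2 ^ k) / 2 * (q : ℝ) ^ j ≤ ((F.ClA j y).card : ℝ) := by
  have hne : ∀ i : Fin (a 1), Nonempty (VX F.gnd F.vIdx i) := pt_nonempty_of_idx hF.lab
  have hidx := hF.lab.canon.idx
  obtain ⟨S, hS⟩ := exists_up (r := a 1) hy.2.1
  have hSc : S.card = j := by rw [← card_up, hS, hy.1]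
  have hsupp : Supp (j - 1) y := hy.2.2.2
  set R : Finset (Fin (a 1)) → (∀ i : Fin (a 1), VX F.gnd F.vIdx i) → Prop := fun U x =>
    2 ≤ U.card → F.lbl U.card (pt U x) = y.2 (up U) with hR
  set w : Finset (Fin (a 1)) → ℝ := fun U =>
    if 2 ≤ U.card ∧ U.card ≤ k - 1 then 1 / (a U.card : ℝ) else 1 with hw
  set e : Finset (Fin (a 1)) → ℝ := fun U => if 2 ≤ U.card then ε else 0 with he
  have ht0 : (0 : ℝ) < 1 / t := by positivity
  have ht1 : 1 / t ≤ 1 := by rw [div_le_one (by linarith)]; exact ht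
  have hwt : ∀ U, 1 / t ≤ w U := by
    intro U
    simp only [hw]
    split_ifs with h
    · have h3 := ha U.card (by omega) h.2
      exact one_div_le_one_div_of_le (by exact_mod_cast h3) (hat U.card (by omega) h.2)
    · exact ht1
  have hw1 : ∀ U, w U ≤ 1 := by
    intro U
    simp only [hw]
    split_ifs with h
    · have h3 := ha U.card (by omega) h.2
      have : (1 : ℝ) ≤ a U.card := by exact_mod_cast h3
      rw [div_le_one (by linarith)]; exact this
    · exact le_rfl
  have hcount := count_events (R := R) (w := w) (e := e)
    (fun U x x' hxx => by
      have : pt U x = pt U x' := pt_congr hxx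
      simp only [hR, this])
    (fun U => ht0.le.trans (hwt U)) hw1 S.ssubsets
    (fun U hU T hTU => Finset.mem_ssubsets.2 (lt_of_le_of_lt hTU (Finset.mem_ssubsets.1 hU))) ?_
  · have hsum : ∑ U ∈ S.ssubsets, e U ≤ (1 / t) ^ (2 ^ k) / 2 := by
      by_cases hk3 : 3 ≤ k
      · refine le_trans (sum_le_card_nsmul _ _ ε fun U _ => ?_) (le_trans ?_ (hεt hk3))
        · simp only [he]; split_ifs
          · exact le_rfl
          · exact hε
        · rw [nsmul_eq_mul]
          refine mul_le_mul_of_nonneg_right ?_ hε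
          have : S.ssubsets.card ≤ 2 ^ k := by
            refine (card_le_card (erase_subset _ _)).trans ?_
            rw [card_powerset, hSc]
            exact Nat.pow_le_pow_right (by norm_num) hjk
          exact_mod_cast this
      · rw [sum_eq_zero]
        · positivity
        · intro U hU
          have := card_lt_card (Finset.mem_ssubsets.1 hU)
          simp only [he]
          rw [if_neg (by omega)]
    have hprod : (1 / t) ^ (2 ^ k) ≤ ∏ U ∈ S.ssubsets, w U := by
      calc (1 / t) ^ (2 ^ k) ≤ (1 / t) ^ S.ssubsets.card := by
            refine pow_le_pow_of_le_one ht0.le ht1 ?_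
            refine (card_le_card (erase_subset _ _)).trans ?_
            rw [card_powerset, hSc]
            exact Nat.pow_le_pow_right (by norm_num) hjk
        _ = ∏ U ∈ S.ssubsets, (1 / t) := by rw [prod_const]
        _ ≤ _ := prod_le_prod (fun _ _ => ht0.le) fun U _ => hwt U
    have hE : (1 / t) ^ (2 ^ k) / 2 ≤ 𝔼 x : ∀ i : Fin (a 1), VX F.gnd F.vIdx i,
        ind (pt S x ∈ F.ClA j y) := by
      have h3 : ∀ x : ∀ i : Fin (a 1), VX F.gnd F.vIdx i,
          ind (pt S x ∈ F.ClA j y) = ind (∀ U ∈ S.ssubsets, R U x) := fun x =>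
        ind_congr (pt_mem_ClA_iff hidx hSc hS.symm hsupp (by omega) x)
      rw [expect_congr rfl fun x _ => h3 x]
      have := (abs_le.1 hcount).1
      linarith
    rw [expect_pt S fun I => ind (I ∈ F.ClA j y), sum_ind_card (ClA_subset_PT hidx hS.symm),
      le_div_iff₀ (numPT_pos S)] at hE
    refine le_trans (mul_le_mul_of_nonneg_left ?_ (by positivity)) hE
    rw [← hSc, ← prod_const]
    refine prod_le_prod (fun _ _ => by positivity) fun i _ => ?_
    obtain ⟨v, hv, e⟩ := hF.lab.idx_surj (i + 1) (by omega) (by omega)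
    have := hq v hv
    rw [e] at this
    rw [Fintype.card_coe]
    exact_mod_cast this
  · intro U hU
    have hUS := Finset.mem_ssubsets.1 hU
    have hUc := card_lt_card hUS
    by_cases hU2 : 2 ≤ U.card
    · have hUk : U.card ≤ k - 1 := by omega
      set z := restrictA y (U.card - 1) (up U) with hz
      have hzi : ∀ x : ∀ i : Fin (a 1), VX F.gnd F.vIdx i,
          pt U x ∈ F.ClA U.card z ↔ ∀ T ∈ U.ssubsets, R T x := by
        intro x
        rw [pt_mem_ClA_iff (S := U) (y := z) hidx rfl rfl (restrictA_supp _ _ _) (by omega)]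
        refine forall₂_congr fun T hT => forall_congr' fun hT2 => ?_
        have hTU := Finset.mem_ssubsets.1 hT
        have hTc := card_lt_card hTU
        rw [hz, restrictA]
        dsimp only
        rw [if_pos ⟨up_subset.2 hTU.1, by rwa [card_up], by rw [card_up]; omega⟩]
      by_cases hemp : (F.ClA U.card z).Nonempty
      · obtain ⟨J, hJ⟩ := hemp
        obtain ⟨hJ1, hJ2⟩ := mem_ClA.1 hJ
        have hb := hy.2.2.1 (up U) (hS ▸ up_subset.2 hUS.1) (by rwa [card_up])
          (by rw [card_up]; omega)
        rw [card_up] at hb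
        have hreg := hF.low U.card hU2 hUk J hJ1 _ hb.1 hb.2
        rw [hJ2] at hreg
        have ha1 := ha U.card (by omega) hUk
        have ha1' : (1 : ℝ) ≤ a U.card := by exact_mod_cast ha1
        simp only [he, if_pos hU2]
        refine CutLE.congr (RegAt.cutLE hreg (ClA_subset_PT hidx rfl) (card_pos.1 (by omega)) hε
          (by positivity) (by rw [div_le_one (by linarith)]; exact ha1')) fun x => ?_
        rw [ind_congr (hzi x)]
        congr 2
        · refine ind_congr ?_
          simp only [hR, lblSet, mem_filter]
          rw [and_iff_right (pt_mem_cross hidx x)]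
          exact ⟨fun h => h hU2, fun h _ => h⟩
        · simp only [hw]
          rw [if_pos ⟨hU2, hUk⟩]
      · refine CutLE.congr (CutLE.zero (by simp only [he]; split_ifs; linarith)) fun x => ?_
        rw [ind_false (p := ∀ T ∈ U.ssubsets, R T x), mul_zero]
        rw [← hzi]
        exact fun h => hemp ⟨_, h⟩
    · refine CutLE.congr (CutLE.zero (by simp only [he]; split_ifs; linarith)) fun x => ?_
      rw [ind_true (p := R U x) fun h => absurd h hU2]
      simp only [hw]
      rw [if_neg (by omega), sub_self, zero_mul]

end Lower

end

end HypReg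

namespace HypReg

open Finset LabFam
open scoped BigOperators

attribute [local instance 10] Classical.propDecidable

set_option linter.unusedSectionVars false

noncomputable section

lemma abs_prod_sub_prod_le {ι : Type*} (s : Finset ι) (f g : ι → ℝ)
    (hf : ∀ i ∈ s, 0 ≤ f i ∧ f i ≤ 1) (hg : ∀ i ∈ s, 0 ≤ g i ∧ g i ≤ 1) :
    |∏ i ∈ s, f i - ∏ i ∈ s, g i| ≤ ∑ i ∈ s, |f i - g i| := by
  induction s using Finset.induction_on with
  | empty => simp
  | insert i s hi ih =>
    rw [prod_insert hi, prod_insert hi, sum_insert hi]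
    have h1 := ih (fun j hj => hf j (mem_insert_of_mem hj)) fun j hj => hg j (mem_insert_of_mem hj)
    have h2 : 0 ≤ ∏ j ∈ s, f j := prod_nonneg fun j hj => (hf j (mem_insert_of_mem hj)).1
    have h3 : ∏ j ∈ s, f j ≤ 1 := prod_le_one (fun j hj => (hf j (mem_insert_of_mem hj)).1)
      fun j hj => (hf j (mem_insert_of_mem hj)).2
    obtain ⟨h4, h5⟩ := hg i (mem_insert_self _ _)
    have e : f i * ∏ j ∈ s, f j - g i * ∏ j ∈ s, g j =
        (f i - g i) * ∏ j ∈ s, f j + g i * (∏ j ∈ s, f j - ∏ j ∈ s, g j) := by ring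
    rw [e]
    refine (abs_add_le _ _).trans (add_le_add ?_ ?_)
    · rw [abs_mul, abs_of_nonneg h2]
      exact mul_le_of_le_one_right (abs_nonneg _) h3
    · rw [abs_mul, abs_of_nonneg h4]
      exact (mul_le_of_le_one_left (abs_nonneg _) h5).trans h1

lemma card_powersetCard_le_pow {V : Type} (W : Finset V) (j : ℕ) :
    (W.powersetCard j).card ≤ W.card ^ j := by
  rw [card_powersetCard]
  exact Nat.choose_le_pow _ _

section

variable {V : Type} [DecidableEq V] {W : Finset V} {ix : V → ℕ} {r : ℕ}

/-- Sets meeting a small set are few. -/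
lemma card_touching_le (W Z : Finset V) (j : ℕ) :
    ((W.powersetCard j).filter fun I => ∃ v ∈ I, v ∈ Z).card ≤ Z.card * W.card ^ (j - 1) := by
  have hsub : ((W.powersetCard j).filter fun I => ∃ v ∈ I, v ∈ Z) ⊆
      (Z ×ˢ W.powersetCard (j - 1)).image fun p => insert p.1 p.2 := by
    intro I hI
    simp only [mem_filter, mem_powersetCard] at hI
    obtain ⟨⟨hW, hc⟩, v, hvI, hvZ⟩ := hI
    refine mem_image.2 ⟨(v, I.erase v), mem_product.2 ⟨hvZ, mem_powersetCard.2
      ⟨(erase_subset _ _).trans hW, ?_⟩⟩, insert_erase hvI⟩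
    rw [card_erase_of_mem hvI, hc]
  refine (card_le_card hsub).trans (card_image_le.trans ?_)
  rw [card_product]
  exact Nat.mul_le_mul_left _ (card_powersetCard_le_pow _ _)

/-- Sets with two vertices in the same class are few. -/
lemma card_not_injOn_le (W : Finset V) (ix : V → ℕ) {q : ℕ}
    (hq : ∀ v ∈ W, (W.filter fun u => ix u = ix v).card ≤ q) (j : ℕ) :
    ((W.powersetCard j).filter fun I : Finset V => ¬ Set.InjOn ix I).card ≤ W.card * q * W.card ^ (j - 2) := by
  have hsub : ((W.powersetCard j).filter fun I : Finset V => ¬ Set.InjOn ix I) ⊆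
      ((W.sigma fun v => W.filter fun u => ix u = ix v) ×ˢ W.powersetCard (j - 2)).image
        fun p => insert p.1.1 (insert p.1.2 p.2) := by
    intro I hI
    simp only [mem_filter, mem_powersetCard] at hI
    obtain ⟨⟨hW, hc⟩, hI⟩ := hI
    simp only [Set.InjOn, not_forall] at hI
    obtain ⟨u, hu, v, hv, huv, hne⟩ := hI
    rw [mem_coe] at hu hv
    have hv' : v ∈ I.erase u := mem_erase.2 ⟨Ne.symm hne, hv⟩
    refine mem_image.2 ⟨(⟨u, v⟩, (I.erase u).erase v), mem_product.2 ⟨?_, mem_powersetCard.2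
      ⟨((erase_subset _ _).trans (erase_subset _ _)).trans hW, ?_⟩⟩, ?_⟩
    · simp only [mem_sigma, mem_filter]
      exact ⟨hW hu, hW hv, huv.symm⟩
    · rw [card_erase_of_mem hv', card_erase_of_mem hu, hc]; omega
    · simp only [insert_erase hv', insert_erase hu]
  refine (card_le_card hsub).trans (card_image_le.trans ?_)
  rw [card_product, card_sigma]
  refine Nat.mul_le_mul ?_ (card_powersetCard_le_pow _ _)
  refine (sum_le_sum hq).trans ?_
  simp

/-- The density of a `j`-graph is approximated by an average over partite sets. -/
lemma dens_approx [hne : ∀ i : Fin r, Nonempty (VX W ix i)] {n : ℕ} (hn : W.card = n)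
    (hn0 : 1 ≤ n) (hr : ∀ v ∈ W, 1 ≤ ix v ∧ ix v ≤ r) (hr0 : 1 ≤ r)
    (hsz : ∀ i : Fin r, Fintype.card (VX W ix i) = n / r ∨ Fintype.card (VX W ix i) = n / r + 1)
    {j : ℕ} (hj : 1 ≤ j) (Ψ : Finset V → Prop) :
    |(((W.powersetCard j).filter Ψ).card : ℝ) / (n : ℝ) ^ j -
      ∑ S ∈ powersetCard j (univ : Finset (Fin r)),
        (1 / r : ℝ) ^ j * 𝔼 x : ∀ i : Fin r, VX W ix i, ind (Ψ (pt S x))|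
      ≤ 1 / r + 1 / n + 2 ^ r * (j / n) := by
  have hn1 : (0 : ℝ) < n := by exact_mod_cast hn0
  have hr1 : (0 : ℝ) < r := by exact_mod_cast hr0
  have hfl : ((n / r : ℕ) : ℝ) ≤ n / r := Nat.cast_div_le
  have hfl' : (n : ℝ) / r ≤ ((n / r : ℕ) : ℝ) + 1 := by
    rw [div_le_iff₀ hr1]
    have := Nat.lt_div_mul_add (a := n) (b := r) (by omega)
    have h2 : n ≤ (n / r + 1) * r := by rw [add_mul]; omega
    exact_mod_cast h2
  have hcl : ∀ i : Fin r, |(Fintype.card (VX W ix i) : ℝ) / n - 1 / r| ≤ 1 / n := by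
    intro i
    have e : (Fintype.card (VX W ix i) : ℝ) / n - 1 / r =
        ((Fintype.card (VX W ix i) : ℝ) - n / r) / n := by field_simp
    rw [e, abs_div, abs_of_pos hn1]
    refine div_le_div_of_nonneg_right ?_ hn1.le
    rw [abs_le]
    rcases hsz i with h | h <;> rw [h] <;> push_cast <;> constructor <;> linarith
  -- splitting into partite and non-injective sets
  set A := (W.powersetCard j).filter Ψ with hA
  have hsplit : (A.card : ℝ) = ((A.filter fun I : Finset V => ¬ Set.InjOn ix I).card : ℝ) +
      ((A.filter fun I : Finset V => Set.InjOn ix I).card : ℝ) := by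
    rw [add_comm]
    exact_mod_cast (card_filter_add_card_filter_not (s := A) (fun I : Finset V => Set.InjOn ix I)).symm
  have hbi : (A.filter fun I : Finset V => Set.InjOn ix I) =
      (powersetCard j (univ : Finset (Fin r))).biUnion fun S => (PT W ix S).filter Ψ := by
    ext I
    simp only [hA, mem_filter, mem_powersetCard, mem_biUnion, mem_PT]
    constructor
    · rintro ⟨⟨⟨h1, h2⟩, h3⟩, h4⟩
      obtain ⟨S, hS⟩ := exists_up (r := r) (M := I.image ix) fun i hi => by
        obtain ⟨v, hv, rfl⟩ := mem_image.1 hi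
        exact hr v (h1 hv)
      refine ⟨S, ⟨subset_univ _, ?_⟩, ⟨h1, h4, hS.symm⟩, h3⟩
      rw [← card_up, hS, card_image_of_injOn h4, h2]
    · rintro ⟨S, ⟨-, hS⟩, ⟨h1, h4, h5⟩, h3⟩
      refine ⟨⟨⟨h1, ?_⟩, h3⟩, h4⟩
      rw [← card_image_of_injOn h4, h5, card_up, hS]
  have hcard : ((A.filter fun I : Finset V => Set.InjOn ix I).card : ℝ) =
      ∑ S ∈ powersetCard j (univ : Finset (Fin r)),
        numPT W ix S * 𝔼 x : ∀ i : Fin r, VX W ix i, ind (Ψ (pt S x)) := by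
    rw [hbi, card_biUnion]
    · push_cast
      refine sum_congr rfl fun S _ => ?_
      rw [← sum_PT S fun I => ind (Ψ I)]
      rw [card_eq_sum_ones, sum_filter]
      push_cast
      refine sum_congr rfl fun I _ => ?_
      by_cases h : Ψ I <;> simp [ind, h]
    · intro S _ S' _ hSS
      refine disjoint_left.2 fun I h1 h2 => hSS ?_
      simp only [mem_filter, mem_PT] at h1 h2
      exact up_injective (h1.1.2.2.symm.trans h2.1.2.2)
  have hnon : ((A.filter fun I : Finset V => ¬ Set.InjOn ix I).card : ℝ) / n ^ j ≤ 1 / r + 1 / n := by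
    by_cases h2 : 2 ≤ j
    · have h3 := card_not_injOn_le W ix (q := n / r + 1) (fun v hv => by
        obtain ⟨h4, h5⟩ := hr v hv
        have h6 := hsz ⟨ix v - 1, by omega⟩
        rw [Fintype.card_coe] at h6
        have h7 : (W.filter fun u => ix u = ix v) =
            W.filter fun u => ix u = ((⟨ix v - 1, by omega⟩ : Fin r) : ℕ) + 1 := by
          simp only [Nat.sub_add_cancel h4]
        rw [h7]
        rcases h6 with h | h <;> rw [h]; omega) j
      have h8 : (A.filter fun I : Finset V => ¬ Set.InjOn ix I).card ≤
          ((W.powersetCard j).filter fun I : Finset V => ¬ Set.InjOn ix I).card := by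
        refine card_le_card fun I hI => ?_
        simp only [hA, mem_filter] at hI ⊢
        exact ⟨hI.1.1, hI.2⟩
      rw [hn] at h3
      have h9 : ((A.filter fun I : Finset V => ¬ Set.InjOn ix I).card : ℝ) ≤
          n * ((n / r : ℕ) + 1) * n ^ (j - 2) := by exact_mod_cast h8.trans h3
      rw [div_le_iff₀ (by positivity)]
      refine h9.trans ?_
      have h10 : (n : ℝ) ^ j = n * n * n ^ (j - 2) := by
        rw [← pow_two, ← pow_add]; congr 1; omega
      rw [h10]
      have h11 : (1 / r + 1 / n : ℝ) * (n * n * n ^ (j - 2)) = n * (n / r + 1) * n ^ (j - 2) := by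
        field_simp
      rw [h11]
      gcongr
    · have : (A.filter fun I : Finset V => ¬ Set.InjOn ix I) = ∅ := by
        refine filter_eq_empty_iff.2 fun I hI => ?_
        simp only [hA, mem_filter, mem_powersetCard] at hI
        rw [not_not]
        intro u hu v hv _
        exact card_le_one.1 (by omega : I.card ≤ 1) u hu v hv
      rw [this]
      simp only [card_empty, Nat.cast_zero, zero_div]
      positivity
  have hnum : ∀ S ∈ powersetCard j (univ : Finset (Fin r)),
      |numPT W ix S / n ^ j - (1 / r) ^ j| ≤ j / n := by
    intro S hS
    have hSc := (mem_powersetCard.1 hS).2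
    have e1 : numPT W ix S / n ^ j = ∏ i ∈ S, (Fintype.card (VX W ix i) : ℝ) / n := by
      rw [numPT, prod_div_distrib, prod_const, hSc]
    have e2 : ((1 : ℝ) / r) ^ j = ∏ i ∈ S, (1 / r : ℝ) := by rw [prod_const, hSc]
    rw [e1, e2]
    refine (abs_prod_sub_prod_le S _ _ (fun i _ => ⟨by positivity, ?_⟩) fun i _ =>
      ⟨by positivity, ?_⟩).trans ?_
    · rw [div_le_one hn1, ← hn, Fintype.card_coe]
      exact_mod_cast card_le_card (filter_subset _ _)
    · rw [div_le_one hr1]; exact_mod_cast hr0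
    · refine (sum_le_sum fun i _ => hcl i).trans (le_of_eq ?_)
      rw [sum_const, hSc, nsmul_eq_mul]; ring
  have hE : ∀ S : Finset (Fin r), |𝔼 x : ∀ i : Fin r, VX W ix i, ind (Ψ (pt S x))| ≤ 1 := by
    intro S
    refine (abs_expect_le _).trans (expect_le_of_le fun x => ?_)
    rw [abs_of_nonneg (ind_nonneg _)]
    exact ind_le_one _
  have hmain : (A.card : ℝ) / n ^ j - ∑ S ∈ powersetCard j (univ : Finset (Fin r)),
      (1 / r : ℝ) ^ j * 𝔼 x : ∀ i : Fin r, VX W ix i, ind (Ψ (pt S x)) =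
      ((A.filter fun I : Finset V => ¬ Set.InjOn ix I).card : ℝ) / n ^ j +
      ∑ S ∈ powersetCard j (univ : Finset (Fin r)), (numPT W ix S / n ^ j - (1 / r) ^ j) *
        𝔼 x : ∀ i : Fin r, VX W ix i, ind (Ψ (pt S x)) := by
    rw [hsplit, hcard, add_div, sum_div, add_sub_assoc, ← sum_sub_distrib]
    congr 1
    exact sum_congr rfl fun S _ => by ring
  rw [hmain]
  refine (abs_add_le _ _).trans (add_le_add ?_ ?_)
  · rw [abs_of_nonneg (by positivity)]; exact hnon
  · refine (abs_sum_le_sum_abs _ _).trans ?_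
    have h1 : ∀ S ∈ powersetCard j (univ : Finset (Fin r)), |(numPT W ix S / n ^ j - (1 / r) ^ j) *
        𝔼 x : ∀ i : Fin r, VX W ix i, ind (Ψ (pt S x))| ≤ (j / n : ℝ) := by
      intro S hS
      rw [abs_mul]
      exact (mul_le_mul (hnum S hS) (hE S) (abs_nonneg _) (by positivity)).trans (by rw [mul_one])
    refine (sum_le_sum h1).trans ?_
    rw [sum_const, nsmul_eq_mul]
    refine mul_le_mul_of_nonneg_right ?_ (by positivity)
    rw [card_powersetCard, card_univ, Fintype.card_fin]
    exact_mod_cast Nat.choose_le_two_pow r j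

/-- Comparison of densities on two vertex sets with matching class structures. -/
lemma dens_compare {V' : Type} [DecidableEq V'] {W' : Finset V'} {ix' : V' → ℕ}
    [hne : ∀ i : Fin r, Nonempty (VX W ix i)] [hne' : ∀ i : Fin r, Nonempty (VX W' ix' i)]
    {n m : ℕ} (hn : W.card = n) (hm : W'.card = m) (hn0 : 1 ≤ n) (hm0 : 1 ≤ m)
    (hr : ∀ v ∈ W, 1 ≤ ix v ∧ ix v ≤ r) (hr' : ∀ v ∈ W', 1 ≤ ix' v ∧ ix' v ≤ r) (hr0 : 1 ≤ r)
    (hsz : ∀ i : Fin r, Fintype.card (VX W ix i) = n / r ∨ Fintype.card (VX W ix i) = n / r + 1)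
    (hsz' : ∀ i : Fin r, Fintype.card (VX W' ix' i) = m / r ∨
      Fintype.card (VX W' ix' i) = m / r + 1)
    {j : ℕ} (hj : 1 ≤ j) (Ψ : Finset V → Prop) (Ψ' : Finset V' → Prop) {η : ℝ}
    (hη0 : 0 ≤ η) (hη : ∀ S : Finset (Fin r), S.card = j →
      |(𝔼 x : ∀ i : Fin r, VX W ix i, ind (Ψ (pt S x))) -
        𝔼 x : ∀ i : Fin r, VX W' ix' i, ind (Ψ' (pt S x))| ≤ η) :
    |(((W.powersetCard j).filter Ψ).card : ℝ) / (n : ℝ) ^ j -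
      (((W'.powersetCard j).filter Ψ').card : ℝ) / (m : ℝ) ^ j|
      ≤ η + (2 / r + (1 + 2 ^ r * j) * (1 / n + 1 / m)) := by
  have h1 := dens_approx hn hn0 hr hr0 hsz hj Ψ
  have h2 := dens_approx hm hm0 hr' hr0 hsz' hj Ψ'
  have hr1 : (0 : ℝ) < r := by exact_mod_cast hr0
  have hS0 : ∀ S ∈ powersetCard j (univ : Finset (Fin r)), |(1 / r : ℝ) ^ j *
      (𝔼 x : ∀ i : Fin r, VX W ix i, ind (Ψ (pt S x))) -
        (1 / r : ℝ) ^ j * 𝔼 x : ∀ i : Fin r, VX W' ix' i, ind (Ψ' (pt S x))| ≤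
        (1 / r : ℝ) ^ j * η := by
    intro S hS
    rw [← mul_sub, abs_mul, abs_of_nonneg (by positivity)]
    exact mul_le_mul_of_nonneg_left (hη S (mem_powersetCard.1 hS).2) (by positivity)
  have h3 : |∑ S ∈ powersetCard j (univ : Finset (Fin r)),
        (1 / r : ℝ) ^ j * (𝔼 x : ∀ i : Fin r, VX W ix i, ind (Ψ (pt S x))) -
      ∑ S ∈ powersetCard j (univ : Finset (Fin r)),
        (1 / r : ℝ) ^ j * 𝔼 x : ∀ i : Fin r, VX W' ix' i, ind (Ψ' (pt S x))| ≤ η := by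
    rw [← sum_sub_distrib]
    refine (abs_sum_le_sum_abs _ _).trans ((sum_le_sum hS0).trans ?_)
    rw [sum_const, nsmul_eq_mul, card_powersetCard, card_univ, Fintype.card_fin, ← mul_assoc]
    have h4 : ((r.choose j : ℕ) : ℝ) * (1 / r : ℝ) ^ j ≤ 1 := by
      rw [one_div, inv_pow, ← div_eq_mul_inv, div_le_one (by positivity)]
      exact_mod_cast Nat.choose_le_pow r j
    exact mul_le_of_le_one_left hη0 h4
  have e : (2 / r + (1 + 2 ^ r * j) * (1 / n + 1 / m) : ℝ) =
      (1 / r + 1 / n + 2 ^ r * (j / n)) + (1 / r + 1 / m + 2 ^ r * (j / m)) := by ring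
  rw [e]
  rw [abs_le] at h1 h2 h3 ⊢
  constructor <;> linarith [h1.1, h1.2, h2.1, h2.2, h3.1, h3.2]

end

end

end HypReg

namespace HypReg

open Finset LabFam
open scoped BigOperators

attribute [local instance 10] Classical.propDecidable

set_option linter.unusedSectionVars false

noncomputable section

section MkFam

variable {V : Type} [DecidableEq V]

/-- The partition of the vertices alone. -/
def preFam (W : Finset V) (f : V → ℕ) (c : Finset V → ℕ) : LabFam V where
  gnd := W
  vClass v := W.filter fun u => f u = f v
  cls _ _ := ∅
  vIdx := f
  lbl _ := c

/-- The family of partitions determined by vertex indices and labels. -/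
def mkFam (W : Finset V) (f : V → ℕ) (c : Finset V → ℕ) : LabFam V :=
  { preFam W f c with
    cls := fun j J => ((preFam W f c).toPartFam.cross j).filter fun I =>
      (preFam W f c).addrOf j I = (preFam W f c).addrOf j J }

variable {W : Finset V} {f g : V → ℕ} {c : Finset V → ℕ}

lemma mkFam_idxOK : (mkFam W f c).IdxOK := by
  intro u hu v _
  change f u = f v ↔ (W.filter fun w => f w = f u) = W.filter fun w => f w = f v
  constructor
  · intro h; rw [h]
  · intro h
    have : u ∈ W.filter fun w => f w = f u := mem_filter.2 ⟨hu, rfl⟩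
    rw [h] at this
    exact (mem_filter.1 this).2

lemma mkFam_canon (l : ℕ) : (mkFam W f c).Canon l where
  idx := mkFam_idxOK
  vcl _ _ := rfl
  cls _ _ _ _ _ := rfl

lemma mem_cross_mkFam {i : ℕ} {S : Finset V} :
    S ∈ (mkFam W f c).toPartFam.cross i ↔ S ⊆ W ∧ S.card = i ∧ Set.InjOn f S :=
  mem_cross mkFam_idxOK

lemma mem_cross_mkFam_congr {i : ℕ} {S : Finset V} (h : ∀ v ∈ S, f v = g v) :
    S ∈ (mkFam W f c).toPartFam.cross i ↔ S ∈ (mkFam W g c).toPartFam.cross i := by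
  have : Set.InjOn f S ↔ Set.InjOn g S := Set.EqOn.injOn_iff fun v hv => h v hv
  rw [mem_cross_mkFam, mem_cross_mkFam, this]

lemma mem_ClA_mkFam_congr {i : ℕ} {S : Finset V} {y : Addr} (h : ∀ v ∈ S, f v = g v) :
    S ∈ (mkFam W f c).ClA i y ↔ S ∈ (mkFam W g c).ClA i y := by
  have h1 : S.image f = S.image g := image_congr fun v hv => h v hv
  have h2 : ∀ M : Finset ℕ, S.filter (fun v => f v ∈ M) = S.filter fun v => g v ∈ M := by
    intro M
    ext v
    simp only [mem_filter]
    exact and_congr_right fun hv => by rw [h v hv]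
  have h3 : (mkFam W f c).addrOf (i - 1) S = (mkFam W g c).addrOf (i - 1) S := by
    change (S.image f, fun M => if M ⊆ S.image f ∧ 2 ≤ M.card ∧ M.card ≤ i - 1 then
      c (S.filter fun v => f v ∈ M) else 0) = (S.image g, fun M => if M ⊆ S.image g ∧ 2 ≤ M.card ∧
      M.card ≤ i - 1 then c (S.filter fun v => g v ∈ M) else 0)
    rw [h1]
    simp only [h2]
  rw [mem_ClA, mem_ClA, mem_cross_mkFam_congr h, h3]

end MkFam

section Rebalance

variable {V : Type} [DecidableEq V]

lemma exists_fibers (R : Finset V) (B : Finset ℕ) (s : ℕ → ℕ) (h : ∑ b ∈ B, s b = R.card) :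
    ∃ g : V → ℕ, (∀ v ∈ R, g v ∈ B) ∧ ∀ b ∈ B, (R.filter fun v => g v = b).card = s b := by
  induction B using Finset.induction_on generalizing R with
  | empty =>
    simp only [sum_empty] at h
    have : R = ∅ := card_eq_zero.1 h.symm
    exact ⟨fun _ => 0, by simp [this], by simp⟩
  | insert b B hb ih =>
    rw [sum_insert hb] at h
    obtain ⟨U, hU, hUc⟩ := exists_subset_card_eq (s := R) (n := s b) (by omega)
    obtain ⟨g, hg1, hg2⟩ := ih (R \ U) (by rw [card_sdiff_of_subset hU]; omega)
    refine ⟨fun v => if v ∈ U then b else g v, fun v hv => ?_, fun d hd => ?_⟩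
    · by_cases h1 : v ∈ U
      · simp [h1]
      · simp only [h1, if_false]
        exact mem_insert_of_mem (hg1 v (mem_sdiff.2 ⟨hv, h1⟩))
    · rcases mem_insert.1 hd with rfl | hd
      · rw [← hUc]
        congr 1
        ext v
        simp only [mem_filter]
        constructor
        · rintro ⟨h1, h2⟩
          by_contra h3
          rw [if_neg h3] at h2
          exact hb (h2 ▸ hg1 v (mem_sdiff.2 ⟨h1, h3⟩))
        · intro h1; exact ⟨hU h1, if_pos h1⟩
      · rw [← hg2 d hd]
        congr 1
        ext v
        simp only [mem_filter, mem_sdiff]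
        have hdb : b ≠ d := fun e => hb (e ▸ hd)
        by_cases h1 : v ∈ U
        · simp [h1, hdb]
        · simp [h1]

/-- A function can be made balanced by few changes. -/
lemma exists_balanced (W : Finset V) (a : ℕ) (ha : 1 ≤ a) (f : V → ℕ)
    (hf : ∀ v ∈ W, 1 ≤ f v ∧ f v ≤ a) (q : ℕ)
    (hq : ∀ b ∈ Icc 1 a, (W.filter fun v => f v = b).card ≤ W.card / a + q) :
    ∃ g : V → ℕ, (∀ v ∈ W, 1 ≤ g v ∧ g v ≤ a) ∧
      (∀ b ∈ Icc 1 a, (W.filter fun v => g v = b).card = W.card / a ∨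
        (W.filter fun v => g v = b).card = W.card / a + 1) ∧
      (W.filter fun v => f v ≠ g v).card ≤ a * q := by
  set t : ℕ → ℕ := fun b => W.card / a + if b ≤ W.card % a then 1 else 0 with ht
  set fb : ℕ → Finset V := fun b => W.filter fun v => f v = b with hfb
  have hAex : ∀ b, ∃ A ⊆ fb b, A.card = min (fb b).card (t b) := fun b =>
    exists_subset_card_eq (min_le_left _ _)
  choose A hA hAc using hAex
  set K := (Icc 1 a).biUnion A with hK
  have hKW : K ⊆ W := by
    intro v hv
    obtain ⟨b, -, hb⟩ := mem_biUnion.1 hv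
    exact (mem_filter.1 (hA b hb)).1
  have hfA : ∀ {b v}, v ∈ A b → f v = b := fun {b v} hv => (mem_filter.1 (hA b hv)).2
  have hKc : K.card = ∑ b ∈ Icc 1 a, (A b).card := card_biUnion fun b _ d _ hbd =>
    disjoint_left.2 fun v h1 h2 => hbd ((hfA h1).symm.trans (hfA h2))
  have htsum : ∑ b ∈ Icc 1 a, t b = W.card := by
    simp only [ht]
    rw [sum_add_distrib, sum_const, Nat.card_Icc, ← sum_filter, ← card_eq_sum_ones]
    have : (Icc 1 a).filter (fun b => b ≤ W.card % a) = Icc 1 (W.card % a) := by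
      ext b
      simp only [mem_filter, mem_Icc]
      have := Nat.mod_lt W.card (show 0 < a by omega)
      omega
    rw [this, Nat.card_Icc, Nat.add_sub_cancel, Nat.add_sub_cancel, smul_eq_mul]
    exact Nat.div_add_mod _ _
  have hAt : ∀ b, (A b).card ≤ t b := fun b => hAc b ▸ min_le_right _ _
  have hsum : ∑ b ∈ Icc 1 a, (t b - (A b).card) = (W \ K).card := by
    rw [card_sdiff_of_subset hKW, hKc, ← htsum]
    exact sum_tsub_distrib _ fun b _ => hAt b
  obtain ⟨h, h1, h2⟩ := exists_fibers (W \ K) (Icc 1 a) _ hsum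
  have hgb : ∀ b ∈ Icc 1 a, (W.filter fun v => (if v ∈ K then f v else h v) = b).card = t b := by
    intro b hb
    have : (W.filter fun v => (if v ∈ K then f v else h v) = b) =
        A b ∪ (W \ K).filter fun v => h v = b := by
      ext v
      simp only [mem_filter, mem_union, mem_sdiff]
      by_cases hv : v ∈ K
      · simp only [hv, if_true, not_true, and_false, false_and, or_false]
        constructor
        · rintro ⟨-, rfl⟩
          obtain ⟨d, -, hd⟩ := mem_biUnion.1 hv
          rwa [hfA hd]
        · intro hv'; exact ⟨hKW hv, hfA hv'⟩
      · simp only [hv, if_false, not_false_iff, and_true]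
        constructor
        · intro h; exact Or.inr h
        · rintro (h | h)
          · exact absurd (mem_biUnion.2 ⟨b, hb, h⟩) hv
          · exact h
    rw [this, card_union_of_disjoint, h2 b hb]
    · have := hAt b; omega
    · refine disjoint_left.2 fun v h3 h4 => ?_
      exact (mem_sdiff.1 (mem_filter.1 h4).1).2 (mem_biUnion.2 ⟨b, hb, h3⟩)
  refine ⟨fun v => if v ∈ K then f v else h v, fun v hv => ?_, fun b hb => ?_, ?_⟩
  · dsimp only
    split_ifs with hvK
    · exact hf v hv
    · exact mem_Icc.1 (h1 v (mem_sdiff.2 ⟨hv, hvK⟩))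
  · rw [hgb b hb]
    simp only [ht]
    split_ifs
    · exact Or.inr rfl
    · exact Or.inl rfl
  · have hsub : (W.filter fun v => f v ≠ if v ∈ K then f v else h v) ⊆
        (Icc 1 a).biUnion fun b => fb b \ A b := by
      intro v hv
      simp only [mem_filter] at hv
      obtain ⟨hvW, hv⟩ := hv
      have hvK : v ∉ K := fun hc => hv (by simp [hc])
      have hfv := mem_Icc.2 (hf v hvW)
      refine mem_biUnion.2 ⟨f v, hfv, mem_sdiff.2 ⟨mem_filter.2 ⟨hvW, rfl⟩, fun hc => ?_⟩⟩
      exact hvK (mem_biUnion.2 ⟨_, hfv, hc⟩)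
    refine (card_le_card hsub).trans (card_biUnion_le.trans ?_)
    refine (sum_le_card_nsmul _ _ q fun b hb => ?_).trans (by simp)
    rw [card_sdiff_of_subset (hA b), hAc]
    have h3 := hq b hb
    have h4 : W.card / a ≤ t b := Nat.le_add_right _ _
    change (fb b).card ≤ _ at h3
    omega

end Rebalance

section Coded

variable {V : Type} [DecidableEq V] {F : LabFam V} {W : Finset V} {ix : V → ℕ} {k r N : ℕ}

/-- The labels of `F` are given by the colours `c` of partite sets. -/
structure Coded (F : LabFam V) (ix : V → ℕ) (k : ℕ)
    (c : (∀ i : Fin r, VX W ix i) → Finset (Fin r) → Fin N) : Prop where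
  idx : ∀ x i, F.vIdx (x i) = c x {i}
  lbl : ∀ x U, 2 ≤ U.card → U.card ≤ k - 1 → pt U x ∈ F.toPartFam.cross U.card →
    F.lbl U.card (pt U x) = c x U

/-- The colour pattern `p` on `S` is that of the address `y`. -/
def PatOK (S : Finset (Fin r)) (j : ℕ) (y : Addr) (p : Finset (Fin r) → Fin N) : Prop :=
  S.card = j ∧ Set.InjOn (fun i => (p {i} : ℕ)) S ∧ (S.image fun i => (p {i} : ℕ)) = y.1 ∧
  ∀ U ⊆ S, 2 ≤ U.card → U.card ≤ j - 1 → (p U : ℕ) = y.2 (U.image fun i => (p {i} : ℕ))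

lemma Coded.image_pt {c : (∀ i : Fin r, VX W ix i) → Finset (Fin r) → Fin N}
    (hc : Coded F ix k c) (x : ∀ i : Fin r, VX W ix i) (U : Finset (Fin r)) :
    (pt U x).image F.vIdx = U.image fun i => (c x {i} : ℕ) := by
  rw [pt, image_image]
  exact image_congr fun i _ => hc.idx x i

lemma Coded.mem_ClA_iff {c : (∀ i : Fin r, VX W ix i) → Finset (Fin r) → Fin N}
    (hc : Coded F ix k c) (hF : F.IdxOK) (hW : F.gnd = W) {j : ℕ} (hj : j ≤ k) {y : Addr}
    (hy : Supp (j - 1) y) (S : Finset (Fin r)) (x : ∀ i : Fin r, VX W ix i) :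
    pt S x ∈ F.ClA j y ↔ PatOK S j y (c x) := by
  have hinj : Set.InjOn F.vIdx (pt S x) ↔ Set.InjOn (fun i => (c x {i} : ℕ)) S := by
    rw [← card_image_iff, ← card_image_iff, hc.image_pt, card_pt]
  rw [mem_ClA, mem_cross hF, addrOf_eq_iff hy, hc.image_pt, card_pt, hW, hinj, PatOK,
    and_iff_right pt_subset, and_assoc]
  refine and_congr_right fun hS => and_congr_right fun hI => and_congr_right fun hy1 => ?_
  rw [EmbA, hc.image_pt, hy1, and_iff_right subset_rfl]
  have hI' := hinj.2 hI
  have hsub : ∀ U ⊆ S, HypReg.sub F.vIdx (U.image fun i => (c x {i} : ℕ)) (pt S x) = pt U x := by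
    intro U hU
    rw [← hc.image_pt x U, sub_image hI' (pt_mono hU)]
  have hcr : ∀ U ⊆ S, pt U x ∈ F.toPartFam.cross U.card := fun U hU =>
    (mem_cross hF).2 ⟨by rw [hW]; exact pt_subset, card_pt, hI'.mono (coe_subset.2 (pt_mono hU))⟩
  have hci : ∀ U ⊆ S, (U.image fun i => (c x {i} : ℕ)).card = U.card := fun U hU =>
    card_image_of_injOn (hI.mono (coe_subset.2 hU))
  constructor
  · intro h U hU h2 hUj
    have := h (U.image fun i => (c x {i} : ℕ)) (hy1 ▸ image_subset_image hU)
      (by rwa [hci U hU]) (by rwa [hci U hU])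
    rwa [hsub U hU, hci U hU, hc.lbl x U h2 (by omega) (hcr U hU)] at this
  · intro h M hM h2 hMj
    rw [← hy1] at hM
    obtain ⟨U, hU, rfl⟩ := subset_image_iff.1 hM
    have hU' : U ⊆ S := coe_subset.1 hU
    rw [hci U hU'] at h2 hMj
    rw [hsub U hU', hci U hU', hc.lbl x U h2 (by omega) (hcr U hU')]
    exact h U hU' h2 hMj

end Coded

end

end HypReg

namespace HypReg

open Finset LabFam
open scoped BigOperators

attribute [local instance 10] Classical.propDecidable

set_option linter.unusedSectionVars false

noncomputable section

variable {V V' : Type} [DecidableEq V] [DecidableEq V']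

/-- The number of elements of `X` relative to `n ^ j`. -/
def relCard {α : Type} (n j : ℕ) (X : Finset α) : ℝ := (X.card : ℝ) / (n : ℝ) ^ j

/-- The tests of regularity on the second side can be simulated on the first side. -/
def Close (n m j : ℕ) (τ : ℝ) (Cl₁ E₁ : Finset (Finset V)) (Cl₂ E₂ : Finset (Finset V')) : Prop :=
  ∀ G₂ : Finset (Finset V'), ∃ G₁ : Finset (Finset V),
    |relCard n j Cl₁ - relCard m j Cl₂| ≤ τ ∧
    |relCard n j (cliq Cl₁ j G₁) - relCard m j (cliq Cl₂ j G₂)| ≤ τ ∧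
    |relCard n j (E₁ ∩ cliq Cl₁ j G₁) - relCard m j (E₂ ∩ cliq Cl₂ j G₂)| ≤ τ

variable {n m j : ℕ} {τ ε δ d c : ℝ} {Cl₁ E₁ : Finset (Finset V)} {Cl₂ E₂ : Finset (Finset V')}

lemma regAt_iff_relCard (hn : 1 ≤ n) {Cl E : Finset (Finset V)} :
    RegAt Cl E j ε d ↔ ∀ G, ε * relCard n j Cl ≤ relCard n j (cliq Cl j G) →
      |relCard n j (E ∩ cliq Cl j G) - d * relCard n j (cliq Cl j G)| ≤
        ε * relCard n j (cliq Cl j G) := by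
  have hp : (0 : ℝ) < (n : ℝ) ^ j := by positivity
  refine forall_congr' fun G => ?_
  unfold relCard
  rw [← mul_div_assoc, div_le_div_iff_of_pos_right hp, ← mul_div_assoc, ← mul_div_assoc, ← sub_div,
    abs_div, abs_of_pos hp, div_le_div_iff_of_pos_right hp]

lemma Close.regAt (h : Close n m j τ Cl₁ E₁ Cl₂ E₂) (hn : 1 ≤ n) (hm : 1 ≤ m) (hc : 0 < c)
    (hcl : c ≤ relCard n j Cl₁) (hε : 0 < ε) (hε1 : ε ≤ 1) (hδ : 0 < δ)
    (hδ1 : δ ≤ 1) (hd : 0 ≤ d) (hd1 : d ≤ 1) (hτ : τ ≤ δ * ε * c / 8)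
    (hr : RegAt Cl₁ E₁ j ε d) : RegAt Cl₂ E₂ j (ε + δ) d := by
  rw [regAt_iff_relCard hn] at hr
  rw [regAt_iff_relCard hm]
  intro G₂ hG
  obtain ⟨G₁, h1, h2, h3⟩ := h G₂
  set C₁ := relCard n j Cl₁
  set C₂ := relCard m j Cl₂
  set K₁ := relCard n j (cliq Cl₁ j G₁)
  set K₂ := relCard m j (cliq Cl₂ j G₂)
  set X₁ := relCard n j (E₁ ∩ cliq Cl₁ j G₁)
  set X₂ := relCard m j (E₂ ∩ cliq Cl₂ j G₂)
  rw [abs_le] at h1 h2 h3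
  have hδε : 0 < δ * ε := mul_pos hδ hε
  have a1 : δ * ε * c ≤ δ * c := by
    have : δ * ε ≤ δ := mul_le_of_le_one_right hδ.le hε1
    exact mul_le_mul_of_nonneg_right this hc.le
  have a1' : δ * ε * c ≤ ε * c := by
    have : δ * ε ≤ ε := mul_le_of_le_one_left hε.le hδ1
    exact mul_le_mul_of_nonneg_right this hc.le
  have a1'' : ε * c ≤ c := mul_le_of_le_one_left hc.le hε1
  have a2 : δ * c ≤ δ * C₁ := mul_le_mul_of_nonneg_left hcl hδ.le
  have a3 : (ε + δ) * (C₁ - τ) ≤ (ε + δ) * C₂ :=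
    mul_le_mul_of_nonneg_left (by linarith [h1.2]) (by linarith)
  have hτ0 : 0 ≤ τ := by linarith [h1.1, h1.2]
  have a4 : (ε + δ) * τ ≤ 2 * τ := mul_le_mul_of_nonneg_right (by linarith) hτ0
  have e1 : (ε + δ) * (C₁ - τ) = ε * C₁ + δ * C₁ - (ε + δ) * τ := by ring
  have hK : ε * C₁ ≤ K₁ := by linarith [h2.1, h2.2]
  have h4 := hr G₁ hK
  rw [abs_le] at h4 ⊢
  have a5 : ε * K₁ ≤ ε * K₂ + τ := by
    have := mul_le_mul_of_nonneg_left (show K₁ ≤ K₂ + τ by linarith [h2.2]) hε.le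
    have h5 : ε * τ ≤ τ := mul_le_of_le_one_left hτ0 hε1
    linarith [mul_add ε K₂ τ]
  have a6 : d * K₁ ≤ d * K₂ + τ := by
    have := mul_le_mul_of_nonneg_left (show K₁ ≤ K₂ + τ by linarith [h2.2]) hd
    have h5 : d * τ ≤ τ := mul_le_of_le_one_left hτ0 hd1
    linarith [mul_add d K₂ τ]
  have a7 : d * K₂ ≤ d * K₁ + τ := by
    have := mul_le_mul_of_nonneg_left (show K₂ ≤ K₁ + τ by linarith [h2.1]) hd
    have h5 : d * τ ≤ τ := mul_le_of_le_one_left hτ0 hd1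
    linarith [mul_add d K₁ τ]
  have a8 : 3 * τ ≤ δ * K₂ := by
    have b1 : ε * (C₁ - τ) ≤ (ε + δ) * (C₁ - τ) :=
      mul_le_mul_of_nonneg_right (by linarith) (by linarith)
    have b2 : ε * (c - τ) ≤ ε * (C₁ - τ) := mul_le_mul_of_nonneg_left (by linarith) hε.le
    have b3 : ε * (c * (7 / 8)) ≤ ε * (c - τ) := mul_le_mul_of_nonneg_left (by linarith) hε.le
    have b4 := mul_le_mul_of_nonneg_left (show ε * (c * (7 / 8)) ≤ K₂ by linarith) hδ.le
    have e2 : δ * (ε * (c * (7 / 8))) = δ * ε * c * (7 / 8) := by ring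
    have b5 : 0 < δ * ε * c := mul_pos hδε hc
    linarith
  have e3 : (ε + δ) * K₂ = ε * K₂ + δ * K₂ := by ring
  constructor <;> linarith [h3.1, h3.2, h4.1, h4.2]

lemma Close.nonempty (h : Close n m j τ Cl₁ E₁ Cl₂ E₂) (hn : 1 ≤ n) (hc : 0 < c)
    (hcl : c ≤ relCard n j Cl₁) (hε : 0 < ε) (hd : 2 * ε ≤ d) (hd1 : d ≤ 1)
    (hτ : τ ≤ ε * c / 8)
    (hr : RegAt Cl₁ E₁ j ε d) : (E₂ ∩ Cl₂).Nonempty := by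
  rw [regAt_iff_relCard hn] at hr
  obtain ⟨G₁, h1, h2, h3⟩ := h (Cl₂.biUnion fun I => I.powersetCard (j - 1))
  have hcq : cliq Cl₂ j (Cl₂.biUnion fun I => I.powersetCard (j - 1)) = Cl₂ := by
    ext I
    rw [mem_cliq]
    exact ⟨fun h => h.1, fun h => ⟨h, fun T hT => mem_biUnion.2 ⟨I, h, hT⟩⟩⟩
  rw [hcq] at h2 h3
  have hr1 := hr G₁
  by_contra hem
  rw [not_nonempty_iff_eq_empty.1 hem] at h3
  have h0 : relCard m j (∅ : Finset (Finset V')) = 0 := by simp [relCard]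
  rw [h0] at h3
  set C₁ := relCard n j Cl₁
  set C₂ := relCard m j Cl₂
  set K₁ := relCard n j (cliq Cl₁ j G₁)
  set X₁ := relCard n j (E₁ ∩ cliq Cl₁ j G₁)
  rw [abs_le] at h1 h2 h3
  have hεc : 0 < ε * c := mul_pos hε hc
  have a1 : ε * c ≤ c / 2 := by nlinarith
  have hK : c / 2 ≤ K₁ := by linarith [h1.2, h2.1]
  have hK' : C₁ - 2 * τ ≤ K₁ := by linarith [h1.2, h2.1]
  have h4 := hr1 (by nlinarith)
  rw [abs_le] at h4
  have : ε * (c / 2) ≤ ε * K₁ := mul_le_mul_of_nonneg_left hK hε.le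
  have h5 : 2 * ε * K₁ ≤ d * K₁ := mul_le_mul_of_nonneg_right hd (by linarith)
  linarith [h3.2, h4.1]

end

end HypReg

namespace HypReg

open Finset LabFam
open scoped BigOperators

attribute [local instance 10] Classical.propDecidable

set_option linter.unusedSectionVars false

noncomputable section

section

variable {V : Type} [DecidableEq V]

/-- `ix` splits the `n`-set `W` into `r` classes of nearly equal size. -/
structure Equi (W : Finset V) (ix : V → ℕ) (r n : ℕ) : Prop where
  card : W.card = n
  pos : 1 ≤ n
  rng : ∀ v ∈ W, 1 ≤ ix v ∧ ix v ≤ r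
  rpos : 1 ≤ r
  size : ∀ i : Fin r, Fintype.card (VX W ix i) = n / r ∨ Fintype.card (VX W ix i) = n / r + 1
  ne : ∀ i : Fin r, Nonempty (VX W ix i)

lemma Nice.equi {F : LabFam V} {k : ℕ} {a : ℕ → ℕ} {ε : ℝ} {d : Addr → ℝ} {H : Finset (Finset V)}
    (hF : F.Nice k a ε d H) (hk : 2 ≤ k) : Equi F.gnd F.vIdx (a 1) F.gnd.card where
  card := rfl
  pos := by
    obtain ⟨v, hv, -⟩ := hF.lab.idx_surj 1 le_rfl (by have := hF.lab.le_one; omega)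
    exact card_pos.2 ⟨v, hv⟩
  rng := hF.lab.idx_range
  rpos := by have := hF.lab.le_one; omega
  size i := by
    obtain ⟨⟨v, hv⟩⟩ := pt_nonempty_of_idx hF.lab i
    obtain ⟨h1, h2⟩ := mem_filter.1 hv
    rw [Fintype.card_coe, ← h2]
    exact hF.size v h1
  ne i := pt_nonempty_of_idx hF.lab i

/-- The error in comparing densities. -/
def cmpErr (r n m j : ℕ) : ℝ := 2 / r + (1 + 2 ^ r * j) * (1 / n + 1 / m)

lemma relCard_diff {W Z : Finset V} {m j : ℕ} (hW : W.card = m) (hm : 1 ≤ m) (hj : 1 ≤ j)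
    {X X' : Finset (Finset V)} (hX : X ⊆ W.powersetCard j) (hX' : X' ⊆ W.powersetCard j)
    (h : ∀ I ∈ W.powersetCard j, (∀ v ∈ I, v ∉ Z) → (I ∈ X ↔ I ∈ X')) :
    |relCard m j X - relCard m j X'| ≤ (Z.card : ℝ) / m := by
  have hm0 : (0 : ℝ) < m := by exact_mod_cast hm
  set D := (W.powersetCard j).filter fun I => ∃ v ∈ I, v ∈ Z with hD
  have hDc : (D.card : ℝ) ≤ Z.card * (m : ℝ) ^ (j - 1) := by
    rw [← hW]; exact_mod_cast card_touching_le W Z j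
  have key : ∀ {A B : Finset (Finset V)}, A ⊆ W.powersetCard j →
      (∀ I ∈ W.powersetCard j, (∀ v ∈ I, v ∉ Z) → (I ∈ A → I ∈ B)) →
      (A.card : ℝ) ≤ B.card + D.card := by
    intro A B hA hAB
    have : A ⊆ B ∪ D := by
      intro I hI
      by_cases hZ : ∃ v ∈ I, v ∈ Z
      · exact mem_union_right _ (by simp only [hD, mem_filter]; exact ⟨hA hI, hZ⟩)
      · push Not at hZ
        exact mem_union_left _ (hAB I (hA hI) hZ hI)
    exact_mod_cast (card_le_card this).trans (card_union_le _ _)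
  have h1 := key hX fun I hI hZ => (h I hI hZ).1
  have h2 := key hX' fun I hI hZ => (h I hI hZ).2
  unfold relCard
  rw [← sub_div, abs_div, abs_of_pos (show (0 : ℝ) < (m : ℝ) ^ j by positivity),
    div_le_div_iff₀ (by positivity) hm0]
  have e : (m : ℝ) ^ j = m ^ (j - 1) * m := by rw [← pow_succ]; congr 1; omega
  rw [e, ← mul_assoc]
  refine mul_le_mul_of_nonneg_right ?_ hm0.le
  rw [abs_le]
  constructor <;> linarith

end

section Compare

variable {V V' : Type} [DecidableEq V] [DecidableEq V'] {W : Finset V} {ix : V → ℕ}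
  {W' : Finset V'} {ix' : V' → ℕ} {r n m : ℕ}

lemma relCard_compare (h₁ : Equi W ix r n) (h₂ : Equi W' ix' r m) {j : ℕ} (hj : 1 ≤ j)
    {X : Finset (Finset V)} (hX : X ⊆ W.powersetCard j) {X' : Finset (Finset V')}
    (hX' : X' ⊆ W'.powersetCard j) {κ : Type} {c : (∀ i : Fin r, VX W ix i) → Finset (Fin r) → κ}
    {c' : (∀ i : Fin r, VX W' ix' i) → Finset (Fin r) → κ}
    (R : Finset (Fin r) → (Finset (Fin r) → κ) → Prop)
    (hR : ∀ S x, S.card = j → (pt S x ∈ X ↔ R S (c x)))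
    (hR' : ∀ S x, S.card = j → (pt S x ∈ X' ↔ R S (c' x))) {η : ℝ} (hη : 0 ≤ η)
    (htr : ∀ Φ : (Finset (Fin r) → κ) → ℝ, (∀ p, |Φ p| ≤ 1) →
      |(𝔼 x, Φ (c x)) - 𝔼 y, Φ (c' y)| ≤ η) :
    |relCard n j X - relCard m j X'| ≤ η + cmpErr r n m j := by
  have := h₁.ne
  have := h₂.ne
  have h := dens_compare h₁.card h₂.card h₁.pos h₂.pos h₁.rng h₂.rng h₁.rpos h₁.size h₂.size hj
    (fun I => I ∈ X) (fun I => I ∈ X') hη fun S hS => by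
      have h1 : ∀ x, ind (pt S x ∈ X) = ind (R S (c x)) := fun x => ind_congr (hR S x hS)
      have h2 : ∀ x, ind (pt S x ∈ X') = ind (R S (c' x)) := fun x => ind_congr (hR' S x hS)
      simp only [h1, h2]
      exact htr (fun p => ind (R S p)) fun p => by
        rw [abs_of_nonneg (ind_nonneg _)]; exact ind_le_one _
  unfold relCard cmpErr
  convert h using 5
  · congr 1; ext I; simp only [mem_filter]; exact ⟨fun h => ⟨hX h, h⟩, fun h => h.2⟩
  · congr 1; ext I; simp only [mem_filter]; exact ⟨fun h => ⟨hX' h, h⟩, fun h => h.2⟩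

lemma pt_inj {S S' : Finset (Fin r)} {x x' : ∀ i : Fin r, VX W ix i} (h : pt S x = pt S' x') :
    S = S' := by
  apply up_injective
  rw [← image_pt (x := x), h, image_pt]

lemma ClA_subset_powersetCard {F : LabFam V} (hF : F.IdxOK) {j : ℕ} {y : Addr} :
    F.ClA j y ⊆ F.gnd.powersetCard j := by
  intro I hI
  obtain ⟨h1, h2, -⟩ := (mem_cross hF).1 (mem_ClA.1 hI).1
  exact mem_powersetCard.2 ⟨h1, h2⟩

/-- Transfer of colours gives closeness of address classes. -/
lemma close_of_transfer (h₁ : Equi W ix r n) (h₂ : Equi W' ix' r m) {k j N : ℕ} (hj : 1 ≤ j)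
    (hjk : j ≤ k) {κ : Type}
    {BX : (∀ i : Fin r, VX W ix i) → Finset (Fin r) → κ}
    {BY : (∀ i : Fin r, VX W' ix' i) → Finset (Fin r) → κ}
    {OX : (∀ i : Fin r, VX W ix i) → Finset (Fin r) → Fin N}
    {OY : (∀ i : Fin r, VX W' ix' i) → Finset (Fin r) → Fin N} {η : ℝ} (hη : 0 ≤ η)
    (htr : ∀ FY : (∀ i : Fin r, VX W' ix' i) → Finset (Fin r) → Bool, IsDep FY →
      ∃ FX : (∀ i : Fin r, VX W ix i) → Finset (Fin r) → Bool, IsDep FX ∧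
      ∀ Φ : (Finset (Fin r) → κ × Fin N × Bool) → ℝ, (∀ p, |Φ p| ≤ 1) →
      |(𝔼 x, Φ fun S => (BX x S, OX x S, FX x S)) -
        𝔼 y, Φ fun S => (BY y S, OY y S, FY y S)| ≤ η)
    {F : LabFam V} {F' : LabFam V'} (hF : F.IdxOK) (hF' : F'.IdxOK) (hW : F.gnd = W)
    (hW' : F'.gnd = W') (hc : Coded F ix k OX) (hc' : Coded F' ix' k OY) {y : Addr}
    (hy : Supp (j - 1) y) {E : Finset (Finset V)} {E' : Finset (Finset V')}
    (e : Finset (Fin r) → (Finset (Fin r) → κ × Fin N) → Prop)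
    (hE : ∀ S x, S.card = j → pt S x ∈ F.ClA j y →
      (pt S x ∈ E ↔ e S fun U => (BX x U, OX x U)))
    (hE' : ∀ S x, S.card = j → pt S x ∈ F'.ClA j y →
      (pt S x ∈ E' ↔ e S fun U => (BY x U, OY x U))) :
    Close n m j (η + cmpErr r n m j) (F.ClA j y) E (F'.ClA j y) E' := by
  intro G'
  obtain ⟨FX, hFX, hΦ⟩ := htr (fun x U => decide (pt U x ∈ G')) fun S x x' h => by
    have : pt S x = pt S x' := pt_congr h
    simp only [this]
  set G : Finset (Finset V) := W.powerset.filter fun I => ∃ U, ∃ x : ∀ i : Fin r, VX W ix i,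
    I = pt U x ∧ FX x U = true with hG
  have hGm : ∀ U x, pt U x ∈ G ↔ FX x U = true := by
    intro U x
    simp only [hG, mem_filter, mem_powerset]
    constructor
    · rintro ⟨-, U', x', h1, h2⟩
      obtain rfl := pt_inj h1
      have := hFX U (pt_eq_iff.1 h1)
      simp only at this
      rw [this, h2]
    · intro h; exact ⟨pt_subset, U, x, rfl, h⟩
  set c : (∀ i : Fin r, VX W ix i) → Finset (Fin r) → κ × Fin N × Bool :=
    fun x S => (BX x S, OX x S, FX x S) with hcdef
  set c' : (∀ i : Fin r, VX W' ix' i) → Finset (Fin r) → κ × Fin N × Bool :=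
    fun x S => (BY x S, OY x S, decide (pt S x ∈ G')) with hcdef'
  have hsub : F.ClA j y ⊆ W.powersetCard j := hW ▸ ClA_subset_powersetCard hF
  have hsub' : F'.ClA j y ⊆ W'.powersetCard j := hW' ▸ ClA_subset_powersetCard hF'
  have hq : cliq (F.ClA j y) j G ⊆ F.ClA j y := fun I hI => (mem_cliq.1 hI).1
  have hq' : cliq (F'.ClA j y) j G' ⊆ F'.ClA j y := fun I hI => (mem_cliq.1 hI).1
  set R₁ : Finset (Fin r) → (Finset (Fin r) → κ × Fin N × Bool) → Prop :=
    fun S p => PatOK S j y fun U => (p U).2.1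
  set R₂ : Finset (Fin r) → (Finset (Fin r) → κ × Fin N × Bool) → Prop :=
    fun S p => R₁ S p ∧ ∀ T ∈ S.powersetCard (j - 1), (p T).2.2 = true
  set R₃ : Finset (Fin r) → (Finset (Fin r) → κ × Fin N × Bool) → Prop :=
    fun S p => e S (fun U => ((p U).1, (p U).2.1)) ∧ R₂ S p
  have h11 : ∀ S x, S.card = j → (pt S x ∈ F.ClA j y ↔ R₁ S (c x)) := fun S x _ =>
    hc.mem_ClA_iff hF hW hjk hy S x
  have h12 : ∀ S x, S.card = j → (pt S x ∈ F'.ClA j y ↔ R₁ S (c' x)) := fun S x _ =>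
    hc'.mem_ClA_iff hF' hW' hjk hy S x
  have h21 : ∀ S x, S.card = j → (pt S x ∈ cliq (F.ClA j y) j G ↔ R₂ S (c x)) := by
    intro S x hS
    rw [mem_cliq, h11 S x hS]
    refine and_congr_right fun _ => ?_
    constructor
    · intro h T hT
      exact (hGm T x).1 (h _ (mem_powersetCard_pt.2 ⟨T, hT, rfl⟩))
    · intro h T hT
      obtain ⟨U, hU, rfl⟩ := mem_powersetCard_pt.1 hT
      exact (hGm U x).2 (h U hU)
  have h22 : ∀ S x, S.card = j → (pt S x ∈ cliq (F'.ClA j y) j G' ↔ R₂ S (c' x)) := by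
    intro S x hS
    rw [mem_cliq, h12 S x hS]
    refine and_congr_right fun _ => ?_
    constructor
    · intro h T hT
      exact decide_eq_true (h _ (mem_powersetCard_pt.2 ⟨T, hT, rfl⟩))
    · intro h T hT
      obtain ⟨U, hU, rfl⟩ := mem_powersetCard_pt.1 hT
      exact of_decide_eq_true (h U hU)
  have h31 : ∀ S x, S.card = j → (pt S x ∈ E ∩ cliq (F.ClA j y) j G ↔ R₃ S (c x)) := by
    intro S x hS
    rw [mem_inter]
    constructor
    · rintro ⟨h3, h4⟩; exact ⟨(hE S x hS (hq h4)).1 h3, (h21 S x hS).1 h4⟩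
    · rintro ⟨h3, h4⟩
      have h5 := (h21 S x hS).2 h4
      exact ⟨(hE S x hS (hq h5)).2 h3, h5⟩
  have h32 : ∀ S x, S.card = j → (pt S x ∈ E' ∩ cliq (F'.ClA j y) j G' ↔ R₃ S (c' x)) := by
    intro S x hS
    rw [mem_inter]
    constructor
    · rintro ⟨h3, h4⟩; exact ⟨(hE' S x hS (hq' h4)).1 h3, (h22 S x hS).1 h4⟩
    · rintro ⟨h3, h4⟩
      have h5 := (h22 S x hS).2 h4
      exact ⟨(hE' S x hS (hq' h5)).2 h3, h5⟩
  exact ⟨G, relCard_compare h₁ h₂ hj hsub hsub' R₁ h11 h12 hη hΦ,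
    relCard_compare h₁ h₂ hj (hq.trans hsub) (hq'.trans hsub') R₂ h21 h22 hη hΦ,
    relCard_compare h₁ h₂ hj (inter_subset_right.trans (hq.trans hsub))
      (inter_subset_right.trans (hq'.trans hsub')) R₃ h31 h32 hη hΦ⟩

/-- Closeness is not affected much by changes at few vertices. -/
lemma Close.change {j : ℕ} {τ : ℝ} {Cl E : Finset (Finset V)} {Cl₁ E₁ Cl₂ E₂ : Finset (Finset V')}
    (h : Close n m j τ Cl E Cl₁ E₁) {Z : Finset V'} (hW : W'.card = m) (hm : 1 ≤ m) (hj : 1 ≤ j)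
    (hs₁ : Cl₁ ⊆ W'.powersetCard j) (hs₂ : Cl₂ ⊆ W'.powersetCard j)
    (hZ : ∀ I ∈ W'.powersetCard j, (∀ v ∈ I, v ∉ Z) → (I ∈ Cl₁ ↔ I ∈ Cl₂))
    (hE : ∀ I ∈ Cl₁, I ∈ Cl₂ → (I ∈ E₁ ↔ I ∈ E₂)) :
    Close n m j (τ + Z.card / m) Cl E Cl₂ E₂ := by
  intro G'
  obtain ⟨G, h1, h2, h3⟩ := h G'
  have hq₁ : cliq Cl₁ j G' ⊆ Cl₁ := fun I hI => (mem_cliq.1 hI).1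
  have hq₂ : cliq Cl₂ j G' ⊆ Cl₂ := fun I hI => (mem_cliq.1 hI).1
  have d1 := relCard_diff hW hm hj hs₁ hs₂ hZ
  have d2 := relCard_diff (Z := Z) hW hm hj (hq₁.trans hs₁) (hq₂.trans hs₂) fun I hI hIZ => by
    rw [mem_cliq, mem_cliq, hZ I hI hIZ]
  have d3 := relCard_diff (Z := Z) hW hm hj
    ((inter_subset_right (s₁ := E₁)).trans (hq₁.trans hs₁))
    ((inter_subset_right (s₁ := E₂)).trans (hq₂.trans hs₂)) fun I hI hIZ => by
      rw [mem_inter, mem_inter, mem_cliq, mem_cliq]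
      have := hZ I hI hIZ
      constructor
      · rintro ⟨a1, a2, a3⟩; exact ⟨(hE I a2 (this.1 a2)).1 a1, this.1 a2, a3⟩
      · rintro ⟨a1, a2, a3⟩; exact ⟨(hE I (this.2 a2) a2).2 a1, this.2 a2, a3⟩
  rw [abs_le] at d1 d2 d3 h1 h2 h3
  refine ⟨G, ?_, ?_, ?_⟩ <;> rw [abs_le] <;> constructor <;>
    linarith [h1.1, h1.2, h2.1, h2.2, h3.1, h3.2, d1.1, d1.2, d2.1, d2.2, d3.1, d3.2]

end Compare

section Codes

variable {V : Type} [DecidableEq V] {k r A : ℕ} {a : ℕ → ℕ}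

/-- The label of a set of vertices. -/
def code (O : LabFam V) (k : ℕ) (L : Finset V) : ℕ :=
  if 2 ≤ L.card ∧ L.card ≤ k - 1 ∧ L ∈ O.toPartFam.cross L.card then O.lbl L.card L
  else if L.card = 1 then L.sup O.vIdx else 1

lemma code_range {O : LabFam V} (hO : O.LabOK k a) (ha : ∀ i, 1 ≤ i → i ≤ k - 1 → 1 ≤ a i)
    {L : Finset V} (hL : L ⊆ O.gnd) (h1 : 1 ≤ L.card) (h2 : L.card ≤ k - 1) :
    1 ≤ code O k L ∧ code O k L ≤ a L.card := by
  unfold code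
  split_ifs with h3 h4
  · exact hO.lbl_range _ h3.1 h3.2.1 _ h3.2.2
  · obtain ⟨v, rfl⟩ := card_eq_one.1 h4
    rw [sup_singleton, card_singleton]
    exact hO.idx_range v (hL (mem_singleton_self v))
  · exact ⟨le_rfl, ha _ h1 h2⟩

variable (r A) in
/-- The colouring of partite sets by the labels of `O`. -/
def codeCol (O : LabFam V) (k : ℕ) {W : Finset V} {ix : V → ℕ}
    (x : ∀ i : Fin r, VX W ix i) (U : Finset (Fin r)) : Fin (A + 2) :=
  if 1 ≤ U.card ∧ U.card ≤ k - 1 then Fin.ofNat (A + 2) (code O k (pt U x)) else 1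

lemma codeCol_isDep (O : LabFam V) (k : ℕ) {W : Finset V} {ix : V → ℕ} :
    IsDep (codeCol r A O k (W := W) (ix := ix)) := by
  intro S x x' h
  have : pt S x = pt S x' := pt_congr h
  simp only [codeCol, this]

lemma codeCol_val {O : LabFam V} (hO : O.LabOK k a)
    (ha : ∀ i, 1 ≤ i → i ≤ k - 1 → 1 ≤ a i ∧ a i ≤ A) {W : Finset V}
    (hW : O.gnd = W) {ix : V → ℕ} (x : ∀ i : Fin r, VX W ix i) {U : Finset (Fin r)} (h1 : 1 ≤ U.card) (h2 : U.card ≤ k - 1) :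
    (codeCol r A O k x U : ℕ) = code O k (pt U x) := by
  have h3 := (code_range hO (fun i h h' => (ha i h h').1) (pt_subset.trans hW.superset : pt U x ⊆ O.gnd)
    (by rwa [card_pt]) (by rwa [card_pt])).2
  rw [card_pt] at h3
  have h4 := (ha _ h1 h2).2
  rw [codeCol, if_pos ⟨h1, h2⟩]
  exact Nat.mod_eq_of_lt (by omega)

lemma codeCol_coded {O : LabFam V} (hO : O.LabOK k a) (hk : 2 ≤ k)
    (ha : ∀ i, 1 ≤ i → i ≤ k - 1 → 1 ≤ a i ∧ a i ≤ A) {W : Finset V}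
    (hW : O.gnd = W) (ix : V → ℕ) : Coded O ix k (codeCol r A O k (W := W)) where
  idx x i := by
    rw [codeCol_val hO ha hW x (by simp) (by simp; omega)]
    simp [code, pt]
  lbl x U h2 hU hc := by
    rw [codeCol_val hO ha hW x (by omega) hU, code, card_pt, if_pos ⟨h2, hU, hc⟩]

variable {W : Finset V} {ix : V → ℕ} {N : ℕ}

/-- The function on sets induced by a colouring of partite sets. -/
def decode (c : (∀ i : Fin r, VX W ix i) → Finset (Fin r) → Fin N) (L : Finset V) : ℕ :=
  if h : ∃ p : (∀ i : Fin r, VX W ix i) × Finset (Fin r), L = pt p.2 p.1 then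
    (c h.choose.1 h.choose.2 : ℕ) else 1

lemma decode_pt {c : (∀ i : Fin r, VX W ix i) → Finset (Fin r) → Fin N} (hc : IsDep c)
    (x : ∀ i : Fin r, VX W ix i) (U : Finset (Fin r)) : decode c (pt U x) = c x U := by
  have h : ∃ p : (∀ i : Fin r, VX W ix i) × Finset (Fin r), pt U x = pt p.2 p.1 := ⟨(x, U), rfl⟩
  rw [decode, dif_pos h]
  have h1 := h.choose_spec
  have h2 := pt_inj h1
  rw [← h2] at h1 ⊢
  exact congrArg Fin.val (hc U (pt_eq_iff.1 h1)).symm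

lemma decode_range {c : (∀ i : Fin r, VX W ix i) → Finset (Fin r) → Fin N} {s : ℕ}
    (hs : 1 ≤ s) {L : Finset V}
    (h : ∀ x U, U.card = L.card → 1 ≤ (c x U : ℕ) ∧ (c x U : ℕ) ≤ s) :
    1 ≤ decode c L ∧ decode c L ≤ s := by
  unfold decode
  split_ifs with hL
  · refine h _ _ ?_
    conv_rhs => rw [hL.choose_spec, card_pt]
  · exact ⟨le_rfl, hs⟩

lemma decode_coded {c : (∀ i : Fin r, VX W ix i) → Finset (Fin r) → Fin N} (hc : IsDep c) :
    Coded (mkFam W (fun v => decode c {v}) (decode c)) ix k c where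
  idx x i := by
    have : pt {i} x = {(x i : V)} := by simp [pt]
    change decode c {(x i : V)} = c x {i}
    rw [← this, decode_pt hc]
  lbl x U _ _ _ := decode_pt hc x U

end Codes

end

end HypReg

namespace HypReg

open Finset LabFam
open scoped BigOperators

attribute [local instance 10] Classical.propDecidable

set_option linter.unusedSectionVars false

noncomputable section

section

variable {V V' : Type} [DecidableEq V] [DecidableEq V'] {W : Finset V} {ix : V → ℕ}
  {W' : Finset V'} {ix' : V' → ℕ} {r n m : ℕ}

lemma cmpErr_mono {i j : ℕ} (h : i ≤ j) : cmpErr r n m i ≤ cmpErr r n m j := by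
  unfold cmpErr
  have : (i : ℝ) ≤ j := by exact_mod_cast h
  gcongr

lemma cmpErr_nonneg (j : ℕ) : 0 ≤ cmpErr r n m j := by unfold cmpErr; positivity

lemma mem_sing_pt {U : Finset V} {S : Finset (Fin r)} {x : ∀ i : Fin r, VX W ix i}
    (hS : S.card = 1) : pt S x ∈ sing U ↔ ∀ i ∈ S, (x i : V) ∈ U := by
  obtain ⟨i, rfl⟩ := card_eq_one.1 hS
  have h1 : pt {i} x = {(x i : V)} := by simp [pt]
  rw [h1, mem_sing]
  simp only [singleton_inj, exists_eq_right, mem_singleton, forall_eq]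

lemma card_sing (U : Finset V) : (sing U).card = U.card :=
  card_image_of_injective _ singleton_injective

lemma sing_subset_powersetCard {U : Finset V} (h : U ⊆ W) : sing U ⊆ W.powersetCard 1 := by
  intro I hI
  obtain ⟨v, hv, rfl⟩ := mem_sing.1 hI
  exact mem_powersetCard.2 ⟨singleton_subset_iff.2 (h hv), card_singleton v⟩

lemma Close.mono {j : ℕ} {τ τ' : ℝ} {Cl E : Finset (Finset V)} {Cl' E' : Finset (Finset V')}
    (h : Close n m j τ Cl E Cl' E') (hτ : τ ≤ τ') : Close n m j τ' Cl E Cl' E' := fun G =>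
  let ⟨G', h1, h2, h3⟩ := h G
  ⟨G', h1.trans hτ, h2.trans hτ, h3.trans hτ⟩

lemma fiber_le (h₁ : Equi W ix r n) (h₂ : Equi W' ix' r m) {k N : ℕ} {κ : Type}
    {BX : (∀ i : Fin r, VX W ix i) → Finset (Fin r) → κ}
    {BY : (∀ i : Fin r, VX W' ix' i) → Finset (Fin r) → κ}
    {OX : (∀ i : Fin r, VX W ix i) → Finset (Fin r) → Fin N}
    {OY : (∀ i : Fin r, VX W' ix' i) → Finset (Fin r) → Fin N} {η : ℝ} (hη : 0 ≤ η)
    (htr : ∀ FY : (∀ i : Fin r, VX W' ix' i) → Finset (Fin r) → Bool, IsDep FY →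
      ∃ FX : (∀ i : Fin r, VX W ix i) → Finset (Fin r) → Bool, IsDep FX ∧
      ∀ Φ : (Finset (Fin r) → κ × Fin N × Bool) → ℝ, (∀ p, |Φ p| ≤ 1) →
      |(𝔼 x, Φ fun S => (BX x S, OX x S, FX x S)) -
        𝔼 y, Φ fun S => (BY y S, OY y S, FY y S)| ≤ η)
    {F : LabFam V} {F' : LabFam V'} (hc : Coded F ix k OX) (hc' : Coded F' ix' k OY) {a b : ℕ}
    (ha : 1 ≤ a) (hb : (W.filter fun v => F.vIdx v = b).card ≤ n / a + 1) :
    (W'.filter fun v => F'.vIdx v = b).card ≤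
      m / a + (⌈(m : ℝ) * (1 / n + (η + cmpErr r n m 1))⌉₊ + 1) := by
  obtain ⟨FX, -, hΦ⟩ := htr (fun _ _ => true) fun S x x' h => rfl
  have key := relCard_compare h₁ h₂ le_rfl
    (sing_subset_powersetCard (filter_subset (fun v => F.vIdx v = b) W))
    (sing_subset_powersetCard (filter_subset (fun v => F'.vIdx v = b) W'))
    (c := fun x S => (BX x S, OX x S, FX x S)) (c' := fun x S => (BY x S, OY x S, true))
    (fun S p => ∀ i ∈ S, ((p {i}).2.1 : ℕ) = b)
    (fun S x hS => by
      rw [mem_sing_pt hS]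
      refine forall₂_congr fun i _ => ?_
      rw [mem_filter, hc.idx x i]
      exact and_iff_right (mem_filter.1 (x i).2).1)
    (fun S x hS => by
      rw [mem_sing_pt hS]
      refine forall₂_congr fun i _ => ?_
      rw [mem_filter, hc'.idx x i]
      exact and_iff_right (mem_filter.1 (x i).2).1) hη hΦ
  have hn0 : (0 : ℝ) < n := by exact_mod_cast h₁.pos
  have hm0 : (0 : ℝ) < m := by exact_mod_cast h₂.pos
  have ha0 : (0 : ℝ) < a := by exact_mod_cast ha
  unfold relCard at key
  rw [card_sing, card_sing, pow_one, pow_one, abs_le] at key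
  set e := η + cmpErr r n m 1
  have h1 : ((W.filter fun v => F.vIdx v = b).card : ℝ) / n ≤ 1 / a + 1 / n := by
    have h2 : ((W.filter fun v => F.vIdx v = b).card : ℝ) ≤ (n : ℝ) / a + 1 := by
      have h3 : ((n / a : ℕ) : ℝ) ≤ (n : ℝ) / a := Nat.cast_div_le
      have h4 : ((W.filter fun v => F.vIdx v = b).card : ℝ) ≤ ((n / a : ℕ) : ℝ) + 1 := by
        exact_mod_cast hb
      linarith
    rw [div_le_iff₀ hn0]
    refine h2.trans (le_of_eq ?_)
    field_simp
  have h5 : ((W'.filter fun v => F'.vIdx v = b).card : ℝ) / m ≤ 1 / a + (1 / n + e) := by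
    linarith [key.1]
  rw [div_le_iff₀ hm0] at h5
  have h6 : (m : ℝ) / a ≤ ((m / a : ℕ) : ℝ) + 1 := by
    rw [div_le_iff₀ ha0]
    have := Nat.lt_div_mul_add (a := m) (b := a) (by omega)
    have h7 : m ≤ (m / a + 1) * a := by rw [add_mul, one_mul]; omega
    exact_mod_cast h7
  have h8 := Nat.le_ceil ((m : ℝ) * (1 / n + e))
  have h9 : (1 / (a : ℝ) + (1 / n + e)) * m = m / a + m * (1 / n + e) := by ring
  have : ((W'.filter fun v => F'.vIdx v = b).card : ℝ) ≤
      ((m / a + (⌈(m : ℝ) * (1 / n + e)⌉₊ + 1) : ℕ) : ℝ) := by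
    push_cast; linarith
  exact_mod_cast this

lemma exists_nice_of_transfer {O : LabFam V} (hW : O.gnd = W) (h₁ : Equi W ix r n) (h₂ : Equi W' ix' r m)
    {k A : ℕ} {κ : Type}
    {BX : (∀ i : Fin r, VX W ix i) → Finset (Fin r) → κ}
    {BY : (∀ i : Fin r, VX W' ix' i) → Finset (Fin r) → κ}
    {OY : (∀ i : Fin r, VX W' ix' i) → Finset (Fin r) → Fin (A + 2)} {η : ℝ} (hη : 0 ≤ η)
    (hOY : IsDep OY) (hOX : ∀ y S, ∃ x : ∀ i : Fin r, VX W ix i, OY y S = codeCol r A O k x S)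
    (htr : ∀ FY : (∀ i : Fin r, VX W' ix' i) → Finset (Fin r) → Bool, IsDep FY →
      ∃ FX : (∀ i : Fin r, VX W ix i) → Finset (Fin r) → Bool, IsDep FX ∧
      ∀ Φ : (Finset (Fin r) → κ × Fin (A + 2) × Bool) → ℝ, (∀ p, |Φ p| ≤ 1) →
      |(𝔼 x, Φ fun S => (BX x S, codeCol r A O k x S, FX x S)) -
        𝔼 y, Φ fun S => (BY y S, OY y S, FY y S)| ≤ η)
    {H : Finset (Finset V)} {H' : Finset (Finset V')}
    (eH : Finset (Fin r) → (Finset (Fin r) → κ) → Prop)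
    (hH : ∀ S x, S.card = k → (pt S x ∈ H ↔ eH S (BX x)))
    (hH' : ∀ S x, S.card = k → (pt S x ∈ H' ↔ eH S (BY x)))
    {a : ℕ → ℕ} {ε₀ δ c : ℝ} {d : Addr → ℝ} (hk : 2 ≤ k) (hO : O.Nice k a ε₀ d H)
    (ha : ∀ i, 1 ≤ i → i ≤ k - 1 → 1 ≤ a i ∧ a i ≤ A) (hd : DensityFun k a d)
    (hε₀ : 0 < ε₀) (hε₁ : ε₀ ≤ 1) (hδ : 0 < δ) (hδ1 : δ ≤ 1)
    (ha2 : ∀ j, 2 ≤ j → j ≤ k - 1 → 2 * ε₀ ≤ 1 / (a j : ℝ)) (hc : 0 < c)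
    (hlow : ∀ j, 2 ≤ j → j ≤ k → ∀ y, IsAddress j (j - 1) a y → c ≤ relCard n j (O.ClA j y))
    (hmA : A ≤ m)
    (herr : (η + cmpErr r n m k) + A * (1 / n + (η + cmpErr r n m k) + 2 / m) ≤ δ * ε₀ * c / 8) :
    ∃ O' : LabFam V', O'.gnd = W' ∧ O'.Nice k a (ε₀ + δ) d H' := by
  have ha1 := ha 1 le_rfl (by omega)
  have hn0 : (0 : ℝ) < n := by exact_mod_cast h₁.pos
  have hm0 : (0 : ℝ) < m := by exact_mod_cast h₂.pos
  set L : Finset V' → ℕ := decode OY with hL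
  set f : V' → ℕ := fun v => L {v} with hf
  have hrange : ∀ {I : Finset V'}, 1 ≤ I.card → I.card ≤ k - 1 → 1 ≤ L I ∧ L I ≤ a I.card := by
    intro I h1 h2
    refine decode_range (ha _ h1 h2).1 fun y U hU => ?_
    obtain ⟨x, hx⟩ := hOX y U
    rw [hx, codeCol_val hO.lab ha hW x (by omega) (by omega), ← hU]
    have h3 := code_range hO.lab (fun i h h' => (ha i h h').1) (pt_subset.trans hW.superset : pt U x ⊆ O.gnd)
      (by rw [card_pt]; omega) (by rw [card_pt]; omega)
    rwa [card_pt] at h3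
  set e := η + cmpErr r n m k with he
  set q : ℕ := ⌈(m : ℝ) * (1 / n + (η + cmpErr r n m 1))⌉₊ + 1 with hq
  have hcod : Coded O ix k (codeCol r A O k) := codeCol_coded hO.lab hk ha hW ix
  have hcod' : Coded (mkFam W' f L) ix' k OY := decode_coded hOY
  have hfib : ∀ b ∈ Icc 1 (a 1), (W'.filter fun v => f v = b).card ≤ W'.card / a 1 + q := by
    intro b hb
    rw [h₂.card]
    refine fiber_le h₁ h₂ hη htr hcod hcod' ha1.1 ?_
    obtain ⟨h1, h2⟩ := mem_Icc.1 hb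
    obtain ⟨v, hv, rfl⟩ := hO.lab.idx_surj b h1 h2
    have := hO.size v hv
    rw [hW, h₁.card] at this
    omega
  obtain ⟨g, hg1, hg2, hg3⟩ := exists_balanced W' (a 1) ha1.1 f
    (fun v _ => by
      have := hrange (I := {v}) (by simp) (by rw [card_singleton]; omega)
      rwa [card_singleton] at this) q hfib
  set Z := W'.filter fun v => f v ≠ g v with hZ
  have hZm : (Z.card : ℝ) / m ≤ A * (1 / n + e + 2 / m) := by
    rw [div_le_iff₀ hm0]
    have h1 : (Z.card : ℝ) ≤ A * q := by
      have : Z.card ≤ A * q := hg3.trans (Nat.mul_le_mul_right _ ha1.2)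
      exact_mod_cast this
    have h2 : (q : ℝ) ≤ m * (1 / n + e) + 2 := by
      have h3 : (0 : ℝ) ≤ m * (1 / n + (η + cmpErr r n m 1)) := by
        have := cmpErr_nonneg (r := r) (n := n) (m := m) 1
        positivity
      have h4 := (Nat.ceil_lt_add_one h3).le
      have h5 : (m : ℝ) * (1 / n + (η + cmpErr r n m 1)) ≤ m * (1 / n + e) := by
        have := cmpErr_mono (r := r) (n := n) (m := m) (show 1 ≤ k by omega)
        have h6 : η + cmpErr r n m 1 ≤ e := by rw [he]; linarith
        gcongr
      rw [hq]; push_cast; linarith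
    have h6 : (A : ℝ) * (1 / n + e + 2 / m) * m = A * (m * (1 / n + e) + 2) := by
      field_simp
    rw [h6]
    exact h1.trans (by gcongr)
  set O' : LabFam V' := mkFam W' g L with hO'
  have hgW : O'.gnd = W' := rfl
  have hidx' : O'.IdxOK := mkFam_idxOK
  have hidxF : (mkFam W' f L).IdxOK := mkFam_idxOK
  have hidx : O.IdxOK := hO.lab.canon.idx
  have hclose : ∀ j, 2 ≤ j → j ≤ k → ∀ y, Supp (j - 1) y → ∀ (E : Finset (Finset V))
      (EF E' : Finset (Finset V')) (ev : Finset (Fin r) → (Finset (Fin r) → κ × Fin (A + 2)) → Prop),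
      (∀ S x, S.card = j → pt S x ∈ O.ClA j y →
        (pt S x ∈ E ↔ ev S fun U => (BX x U, codeCol r A O k x U))) →
      (∀ S x, S.card = j → pt S x ∈ (mkFam W' f L).ClA j y →
        (pt S x ∈ EF ↔ ev S fun U => (BY x U, OY x U))) →
      (∀ I ∈ (mkFam W' f L).ClA j y, I ∈ O'.ClA j y → (I ∈ EF ↔ I ∈ E')) →
      Close n m j (δ * ε₀ * c / 8) (O.ClA j y) E (O'.ClA j y) E' := by
    intro j h2 hjk y hy E EF E' ev hE hEF hE'
    have h1 := close_of_transfer h₁ h₂ (by omega : 1 ≤ j) hjk hη htr hidx hidxF hW rfl hcod hcod'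
      hy ev hE hEF
    have h3 := h1.change (Z := Z) h₂.card h₂.pos (by omega : 1 ≤ j)
      (ClA_subset_powersetCard hidxF) (ClA_subset_powersetCard hidx')
      (fun I hI hIZ => mem_ClA_mkFam_congr fun v hv => by
        have h4 := hIZ v hv
        simp only [hZ, mem_filter, not_and, not_not] at h4
        exact h4 ((mem_powersetCard.1 hI).1 hv)) hE'
    refine h3.mono ?_
    have := cmpErr_mono (r := r) (n := n) (m := m) hjk
    linarith
  have hlowclose : ∀ j, 2 ≤ j → j ≤ k - 1 → ∀ y, Supp (j - 1) y → ∀ b,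
      Close n m j (δ * ε₀ * c / 8) (O.ClA j y) (O.lblSet j b) (O'.ClA j y) (O'.lblSet j b) := by
    intro j h2 hjk y hy b
    refine hclose j h2 (by omega) y hy _ ((mkFam W' f L).lblSet j b) _
      (fun S p => ((p S).2 : ℕ) = b) ?_ ?_ ?_
    · intro S x hS hx
      have hx' := (mem_ClA.1 hx).1
      subst hS
      rw [lblSet, mem_filter, and_iff_right hx', hcod.lbl x S h2 hjk hx']
    · intro S x hS hx
      have hx' := (mem_ClA.1 hx).1
      subst hS
      rw [lblSet, mem_filter, and_iff_right hx', hcod'.lbl x S h2 hjk hx']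
    · intro I hI hI'
      rw [lblSet, lblSet, mem_filter, mem_filter, and_iff_right (mem_ClA.1 hI).1,
        and_iff_right (mem_ClA.1 hI').1]
      rfl
  have hlblr : ∀ j, 2 ≤ j → j ≤ k - 1 → ∀ I ∈ O'.toPartFam.cross j,
      1 ≤ O'.lbl j I ∧ O'.lbl j I ≤ a j := by
    intro j h2 hjk I hI
    have hc1 := ((mem_cross hidx').1 hI).2.1
    subst hc1
    exact hrange (by omega) hjk
  have hreg : ∀ j, 2 ≤ j → j ≤ k - 1 → ∀ y, IsAddress j (j - 1) a y → ∀ b, 1 ≤ b → b ≤ a j →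
      RegAt (O.ClA j y) (O.lblSet j b) j ε₀ (1 / (a j : ℝ)) := by
    intro j h2 hjk y hy b hb hb'
    have h3 : (O.ClA j y).Nonempty := by
      rw [nonempty_iff_ne_empty]
      intro h0
      have := hlow j h2 (by omega) y hy
      rw [h0] at this
      simp only [relCard, card_empty, Nat.cast_zero, zero_div] at this
      linarith
    obtain ⟨J, hJ⟩ := h3
    obtain ⟨hJ1, rfl⟩ := mem_ClA.1 hJ
    exact hO.low j h2 hjk J hJ1 b hb hb'
  have haddr : ∀ j, 2 ≤ j → j ≤ k - 1 → ∀ J ∈ O'.toPartFam.cross j,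
      IsAddress j (j - 1) a (O'.addrOf (j - 1) J) := fun j h2 hjk J hJ =>
    isAddress_addrOf hidx' hg1 hlblr (by omega) hJ
  have hε1' : δ * ε₀ * c / 8 ≤ ε₀ * c / 8 := by
    have : δ * (ε₀ * c) ≤ 1 * (ε₀ * c) := mul_le_mul_of_nonneg_right hδ1 (by positivity)
    linarith
  have ha01 : ∀ j, 1 ≤ j → j ≤ k - 1 → (0 : ℝ) ≤ 1 / (a j : ℝ) ∧ 1 / (a j : ℝ) ≤ 1 := by
    intro j h1 hjk
    have : (1 : ℝ) ≤ a j := by exact_mod_cast (ha j h1 hjk).1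
    exact ⟨by positivity, by rw [div_le_one (by linarith)]; exact this⟩
  refine ⟨O', hgW, ⟨mkFam_canon _, hO.lab.le_one, hg1, ?_, hlblr, ?_⟩, ?_, ?_, ?_⟩
  · intro i h1 h2
    have h3 := hg2 i (mem_Icc.2 ⟨h1, h2⟩)
    have h4 : 1 ≤ W'.card / a 1 := by
      rw [h₂.card]
      exact (Nat.one_le_div_iff (by omega)).2 (ha1.2.trans hmA)
    have h5 : 0 < (W'.filter fun v => g v = i).card := by omega
    obtain ⟨v, hv⟩ := card_pos.1 h5
    exact ⟨v, (mem_filter.1 hv).1, (mem_filter.1 hv).2⟩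
  · intro j h2 hjk J hJ b hb hb'
    have hy := haddr j h2 hjk J hJ
    obtain ⟨I, hI⟩ := (hlowclose j h2 hjk _ (addrOf_supp _ _) b).nonempty h₁.pos hc
      (hlow j h2 (by omega) _ hy) hε₀ (ha2 j h2 hjk) (ha01 j (by omega) hjk).2 hε1'
      (hreg j h2 hjk _ hy b hb hb')
    obtain ⟨h3, h4⟩ := mem_inter.1 hI
    exact ⟨I, h4, (mem_filter.1 h3).2⟩
  · intro v hv
    obtain ⟨h1, h2⟩ := hg1 v hv
    exact hg2 (g v) (mem_Icc.2 ⟨h1, h2⟩)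
  · intro j h2 hjk J hJ b hb hb'
    have hy := haddr j h2 hjk J hJ
    exact (hlowclose j h2 hjk _ (addrOf_supp _ _) b).regAt h₁.pos h₂.pos hc
      (hlow j h2 (by omega) _ hy) hε₀ hε₁ hδ hδ1 (ha01 j (by omega) hjk).1
      (ha01 j (by omega) hjk).2 le_rfl (hreg j h2 hjk _ hy b hb hb')
  · intro x hx
    refine (hclose k hk le_rfl x hx.2.2.2 H H' H' (fun S p => eH S fun U => (p U).1) ?_ ?_ ?_).regAt
      h₁.pos h₂.pos hc (hlow k hk le_rfl x hx) hε₀ hε₁ hδ hδ1 (hd x hx).1 (hd x hx).2 le_rfl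
      (hO.top x hx)
    · intro S y hS _; exact hH S y hS
    · intro S y hS _; exact hH' S y hS
    · intro I _ _; rfl

end

end

end HypReg

namespace HypReg

open Finset LabFam
open scoped BigOperators

attribute [local instance 10] Classical.propDecidable

set_option linter.unusedSectionVars false

noncomputable section

/-- Colours on subsets can be transferred between strongly regular colourings. -/
def Transferable (ι κ α φ : Type) [Fintype ι] [DecidableEq ι] [Fintype κ] [Fintype α] [Fintype φ]
    (η ε : ℝ) (n₀ : ℕ) : Prop :=
  ∀ (X Y : ι → Type) [∀ i, Fintype (X i)] [∀ i, Nonempty (X i)] [∀ i, Fintype (Y i)]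
    [∀ i, Nonempty (Y i)],
    (∀ i, n₀ ≤ Fintype.card (X i)) → (∀ i, n₀ ≤ Fintype.card (Y i)) →
    (∀ i j, Fintype.card (X i) ≤ 2 * Fintype.card (X j)) →
    (∀ i j, Fintype.card (Y i) ≤ 2 * Fintype.card (Y j)) →
  ∀ (BX : (∀ i, X i) → Finset ι → κ) (BY : (∀ i, Y i) → Finset ι → κ)
    (β : Finset ι → (Finset ι → κ) → ℝ), IsDep BX → IsDep BY → IsKer β →
    SuperReg BX β ε → SuperReg BY β ε →
  ∀ OX : (∀ i, X i) → Finset ι → α, IsDep OX →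
  ∃ OY : (∀ i, Y i) → Finset ι → α, IsDep OY ∧ (∀ y S, ∃ x, OY y S = OX x S) ∧
  ∀ FY : (∀ i, Y i) → Finset ι → φ, IsDep FY →
  ∃ FX : (∀ i, X i) → Finset ι → φ, IsDep FX ∧
  ∀ Φ : (Finset ι → κ × α × φ) → ℝ, (∀ p, |Φ p| ≤ 1) →
    |(𝔼 x, Φ fun S => (BX x S, OX x S, FX x S)) -
      𝔼 y, Φ fun S => (BY y S, OY y S, FY y S)| ≤ η

section

variable {V V' : Type} [DecidableEq V] [DecidableEq V'] {n m k r : ℕ}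

lemma Equi.le_card {W : Finset V} {ix : V → ℕ} (h : Equi W ix r n) {N : ℕ} (hN : r * (N + 1) ≤ n)
    (i : Fin r) : N + 1 ≤ Fintype.card (VX W ix i) := by
  have : N + 1 ≤ n / r := (Nat.le_div_iff_mul_le h.rpos).2 (by rwa [mul_comm])
  rcases h.size i with h | h <;> omega

lemma Equi.card_le_two_mul {W : Finset V} {ix : V → ℕ} (h : Equi W ix r n) (hn : r ≤ n)
    (i j : Fin r) : Fintype.card (VX W ix i) ≤ 2 * Fintype.card (VX W ix j) := by
  have : 1 ≤ n / r := (Nat.one_le_div_iff h.rpos).2 hn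
  rcases h.size i with h1 | h1 <;> rcases h.size j with h2 | h2 <;> omega

lemma pt_mem_iff_baseCol {F : LabFam V} {T : ℕ} {H : Finset (Finset V)} {S : Finset (Fin r)}
    (hk : 2 ≤ k) (hS : S.card = k) (x : ∀ i : Fin r, VX F.gnd F.vIdx i) :
    pt S x ∈ H ↔ baseCol F k r T H x S = 1 := by
  rw [baseCol, if_neg (by omega), if_pos hS]
  split_ifs with h
  · simp [h]
  · simp [h]

lemma exists_nice_of_transferable {T A n₀ : ℕ} {η ε₂ : ℝ} (hη : 0 ≤ η)
    (htr : Transferable (Fin r) (Fin (T + 2)) (Fin (A + 2)) Bool η ε₂ n₀) (hk : 2 ≤ k)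
    {aQ a : ℕ → ℕ} {ε ε₀ δ c : ℝ} {dQ d : Addr → ℝ} {H : Finset (Finset V)}
    {H' : Finset (Finset V')} {Q O : LabFam V} {Q' : LabFam V'} (hr : aQ 1 = r)
    (hQ : Q.Nice k aQ ε dQ H) (hQ' : Q'.Nice k aQ ε dQ H') (hO : O.Nice k a ε₀ d H)
    (hOQ : O.gnd = Q.gnd) (hn : Q.gnd.card = n) (hm : Q'.gnd.card = m)
    (hε : 0 ≤ ε) (hε₂ : (T + 2 : ℝ) ^ (2 ^ r) * ε ≤ ε₂) (hdQ : DensityFun k aQ dQ)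
    (haQ : ∀ i, 1 ≤ i → i ≤ k - 1 → 1 ≤ aQ i ∧ aQ i ≤ T)
    (hn₀ : r * (n₀ + 1) ≤ n) (hm₀ : r * (n₀ + 1) ≤ m)
    (ha : ∀ i, 1 ≤ i → i ≤ k - 1 → 1 ≤ a i ∧ a i ≤ A) (hd : DensityFun k a d)
    (hε₀ : 0 < ε₀) (hε₁ : ε₀ ≤ 1) (hδ : 0 < δ) (hδ1 : δ ≤ 1)
    (ha2 : ∀ j, 2 ≤ j → j ≤ k - 1 → 2 * ε₀ ≤ 1 / (a j : ℝ)) (hc : 0 < c)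
    (hlow : ∀ j, 2 ≤ j → j ≤ k → ∀ y, IsAddress j (j - 1) a y → c ≤ relCard n j (O.ClA j y))
    (hmA : A ≤ m)
    (herr : (η + cmpErr r n m k) + A * (1 / n + (η + cmpErr r n m k) + 2 / m) ≤ δ * ε₀ * c / 8) :
    ∃ O' : LabFam V', O'.gnd = Q'.gnd ∧ O'.Nice k a (ε₀ + δ) d H' := by
  subst hr hn hm
  have h₁ := Nice.equi hQ hk
  have h₂ := Nice.equi hQ' hk
  have := h₁.ne
  have := h₂.ne
  have hle : aQ 1 ≤ aQ 1 * (n₀ + 1) := Nat.le_mul_of_pos_right _ (by omega)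
  obtain ⟨OY, hOY, hOX, hF⟩ := htr (fun i : Fin (aQ 1) => VX Q.gnd Q.vIdx i)
    (fun i : Fin (aQ 1) => VX Q'.gnd Q'.vIdx i)
    (fun i => (Nat.le_succ _).trans (h₁.le_card hn₀ i))
    (fun i => (Nat.le_succ _).trans (h₂.le_card hm₀ i))
    (h₁.card_le_two_mul (hle.trans hn₀)) (h₂.card_le_two_mul (hle.trans hm₀))
    (baseCol Q k (aQ 1) T H) (baseCol Q' k (aQ 1) T H') (baseKer k aQ dQ (aQ 1) T)
    (baseCol_isDep H) (baseCol_isDep H') (baseKer_isKer hk haQ)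
    (fun S e => (Nice.superReg hk hQ hε hdQ haQ S e).mono hε₂)
    (fun S e => (Nice.superReg hk hQ' hε hdQ haQ S e).mono hε₂)
    (codeCol (aQ 1) A O k) (codeCol_isDep O k)
  exact exists_nice_of_transfer hOQ h₁ h₂ hη hOY hOX hF (fun S p => p S = 1)
    (fun S x hS => pt_mem_iff_baseCol hk hS x) (fun S x hS => pt_mem_iff_baseCol hk hS x)
    hk hO ha hd hε₀ hε₁ hδ hδ1 ha2 hc hlow hmA herr

end

section Numerics

lemma error_bound {A r k n m : ℕ} {η σ θ : ℝ} (hσ : 0 < σ) (hθ : 4 * (A + 1) * σ ≤ θ)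
    (hη : η ≤ σ) (hr : 1 / (r : ℝ) ≤ σ / 2) (hn1 : 1 ≤ n) (hm1 : 1 ≤ m)
    (hn : (3 + 2 ^ r * k) / σ ≤ (n : ℝ)) (hm : (3 + 2 ^ r * k) / σ ≤ (m : ℝ)) :
    (η + cmpErr r n m k) + A * (1 / n + (η + cmpErr r n m k) + 2 / m) ≤ θ := by
  have hn0 : (0 : ℝ) < n := by exact_mod_cast hn1
  have hm0 : (0 : ℝ) < m := by exact_mod_cast hm1
  rw [div_le_comm₀ hσ hn0] at hn
  rw [div_le_comm₀ hσ hm0] at hm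
  have e1 : cmpErr r n m k = 2 * (1 / r) + (1 + 2 ^ r * k) / n + (1 + 2 ^ r * k) / m := by
    unfold cmpErr; ring
  have e2 : ((3 : ℝ) + 2 ^ r * k) / n = 2 * (1 / n) + (1 + 2 ^ r * k) / n := by ring
  have e3 : ((3 : ℝ) + 2 ^ r * k) / m = 2 / m + (1 + 2 ^ r * k) / m := by ring
  have p1 : (0 : ℝ) < 1 / n := by positivity
  have p2 : (0 : ℝ) < 2 / m := by positivity
  rw [e2] at hn
  rw [e3] at hm
  have h1 : η + cmpErr r n m k ≤ 4 * σ := by rw [e1]; linarith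
  have h2 : 1 / n + (η + cmpErr r n m k) + 2 / m ≤ 4 * σ := by rw [e1]; linarith
  calc _ ≤ 4 * σ + A * (4 * σ) := by gcongr
    _ = 4 * (A + 1) * σ := by ring
    _ ≤ θ := hθ

lemma pow_bound {k : ℕ} {t ε₀ : ℝ} (hε : 0 ≤ ε₀) (ht : 2 ≤ t) (h : ε₀ / 2 ≤ 1 / (4 * t ^ (4 ^ k))) :
    2 ^ k * ε₀ ≤ (1 / t) ^ (2 ^ k) / 2 ∧ 2 * ε₀ ≤ 1 / t := by
  have ht0 : 0 < t := by linarith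
  have ht1 : 1 ≤ t := by linarith
  have h1 : ε₀ ≤ 1 / t ^ (4 ^ k) / 2 := by
    have : 1 / (4 * t ^ (4 ^ k)) = 1 / t ^ (4 ^ k) / 4 := by rw [mul_comm, div_mul_eq_div_div]
    linarith
  constructor
  · have h2 : (2 : ℝ) ^ k ≤ t ^ k := by gcongr
    have h3 : k + 2 ^ k ≤ 4 ^ k := by
      have a1 : k < 2 ^ k := Nat.lt_two_pow_self
      have a2 : 4 ^ k = 2 ^ k * 2 ^ k := by rw [← mul_pow]; norm_num
      rcases Nat.eq_zero_or_pos k with rfl | hk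
      · simp
      · have : 2 ≤ 2 ^ k := by calc 2 = 2 ^ 1 := rfl
            _ ≤ 2 ^ k := Nat.pow_le_pow_right (by omega) hk
        nlinarith
    have h4 : t ^ k * t ^ (2 ^ k) ≤ t ^ (4 ^ k) := by
      rw [← pow_add]; exact pow_le_pow_right₀ ht1 h3
    calc 2 ^ k * ε₀ ≤ t ^ k * (1 / t ^ (4 ^ k) / 2) := by gcongr
      _ = t ^ k / t ^ (4 ^ k) / 2 := by ring
      _ ≤ (1 / t) ^ (2 ^ k) / 2 := by
        gcongr
        rw [one_div_pow, div_le_div_iff₀ (by positivity) (by positivity), one_mul]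
        exact h4
  · have h5 : t ≤ t ^ (4 ^ k) := le_self_pow₀ ht1 (by positivity)
    have h6 : 1 / t ^ (4 ^ k) ≤ 1 / t := one_div_le_one_div_of_le ht0 h5
    linarith

lemma exists_maxA_bound {eRI : ℕ → ℕ → ℝ} (hERI : GoodERI eRI) (k : ℕ) {ε₀ : ℝ} (hε₀ : 0 < ε₀) :
    ∃ A : ℕ, 1 ≤ A ∧ ∀ a d, RegInstance eRI k (ε₀ / 2) a d → maxA k a ≤ A := by
  obtain ⟨-, -, -, h, -⟩ := hERI
  obtain ⟨A, hA⟩ := Filter.eventually_atTop.1 ((h k).eventually (gt_mem_nhds (half_pos hε₀)))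
  refine ⟨A + 1, by omega, fun a d hR => ?_⟩
  by_contra hlt
  have h1 := hA (maxA k a) (by omega)
  have h2 := hR.2.2.2.1
  linarith

lemma le_maxA {k i : ℕ} {a : ℕ → ℕ} (h1 : 1 ≤ i) (h2 : i ≤ k - 1) : a i ≤ maxA k a :=
  le_sup (f := a) (mem_Icc.2 ⟨h1, h2⟩)

lemma RegInstance.bound {eRI : ℕ → ℕ → ℝ} (hERI : GoodERI eRI) {k : ℕ} (hk : 3 ≤ k) {ε₀ : ℝ}
    {a : ℕ → ℕ} {d : Addr → ℝ} (hR : RegInstance eRI k (ε₀ / 2) a d) :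
    ε₀ / 2 ≤ 1 / (4 * (maxA k a : ℝ) ^ (4 ^ k)) := by
  obtain ⟨-, -, -, -, eCL, mCL, hC, hlt⟩ := hERI
  have ht : 1 ≤ maxA k a := (hR.2.1 1 le_rfl (by omega)).trans (le_maxA le_rfl (by omega))
  have ht0 : (0 : ℝ) < maxA k a := by exact_mod_cast ht
  refine (hR.2.2.2.1.trans (hlt _ k ht (by omega)).le).trans ?_
  have := (hC (1 / (maxA k a : ℝ)) (1 / (maxA k a : ℝ)) (by positivity) (by positivity) (k - 1) k
    (by omega) (by omega)).1.2
  gcongr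

end Numerics

section Lower

variable {V : Type} [DecidableEq V]

lemma Nice.le_relCard {F : LabFam V} {k n A t : ℕ} {a : ℕ → ℕ} {ε : ℝ} {d : Addr → ℝ}
    {H : Finset (Finset V)} (hF : F.Nice k a ε d H) (hε : 0 ≤ ε) (hk : 2 ≤ k)
    (ha : ∀ i, 1 ≤ i → i ≤ k - 1 → 1 ≤ a i ∧ a i ≤ t) (htA : t ≤ A)
    (hεt : 3 ≤ k → 2 ^ k * ε ≤ (1 / (t : ℝ)) ^ (2 ^ k) / 2) (hn : F.gnd.card = n)
    (hnA : 2 * A ≤ n) {j : ℕ} (h2 : 2 ≤ j) (hjk : j ≤ k) {y : Addr} (hy : IsAddress j (j - 1) a y) :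
    (1 / (A : ℝ)) ^ (2 ^ k) / 2 * (1 / (2 * A)) ^ k ≤ relCard n j (F.ClA j y) := by
  obtain ⟨h1, h1t⟩ := ha 1 le_rfl (by omega)
  have ht1 : 1 ≤ t := h1.trans h1t
  have ht0 : (1 : ℝ) ≤ t := by exact_mod_cast ht1
  have hA0 : (1 : ℝ) ≤ A := by exact_mod_cast ht1.trans htA
  have htA' : (t : ℝ) ≤ A := by exact_mod_cast htA
  have hn1 : 1 ≤ n := by omega
  have hn0 : (0 : ℝ) < n := by exact_mod_cast hn1
  have key := Nice.lower hF hε (fun i h h' => (ha i h h').1) h2 hjk hy ht0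
    (fun i h h' => by exact_mod_cast (ha i h h').2) hεt (q := n / a 1) fun v hv => by
      rcases hF.size v hv with h | h <;> rw [hn] at h <;> omega
  have hq : (n : ℝ) / (2 * A) ≤ ((n / a 1 : ℕ) : ℝ) := by
    have h3 : n / A ≤ n / a 1 := Nat.div_le_div_left (h1t.trans htA) h1
    have h4 : n ≤ (n / A + 1) * A := by
      have := Nat.lt_div_mul_add (a := n) (b := A) (by omega)
      rw [add_mul, one_mul]; omega
    have h5 : 2 ≤ n / A := (Nat.le_div_iff_mul_le (by omega)).2 hnA
    have h6 : n ≤ (n / a 1) * (2 * A) := by nlinarith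
    rw [div_le_iff₀ (by positivity)]
    exact_mod_cast h6
  unfold relCard
  rw [le_div_iff₀ (by positivity)]
  refine le_trans ?_ key
  rw [mul_assoc]
  have h7 : (1 / (A : ℝ)) ^ (2 ^ k) / 2 ≤ (1 / (t : ℝ)) ^ (2 ^ k) / 2 := by gcongr
  have h8 : (1 / (2 * (A : ℝ))) ^ k * (n : ℝ) ^ j ≤ ((n / a 1 : ℕ) : ℝ) ^ j := by
    calc (1 / (2 * (A : ℝ))) ^ k * (n : ℝ) ^ j ≤ (1 / (2 * (A : ℝ))) ^ j * (n : ℝ) ^ j := by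
          gcongr ?_ * _
          refine pow_le_pow_of_le_one (by positivity) ?_ hjk
          rw [div_le_one (by positivity)]; linarith
      _ = ((n : ℝ) / (2 * A)) ^ j := by rw [← mul_pow]; congr 1; ring
      _ ≤ _ := by gcongr
  gcongr

end Lower

end

end HypReg

namespace HypReg

open Finset

/-- Key lemma: if two hypergraphs admit equitable partitions with the same parameters and
the same density function, then every equitable partition of the first can be transferred
to the second at the cost of an additive increase of the regularity parameter. -/
theorem transfer_equitable_partitions (eRI : ℕ → ℕ → ℝ) (hERI : GoodERI eRI) :
    ∀ k : ℕ, 2 ≤ k → ∀ ε₀ : ℝ, 0 < ε₀ → ε₀ ≤ 1 →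
    ∃ δ₀ : ℝ, 0 < δ₀ ∧ ∀ δ : ℝ, 0 < δ → δ ≤ δ₀ →
    ∃ c₁ : ℝ, 0 < c₁ ∧ ∀ T a1 : ℕ, 1 ≤ T → 1 ≤ a1 →
      (1 : ℝ) / (T : ℝ) ≤ c₁ → (1 : ℝ) / (a1 : ℝ) ≤ c₁ →
    ∃ ε₁ : ℝ, 0 < ε₁ ∧ ∀ ε : ℝ, 0 < ε → ε ≤ ε₁ →
    ∃ n₀ : ℕ, ∀ n m : ℕ, n₀ ≤ n → n₀ ≤ m →
    ∀ (V₁ : Type) [DecidableEq V₁], ∀ (V₂ : Type) [DecidableEq V₂],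
    ∀ (W₁ : Finset V₁) (W₂ : Finset V₂), W₁.card = n → W₂.card = m →
    ∀ aQ : ℕ → ℕ, aQ 1 = a1 → (∀ i, 1 ≤ i → i ≤ k - 1 → 1 ≤ aQ i ∧ aQ i ≤ T) →
    ∀ dQ : Addr → ℝ, DensityFun k aQ dQ →
    ∀ (aO : ℕ → ℕ) (dO : Addr → ℝ), RegInstance eRI k (ε₀ / 2) aO dO →
    ∀ (H₁ : Finset (Finset V₁)) (H₂ : Finset (Finset V₂)),
    IsKGraph W₁ k H₁ → IsKGraph W₂ k H₂ →
    -- (P1)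
    ∀ Q₁ : LabFam V₁, Q₁.gnd = W₁ → Q₁.IsEquitPartition k aQ ε dQ H₁ →
    -- (P2)
    ∀ Q₂ : LabFam V₂, Q₂.gnd = W₂ → Q₂.IsEquitPartition k aQ ε dQ H₂ →
    -- (P3)
    ∀ O₁ : LabFam V₁, O₁.gnd = W₁ → O₁.IsEquitPartition k aO ε₀ dO H₁ →
    ∃ O₂ : LabFam V₂, O₂.gnd = W₂ ∧ O₂.IsEquitPartition k aO (ε₀ + δ) dO H₂ := by
  intro k hk ε₀ hε₀ hε₁
  obtain ⟨A, hA1, hA⟩ := exists_maxA_bound hERI k hε₀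
  have hA0 : (0 : ℝ) < A := by exact_mod_cast hA1
  set c : ℝ := (1 / (A : ℝ)) ^ (2 ^ k) / 2 * (1 / (2 * A)) ^ k with hc
  have hc0 : 0 < c := by positivity
  refine ⟨1, one_pos, fun δ hδ hδ1 => ?_⟩
  set σ : ℝ := δ * ε₀ * c / 8 / (4 * (A + 1)) with hσ
  have hσ0 : 0 < σ := by positivity
  refine ⟨σ / 2, by positivity, fun T a1 _ _ _ ha1 => ?_⟩
  obtain ⟨ε₂, hε₂, n₁, htr⟩ :=
    transfer_colours (Fin a1) (Fin (T + 2)) (Fin (A + 2)) Bool hσ0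
  refine ⟨ε₂ / (T + 2 : ℝ) ^ (2 ^ a1), by positivity, fun ε hε hεε => ?_⟩
  refine ⟨1 + a1 * (n₁ + 1) + 2 * A + ⌈(3 + 2 ^ a1 * k : ℝ) / σ⌉₊, ?_⟩
  intro n m hn hm V₁ _ V₂ _ W₁ W₂ hW₁ hW₂ aQ haQ1 haQ dQ hdQ aO dO hR H₁ H₂ _ _ Q₁ hQ₁ hP₁ Q₂ hQ₂
    hP₂ O₁ hO₁ hP₃
  rw [LabFam.isEquitPartition_iff hk] at hP₁ hP₂ hP₃
  have hn' : (3 + 2 ^ a1 * k : ℝ) / σ ≤ n :=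
    (Nat.le_ceil _).trans (by exact_mod_cast (Nat.le_add_left _ _).trans hn)
  have hm' : (3 + 2 ^ a1 * k : ℝ) / σ ≤ m :=
    (Nat.le_ceil _).trans (by exact_mod_cast (Nat.le_add_left _ _).trans hm)
  have haO : ∀ i, 1 ≤ i → i ≤ k - 1 → 1 ≤ aO i ∧ aO i ≤ maxA k aO := fun i h1 h2 =>
    ⟨hR.2.1 i h1 h2, le_maxA h1 h2⟩
  have htA := hA aO dO hR
  have ht2 : (2 : ℝ) ≤ maxA k aO := by
    exact_mod_cast hk.trans (hP₃.lab.le_one.trans (haO 1 le_rfl (by omega)).2)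
  have hb : 3 ≤ k → 2 ^ k * ε₀ ≤ (1 / (maxA k aO : ℝ)) ^ (2 ^ k) / 2 ∧
      2 * ε₀ ≤ 1 / (maxA k aO : ℝ) := fun h3 => pow_bound hε₀.le ht2 (hR.bound hERI h3)
  obtain ⟨O₂, h1, h2⟩ := exists_nice_of_transferable hσ0.le htr hk haQ1 hP₁ hP₂ hP₃
    (hO₁.trans hQ₁.symm) (by rw [hQ₁, hW₁]) (by rw [hQ₂, hW₂]) hε.le
    (by rwa [le_div_iff₀' (by positivity)] at hεε) hdQ haQ (n := n) (m := m) (c := c) (δ := δ)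
    (by omega) (by omega) (fun i h h' => ⟨(haO i h h').1, (haO i h h').2.trans htA⟩) hR.2.2.2.2
    hε₀ hε₁ hδ hδ1
    (fun j h2 hjk => (hb (by omega)).2.trans (one_div_le_one_div_of_le
      (by exact_mod_cast (haO j (by omega) hjk).1) (by exact_mod_cast (haO j (by omega) hjk).2)))
    hc0
    (fun j h2 hjk y hy => Nice.le_relCard hP₃ hε₀.le hk haO htA (fun h3 => (hb h3).1)
      (by rw [hO₁, hW₁]) (by omega) h2 hjk hy)
    (by omega)
    (error_bound hσ0 (le_of_eq (by rw [hσ]; field_simp)) le_rfl ha1 (by omega) (by omega) hn' hm')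
  exact ⟨O₂, h1.trans hQ₂, (LabFam.isEquitPartition_iff hk).2 h2⟩

end HypReg
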